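/- Theorem 2.7(i): Let δ ∈ (0,1] and p ∈ (d,∞) satisfy γ := δ − d/p > 0. Suppose the symmetric, measurable, uniformly elliptic coefficients a^{ij} are uniformly continuous in (x^1,…,x^{d−1}) with modulus ω_a, merely measurable in x^d, and satisfy [a]_{x',δ;B_1} := max_{i,j}[a^{ij}]_{x',δ;B_1} < ∞. Then there is a constant N depending only on d, q, ν, p, δ and ω_a such that: if u is a classical solution of a^{ij}D_{ij}u = f in B_1 with ‖D²u‖_{L_p(B_1)} < ∞ and [f]_{x',γ;B_1} < ∞, then for all 1 ≤ i ≤ q and all 1 ≤ k ≤ d, [D_k D_i u]_{γ;B_{1/2}} ≤ N ( [f]_{x',γ;B_1} + (1 + [a]_{x',δ;B_1}) ‖D²u‖_{L_p(B_1)} ). -/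

import Mathlib

open MeasureTheory Metric Set Filter

noncomputable section

/-- First-order partial derivative `D_i`. -/
def pd {d : ℕ} (i : Fin d) (v : EuclideanSpace ℝ (Fin d) → ℝ)
    (x : EuclideanSpace ℝ (Fin d)) : ℝ :=
  fderiv ℝ v x (EuclideanSpace.single i 1)

/-- Second-order partial derivative `D_i D_j`. -/
def pd2 {d : ℕ} (i j : Fin d) (v : EuclideanSpace ℝ (Fin d) → ℝ)
    (x : EuclideanSpace ℝ (Fin d)) : ℝ :=
  pd i (fun y => pd j v y) x

/-- Partial Hölder bound with respect to the first `q` coordinates: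
`|g x - g y| ≤ K |x' - y'|^δ` whenever `x'' = y''` (note `dist x y = |x' - y'|` then). -/
def PHolderX (d q : ℕ) (δ : ℝ) (Ω : Set (EuclideanSpace ℝ (Fin d)))
    (g : EuclideanSpace ℝ (Fin d) → ℝ) (K : ℝ) : Prop :=
  ∀ x ∈ Ω, ∀ y ∈ Ω, (∀ i : Fin d, q ≤ (i : ℕ) → x i = y i) →
    |g x - g y| ≤ K * dist x y ^ δ

/-- Full Hölder bound. -/
def HolderB {d : ℕ} (δ : ℝ) (Ω : Set (EuclideanSpace ℝ (Fin d)))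
    (g : EuclideanSpace ℝ (Fin d) → ℝ) (K : ℝ) : Prop :=
  ∀ x ∈ Ω, ∀ y ∈ Ω, |g x - g y| ≤ K * dist x y ^ δ

/-- Uniform ellipticity with constant `ν` (two-sided bound). -/
def UnifElliptic (d : ℕ) (ν : ℝ)
    (a : Fin d → Fin d → EuclideanSpace ℝ (Fin d) → ℝ) : Prop :=
  ∀ (x : EuclideanSpace ℝ (Fin d)) (ξ : Fin d → ℝ),
    ν * ∑ i, ξ i ^ 2 ≤ ∑ i, ∑ j, a i j x * ξ i * ξ j ∧
      ∑ i, ∑ j, a i j x * ξ i * ξ j ≤ ν⁻¹ * ∑ i, ξ i ^ 2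

/-- Hilbert–Schmidt norm of the Hessian. -/
def hessNorm {d : ℕ} (v : EuclideanSpace ℝ (Fin d) → ℝ)
    (x : EuclideanSpace ℝ (Fin d)) : ℝ :=
  Real.sqrt (∑ i, ∑ j, pd2 i j v x ^ 2)

/-- Euclidean norm of the gradient. -/
def gradNorm {d : ℕ} (v : EuclideanSpace ℝ (Fin d) → ℝ)
    (x : EuclideanSpace ℝ (Fin d)) : ℝ :=
  Real.sqrt (∑ i, pd i v x ^ 2)

abbrev Eu (d : ℕ) := EuclideanSpace ℝ (Fin d)

/-- coordinate vector -/
abbrev ev {d : ℕ} (i : Fin d) : Eu d := EuclideanSpace.single i (1 : ℝ)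

/-- operator -/
def LL {d : ℕ} (a : Fin d → Fin d → Eu d → ℝ) (v : Eu d → ℝ) (x : Eu d) : ℝ :=
  ∑ i, ∑ j, a i j x * pd2 i j v x

def hs {d : ℕ} (v : Eu d → ℝ) (x : Eu d) : ℝ := ∑ i, ∑ j, pd2 i j v x ^ 2

def gs {d : ℕ} (v : Eu d → ℝ) (x : Eu d) : ℝ := ∑ i, pd i v x ^ 2

section calculus
variable {d : ℕ}

lemma pd_contDiff {u : Eu d → ℝ} (hu : ContDiff ℝ 2 u) (i : Fin d) : ContDiff ℝ 1 (pd i u) := by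
  unfold pd
  exact (hu.fderiv_right (m := 1) (by norm_num)).clm_apply contDiff_const

lemma pd_cont {u : Eu d → ℝ} (hu : ContDiff ℝ 1 u) (i : Fin d) : Continuous (pd i u) := by
  unfold pd
  exact ((hu.continuous_fderiv (by norm_num))).clm_apply continuous_const

lemma pd2_eq {u : Eu d → ℝ} (i j : Fin d) : pd2 i j u = pd i (pd j u) := rfl

lemma pd2_cont {u : Eu d → ℝ} (hu : ContDiff ℝ 2 u) (i j : Fin d) : Continuous (pd2 i j u) :=
  pd_cont (pd_contDiff hu j) i

lemma hs_cont {u : Eu d → ℝ} (hu : ContDiff ℝ 2 u) : Continuous (hs u) := by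
  unfold hs
  exact continuous_finsetSum _ fun i _ => continuous_finsetSum _ fun j _ => (pd2_cont hu i j).pow 2

lemma gs_cont {u : Eu d → ℝ} (hu : ContDiff ℝ 1 u) : Continuous (gs u) := by
  unfold gs
  exact continuous_finsetSum _ fun i _ => (pd_cont hu i).pow 2

lemma hs_nonneg (u : Eu d → ℝ) (x) : 0 ≤ hs u x :=
  Finset.sum_nonneg fun _ _ => Finset.sum_nonneg fun _ _ => sq_nonneg _

lemma gs_nonneg (u : Eu d → ℝ) (x) : 0 ≤ gs u x :=
  Finset.sum_nonneg fun _ _ => sq_nonneg _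

lemma pd2_symm {u : Eu d → ℝ} (hu : ContDiff ℝ 2 u) (i j : Fin d) (x : Eu d) :
    pd2 i j u x = pd2 j i u x := by
  have key : ∀ i j : Fin d, pd2 i j u x = fderiv ℝ (fderiv ℝ u) x (ev i) (ev j) := by
    intro i j
    unfold pd2 pd
    have hd : DifferentiableAt ℝ (fderiv ℝ u) x :=
      ((hu.fderiv_right (m := 1) (by norm_num)).differentiable (by norm_num)).differentiableAt
    rw [fderiv_clm_apply hd (differentiableAt_const _)]
    simp
  rw [key, key]
  exact (hu.contDiffAt.isSymmSndFDerivAt (by simp)).eq _ _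

lemma pd_shift (u : Eu d → ℝ) (i : Fin d) (h x : Eu d) :
    pd i (fun y => u (y + h)) x = pd i u (x + h) := by
  unfold pd; rw [fderiv_comp_add_right]

lemma pd2_shift (u : Eu d → ℝ) (i j : Fin d) (h x : Eu d) :
    pd2 i j (fun y => u (y + h)) x = pd2 i j u (x + h) := by
  unfold pd2
  simp only [pd_shift]

lemma pd_sub {u v : Eu d → ℝ} (hu : Differentiable ℝ u) (hv : Differentiable ℝ v) (i : Fin d)
    (x : Eu d) : pd i (fun y => u y - v y) x = pd i u x - pd i v x := by
  unfold pd; rw [fderiv_fun_sub (hu x) (hv x)]; rfl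

lemma pd_const_mul {u : Eu d → ℝ} (hu : Differentiable ℝ u) (c : ℝ) (i : Fin d)
    (x : Eu d) : pd i (fun y => c * u y) x = c * pd i u x := by
  unfold pd; rw [fderiv_const_mul (hu x)]; rfl

lemma pd_mul {u v : Eu d → ℝ} (hu : Differentiable ℝ u) (hv : Differentiable ℝ v) (i : Fin d)
    (x : Eu d) : pd i (fun y => u y * v y) x = u x * pd i v x + v x * pd i u x := by
  unfold pd; rw [fderiv_fun_mul (hu x) (hv x)]; simp

lemma pd_add {u v : Eu d → ℝ} (hu : Differentiable ℝ u) (hv : Differentiable ℝ v) (i : Fin d)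
    (x : Eu d) : pd i (fun y => u y + v y) x = pd i u x + pd i v x := by
  unfold pd; rw [fderiv_fun_add (hu x) (hv x)]; rfl

lemma pd_const (c : ℝ) (i : Fin d) (x : Eu d) : pd i (fun _ : Eu d => c) x = 0 := by
  unfold pd; simp

lemma diff2 {u : Eu d → ℝ} (hu : ContDiff ℝ 2 u) : Differentiable ℝ u := hu.differentiable (by norm_num)
lemma diff1 {u : Eu d → ℝ} (hu : ContDiff ℝ 1 u) : Differentiable ℝ u := hu.differentiable (by norm_num)
lemma diffpd {u : Eu d → ℝ} (hu : ContDiff ℝ 2 u) (i) : Differentiable ℝ (pd i u) := diff1 (pd_contDiff hu i)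

lemma pd2_sub {u v : Eu d → ℝ} (hu : ContDiff ℝ 2 u) (hv : ContDiff ℝ 2 v) (i j : Fin d)
    (x : Eu d) : pd2 i j (fun y => u y - v y) x = pd2 i j u x - pd2 i j v x := by
  unfold pd2
  simp only [pd_sub (diff2 hu) (diff2 hv)]
  exact pd_sub (diffpd hu j) (diffpd hv j) i x

lemma pd2_const_mul {u : Eu d → ℝ} (hu : ContDiff ℝ 2 u) (c : ℝ) (i j : Fin d)
    (x : Eu d) : pd2 i j (fun y => c * u y) x = c * pd2 i j u x := by
  unfold pd2
  simp only [pd_const_mul (diff2 hu)]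
  exact pd_const_mul (diffpd hu j) c i x

lemma pd2_mul {u v : Eu d → ℝ} (hu : ContDiff ℝ 2 u) (hv : ContDiff ℝ 2 v) (i j : Fin d)
    (x : Eu d) : pd2 i j (fun y => u y * v y) x =
      u x * pd2 i j v x + pd i u x * pd j v x + pd j u x * pd i v x + v x * pd2 i j u x := by
  unfold pd2
  simp only [pd_mul (diff2 hu) (diff2 hv)]
  rw [pd_add (u := fun y => u y * pd j v y) (v := fun y => v y * pd j u y)
    ((diff2 hu).mul (diffpd hv j)) ((diff2 hv).mul (diffpd hu j)),
    pd_mul (diff2 hu) (diffpd hv j), pd_mul (diff2 hv) (diffpd hu j)]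
  ring

/-- linear function -/
def lin (c : Fin d → ℝ) (x : Eu d) : ℝ := ∑ k, c k * x k

lemma lin_contDiff (c : Fin d → ℝ) {n} : ContDiff ℝ n (lin c) := by
  unfold lin; fun_prop

lemma pd_lin (c : Fin d → ℝ) (i : Fin d) (x : Eu d) : pd i (lin c) x = c i := by
  let l : Eu d →L[ℝ] ℝ := ∑ k, c k • (EuclideanSpace.proj k : Eu d →L[ℝ] ℝ)
  have : lin c = l := by
    ext x; simp [lin, l]
  unfold pd
  rw [this, l.fderiv]
  simp [l]

lemma pd2_lin (c : Fin d → ℝ) (i j : Fin d) (x : Eu d) : pd2 i j (lin c) x = 0 := by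
  unfold pd2; simp only [pd_lin]; exact pd_const _ _ _

lemma pd_scale {u : Eu d → ℝ} (hu : Differentiable ℝ u) (x0 : Eu d) (r : ℝ) (i : Fin d) (x : Eu d) :
    pd i (fun y => u (x0 + r • y)) x = r * pd i u (x0 + r • x) := by
  unfold pd
  have h1 : HasFDerivAt (fun y : Eu d => x0 + r • y) (r • ContinuousLinearMap.id ℝ (Eu d)) x :=
    ((hasFDerivAt_id x).const_smul r).const_add x0
  have h2 := ((hu (x0 + r • x)).hasFDerivAt).comp x h1
  have : fderiv ℝ (fun y => u (x0 + r • y)) x = _ := h2.fderiv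
  rw [this]; simp

lemma pd2_scale {u : Eu d → ℝ} (hu : ContDiff ℝ 2 u) (x0 : Eu d) (r : ℝ) (i j : Fin d) (x : Eu d) :
    pd2 i j (fun y => u (x0 + r • y)) x = r ^ 2 * pd2 i j u (x0 + r • x) := by
  unfold pd2
  simp only [pd_scale (diff2 hu)]
  have := pd_scale (diffpd hu j) x0 r i x
  rw [pd_const_mul (u := fun y => pd j u (x0 + r • y))]
  · rw [this]; ring
  · exact (diffpd hu j).comp (by fun_prop)

lemma LL_sub {a : Fin d → Fin d → Eu d → ℝ} {u v : Eu d → ℝ} (hu : ContDiff ℝ 2 u) (hv : ContDiff ℝ 2 v)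
    (x : Eu d) : LL a (fun y => u y - v y) x = LL a u x - LL a v x := by
  unfold LL
  simp only [pd2_sub hu hv, mul_sub, Finset.sum_sub_distrib]

lemma LL_const_mul {a : Fin d → Fin d → Eu d → ℝ} {u : Eu d → ℝ} (hu : ContDiff ℝ 2 u) (c : ℝ)
    (x : Eu d) : LL a (fun y => c * u y) x = c * LL a u x := by
  unfold LL
  simp only [pd2_const_mul hu, Finset.mul_sum]
  refine Finset.sum_congr rfl fun i _ => Finset.sum_congr rfl fun j _ => by ring

lemma LL_shift {a : Fin d → Fin d → Eu d → ℝ} {u : Eu d → ℝ} (h : Eu d)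
    (ha : ∀ i j x, a i j (x + h) = a i j x) (x : Eu d) :
    LL a (fun y => u (y + h)) x = LL a u (x + h) := by
  unfold LL
  simp only [pd2_shift, ha]

lemma LL_lin {a : Fin d → Fin d → Eu d → ℝ} (c : Fin d → ℝ) (x : Eu d) : LL a (lin c) x = 0 := by
  unfold LL; simp [pd2_lin]

/-- derivative along line -/
lemma hasDerivAt_line {g : Eu d → ℝ} (hg : ContDiff ℝ 1 g) (i : Fin d) (x : Eu d) (s : ℝ) :
    HasDerivAt (fun s : ℝ => g (x + s • ev i)) (pd i g (x + s • ev i)) s := by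
  have h1 : HasDerivAt (fun s : ℝ => x + s • ev i) (ev i) s := by
    simpa using ((hasDerivAt_id s).smul_const (ev i)).const_add x
  exact ((diff1 hg (x + s • ev i)).hasFDerivAt).comp_hasDerivAt s h1

lemma ftc_line {g : Eu d → ℝ} (hg : ContDiff ℝ 1 g) (i : Fin d) (x : Eu d) (t : ℝ) :
    ∫ s in (0:ℝ)..t, pd i g (x + s • ev i) = g (x + t • ev i) - g x := by
  rw [intervalIntegral.integral_eq_sub_of_hasDerivAt (fun s _ => hasDerivAt_line hg i x s)]
  · simp
  · apply Continuous.intervalIntegrable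
    exact (pd_cont hg i).comp (by fun_prop)

end calculus

section ibp
variable {d : ℕ}

def slp (g : Eu d → ℝ) (j : Fin d) (t : ℝ) (x : Eu d) : ℝ := (g (x + t • ev j) - g x) / t

lemma norm_ev (j : Fin d) : ‖(ev j : Eu d)‖ = 1 := by simp [ev]

lemma slp_tendsto {g : Eu d → ℝ} (hg : ContDiff ℝ 1 g) (j : Fin d) (x : Eu d) :
    Tendsto (fun t => slp g j t x) (nhdsWithin 0 {0}ᶜ) (nhds (pd j g x)) := by
  have h := hasDerivAt_line hg j x 0
  rw [hasDerivAt_iff_tendsto_slope] at h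
  simp only [zero_smul, add_zero] at h
  refine h.congr fun t => ?_
  simp [slope, slp, div_eq_inv_mul]

lemma slp_bound {g : Eu d → ℝ} (hg : ContDiff ℝ 1 g) (cg : HasCompactSupport g) :
    ∃ C : ℝ, 0 ≤ C ∧ ∀ j t x, |slp g j t x| ≤ C := by
  obtain ⟨C, hC⟩ := hg.lipschitzWith_of_hasCompactSupport cg (by norm_num)
  refine ⟨C, C.2, fun j t x => ?_⟩
  unfold slp
  rw [abs_div]
  have := hC.dist_le_mul (x + t • ev j) x
  rw [Real.dist_eq] at this
  have e : dist (x + t • ev j) x = |t| := by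
    rw [dist_eq_norm, add_sub_cancel_left, norm_smul, norm_ev, mul_one, Real.norm_eq_abs]
  rw [e] at this
  exact div_le_of_le_mul₀ (abs_nonneg _) C.2 this

lemma slp_cont {g : Eu d → ℝ} (hg : Continuous g) (j : Fin d) (t : ℝ) : Continuous (slp g j t) := by
  unfold slp
  exact ((hg.comp (by fun_prop)).sub hg).div_const _

lemma slp_lim {g h b : Eu d → ℝ} (hg : ContDiff ℝ 1 g) (hh : ContDiff ℝ 1 h)
    (cg : HasCompactSupport g) (ch : HasCompactSupport h) (hb : Measurable b) (B : ℝ)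
    (hbB : ∀ x, |b x| ≤ B) (j k : Fin d) :
    Tendsto (fun t => ∫ x, b x * (slp g j t x * slp h k t x)) (nhdsWithin 0 {0}ᶜ)
      (nhds (∫ x, b x * (pd j g x * pd k h x))) := by
  obtain ⟨C1, hC1, h1⟩ := slp_bound hg cg
  obtain ⟨C2, hC2, h2⟩ := slp_bound hh ch
  obtain ⟨R, hR⟩ := cg.isCompact.isBounded.subset_closedBall (0 : Eu d)
  have hB : 0 ≤ B := (abs_nonneg _).trans (hbB 0)
  have gz : ∀ x, x ∉ closedBall (0 : Eu d) R → g x = 0 := fun x hx =>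
    image_eq_zero_of_notMem_tsupport fun hx' => hx (hR hx')
  refine tendsto_integral_filter_of_dominated_convergence
    (indicator (closedBall (0 : Eu d) (R+1)) fun _ => B * (C1 * C2)) ?_ ?_ ?_ ?_
  · refine Eventually.of_forall fun t => ?_
    exact (hb.mul (((slp_cont hg.continuous j t).mul (slp_cont hh.continuous k t)).measurable)).aestronglyMeasurable
  · have : ∀ᶠ t : ℝ in nhdsWithin 0 {0}ᶜ, |t| < 1 := by
      apply nhdsWithin_le_nhds
      have := Metric.ball_mem_nhds (0:ℝ) one_pos
      filter_upwards [this] with t ht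
      simpa using ht
    filter_upwards [this] with t ht
    refine Eventually.of_forall fun x => ?_
    by_cases hx : x ∈ closedBall (0 : Eu d) (R+1)
    · rw [indicator_of_mem hx, Real.norm_eq_abs, abs_mul, abs_mul]
      exact mul_le_mul (hbB x) (mul_le_mul (h1 _ _ _) (h2 _ _ _) (abs_nonneg _) hC1)
        (by positivity) hB
    · rw [indicator_of_notMem hx]
      have hx1 : g x = 0 := gz x fun h' => hx (closedBall_subset_closedBall (by linarith) h')
      have hx2 : g (x + t • ev j) = 0 := by
        apply gz
        simp only [mem_closedBall, dist_zero_right, not_le] at hx ⊢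
        have : ‖x‖ ≤ ‖x + t • ev j‖ + ‖t • ev j‖ := by
          simpa using norm_sub_le (x + t • ev j) (t • ev j)
        rw [norm_smul, norm_ev, mul_one, Real.norm_eq_abs] at this
        linarith
      simp [slp, hx1, hx2]
  · exact (integrable_indicator_iff measurableSet_closedBall).2
      (integrableOn_const (by exact measure_closedBall_lt_top.ne))
  · exact Eventually.of_forall fun x => ((slp_tendsto hg j x).mul (slp_tendsto hh k x)).const_mul _

lemma bdd_int {b φ : Eu d → ℝ} (hb : Measurable b) (B : ℝ) (hbB : ∀ x, |b x| ≤ B)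
    (hφ : Continuous φ) (cφ : HasCompactSupport φ) : Integrable (fun x => b x * φ x) := by
  exact (hφ.integrable_of_hasCompactSupport cφ).bdd_mul hb.aestronglyMeasurable
    (Eventually.of_forall fun x => hbB x)

lemma slp_swap {g h b : Eu d → ℝ} (hg : Continuous g) (hh : Continuous h)
    (cg : HasCompactSupport g) (hb : Measurable b) (B : ℝ)
    (hbB : ∀ x, |b x| ≤ B) (j k : Fin d) (hbj : ∀ x (t : ℝ), b (x + t • ev j) = b x)
    (hbk : ∀ x (t : ℝ), b (x + t • ev k) = b x) (t : ℝ) :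
    ∫ x, b x * (slp g j t x * slp h k t x) = ∫ x, b x * (slp g k (-t) x * slp h j (-t) x) := by
  have hc : ∀ v : Eu d, HasCompactSupport fun x => g (x + v) := fun v =>
    cg.comp_homeomorph (Homeomorph.addRight v)
  have I : ∀ v w : Eu d, Integrable fun x => b x * (g (x + v) * h (x + w)) := fun v w =>
    bdd_int hb B hbB (by fun_prop) ((hc v).mul_right)
  have e : ∀ v w v' w' : Eu d,
      ∫ x, b x * ((g (x + v) - g (x + v')) / t * ((h (x + w) - h (x + w')) / t)) =
       ((∫ x, b x * (g (x + v) * h (x + w))) - (∫ x, b x * (g (x + v) * h (x + w')))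
        - (∫ x, b x * (g (x + v') * h (x + w))) + (∫ x, b x * (g (x + v') * h (x + w')))) / t^2 := by
    intro v w v' w'
    have I2 : Integrable (fun x => b x * (g (x + v) * h (x + w)) - b x * (g (x + v) * h (x + w'))) :=
      (I v w).sub (I v w')
    have I3 : Integrable (fun x => b x * (g (x + v) * h (x + w)) - b x * (g (x + v) * h (x + w'))
        - b x * (g (x + v') * h (x + w))) := I2.sub (I v' w)
    rw [← integral_sub (I _ _) (I _ _), ← integral_sub I2 (I _ _),
      ← integral_add I3 (I _ _), ← integral_div]
    congr 1; ext x
    ring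
  have e1 := e (t • ev j) (t • ev k) 0 0
  have e2 := e ((-t) • ev k) ((-t) • ev j) 0 0
  have s : ∀ v w v' : Eu d, (∀ x, b (x + v') = b x) →
      ∫ x, b x * (g (x + v) * h (x + w)) = ∫ x, b x * (g (x + (v + v')) * h (x + (w + v'))) := by
    intro v w v' hv
    rw [← integral_add_right_eq_self _ v']
    congr 1; ext x
    rw [hv, add_assoc, add_assoc, add_comm v', add_comm v']
  have hjk : ∀ x, b (x + ((-t) • ev j + (-t) • ev k)) = b x := by
    intro x; rw [← add_assoc, hbk, hbj]
  have s1 := s (t • ev j) (t • ev k) _ hjk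
  have s2 := s (t • ev j) 0 ((-t) • ev j) (fun x => hbj x _)
  have s3 := s 0 (t • ev k) ((-t) • ev k) (fun x => hbk x _)
  have z1 : t • ev j + ((-t) • ev j + (-t) • ev k) = (-t) • (ev k : Eu d) := by module
  have z2 : t • ev k + ((-t) • ev j + (-t) • ev k) = (-t) • (ev j : Eu d) := by module
  have z3 : t • ev j + (-t) • ev j = (0 : Eu d) := by module
  have z4 : t • ev k + (-t) • ev k = (0 : Eu d) := by module
  rw [z1, z2] at s1
  rw [z3, zero_add] at s2
  rw [z4, zero_add] at s3
  have l1 : ∫ x, b x * (slp g j t x * slp h k t x) =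
    ∫ x, b x * ((g (x + t • ev j) - g (x + 0)) / t * ((h (x + t • ev k) - h (x + 0)) / t)) := by
    simp [slp]
  have l2 : ∫ x, b x * (slp g k (-t) x * slp h j (-t) x) =
    ∫ x, b x * ((g (x + (-t) • ev k) - g (x + 0)) / t * ((h (x + (-t) • ev j) - h (x + 0)) / t)) := by
    congr 1; ext x
    simp only [slp, add_zero, div_neg]
    ring
  rw [l1, l2, e1, e2, s1, s2, s3]
  ring

lemma swap_ibp {g h b : Eu d → ℝ} (hg : ContDiff ℝ 1 g) (hh : ContDiff ℝ 1 h)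
    (cg : HasCompactSupport g) (ch : HasCompactSupport h) (hb : Measurable b) (B : ℝ)
    (hbB : ∀ x, |b x| ≤ B) (j k : Fin d) (hbj : ∀ x (t : ℝ), b (x + t • ev j) = b x)
    (hbk : ∀ x (t : ℝ), b (x + t • ev k) = b x) :
    ∫ x, b x * (pd j g x * pd k h x) = ∫ x, b x * (pd k g x * pd j h x) := by
  have h1 := slp_lim hg hh cg ch hb B hbB j k
  have h2 := slp_lim hg hh cg ch hb B hbB k j
  have hneg : Tendsto (fun t : ℝ => -t) (nhdsWithin 0 {0}ᶜ) (nhdsWithin 0 {0}ᶜ) := by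
    apply tendsto_nhdsWithin_of_tendsto_nhds_of_eventually_within
    · have : Tendsto (fun t : ℝ => -t) (nhds 0) (nhds (-0)) := continuous_neg.tendsto 0
      rw [neg_zero] at this
      exact this.mono_left nhdsWithin_le_nhds
    · filter_upwards [self_mem_nhdsWithin] with t ht
      simpa using ht
  have h3 := h2.comp hneg
  refine tendsto_nhds_unique h1 (h3.congr fun t => ?_)
  exact (slp_swap hg.continuous hh.continuous cg hb B hbB j k hbj hbk t).symm

end ibp

section energy
variable {d : ℕ}

structure Coef (ν : ℝ) (a : Fin d → Fin d → Eu d → ℝ) : Prop where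
  meas : ∀ i j, Measurable (a i j)
  symm : ∀ i j x, a i j x = a j i x
  ell : UnifElliptic d ν a

/-- coefficients depend only on the coordinate `m` -/
def OnlyC (m : Fin d) (a : Fin d → Fin d → Eu d → ℝ) : Prop :=
  ∀ i j x y, x m = y m → a i j x = a i j y

lemma quad_single (A : Fin d → Fin d → ℝ) (i j : Fin d) (s t : ℝ) :
    ∑ k, ∑ l, A k l * ((if k = i then s else 0) + (if k = j then t else 0)) *
      ((if l = i then s else 0) + (if l = j then t else 0)) =
      A i i * s * s + A i j * s * t + A j i * t * s + A j j * t * t := by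
  simp only [mul_add, add_mul, Finset.sum_add_distrib, mul_ite, ite_mul, mul_zero, zero_mul,
    Finset.sum_ite_eq', Finset.mem_univ, if_true]
  ring

lemma sq_single (i : Fin d) (s : ℝ) :
    ∑ k, ((if k = i then s else 0) + (if k = i then (0:ℝ) else 0)) ^ 2 = s^2 := by
  simp [ite_pow]

lemma sq_single2 (i j : Fin d) (h : i ≠ j) (s t : ℝ) :
    ∑ k, ((if k = i then s else 0) + (if k = j then t else 0)) ^ 2 = s^2 + t^2 := by
  simp only [add_sq, Finset.sum_add_distrib, ite_pow, mul_ite, ite_mul, mul_zero, zero_mul]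
  simp [h.symm]

lemma Coef.diag {ν : ℝ} {a : Fin d → Fin d → Eu d → ℝ} (ha : Coef ν a) (i : Fin d) (x : Eu d) :
    ν ≤ a i i x ∧ a i i x ≤ ν⁻¹ := by
  have := ha.ell x (fun k => (if k = i then 1 else 0) + (if k = i then 0 else 0))
  rw [sq_single, quad_single (fun i j => a i j x)] at this
  simpa using this

lemma Coef.bdd {ν : ℝ} (hν : 0 < ν) {a : Fin d → Fin d → Eu d → ℝ} (ha : Coef ν a) (i j : Fin d) (x : Eu d) :
    |a i j x| ≤ ν⁻¹ := by
  have hi := ha.diag i x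
  have hj := ha.diag j x
  by_cases h : i = j
  · subst h
    rw [abs_of_nonneg (hν.le.trans hi.1)]; exact hi.2
  have h1 := ha.ell x (fun k => (if k = i then 1 else 0) + (if k = j then 1 else 0))
  have h2 := ha.ell x (fun k => (if k = i then 1 else 0) + (if k = j then (-1) else 0))
  rw [sq_single2 _ _ h, quad_single (fun i j => a i j x)] at h1 h2
  rw [ha.symm j i] at h1 h2
  rw [abs_le]
  constructor <;> nlinarith [h1.2, h2.2]

lemma LL_sq_le (c : Fin d → Fin d → Eu d → ℝ) (η : ℝ) (v : Eu d → ℝ) (x : Eu d)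
    (hc : ∀ i j, |c i j x| ≤ η) : (LL c v x) ^ 2 ≤ η ^ 2 * d ^ 2 * hs v x := by
  have e1 : LL c v x = ∑ p : Fin d × Fin d, c p.1 p.2 x * pd2 p.1 p.2 v x := by
    rw [Fintype.sum_prod_type]; rfl
  have e2 : hs v x = ∑ p : Fin d × Fin d, (pd2 p.1 p.2 v x) ^ 2 := by
    rw [Fintype.sum_prod_type]; rfl
  rw [e1, e2]
  refine (Finset.sum_mul_sq_le_sq_mul_sq _ _ _).trans ?_
  refine mul_le_mul_of_nonneg_right ?_ (Finset.sum_nonneg fun _ _ => sq_nonneg _)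
  have : ∀ p ∈ (Finset.univ : Finset (Fin d × Fin d)), (c p.1 p.2 x) ^ 2 ≤ η ^ 2 := by
    intro p _
    rw [← sq_abs]
    exact pow_le_pow_left₀ (abs_nonneg _) (hc _ _) 2
  refine (Finset.sum_le_sum this).trans ?_
  simp [sq]
  apply le_of_eq; ring

lemma LL_meas {a : Fin d → Fin d → Eu d → ℝ} (ha : ∀ i j, Measurable (a i j)) {v : Eu d → ℝ}
    (hv : ContDiff ℝ 2 v) : Measurable (LL a v) := by
  unfold LL
  exact Finset.measurable_sum _ fun i _ => Finset.measurable_sum _ fun j _ =>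
    (ha i j).mul (pd2_cont hv i j).measurable

lemma cont_intOn {φ : Eu d → ℝ} (h : Continuous φ) {A : Set (Eu d)} (hA : Bornology.IsBounded A) :
    IntegrableOn φ A := by
  obtain ⟨R, hR⟩ := hA.subset_closedBall 0
  exact (h.locallyIntegrable.integrableOn_isCompact (isCompact_closedBall 0 R)).mono_set hR

lemma LL_intOn {ν : ℝ} (hν : 0 < ν) {a : Fin d → Fin d → Eu d → ℝ} (ha : Coef ν a) {v : Eu d → ℝ}
    (hv : ContDiff ℝ 2 v) {A : Set (Eu d)} (hA : Bornology.IsBounded A) :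
    IntegrableOn (fun x => (LL a v x) ^ 2) A := by
  refine Integrable.mono' ((cont_intOn (hs_cont hv) hA).const_mul (ν⁻¹ ^ 2 * d ^ 2))
    ((LL_meas ha.meas hv).pow_const 2).aestronglyMeasurable ?_
  refine Eventually.of_forall fun x => ?_
  rw [Real.norm_eq_abs, abs_of_nonneg (sq_nonneg _)]
  exact LL_sq_le a _ v x fun i j => ha.bdd hν i j x

def hy (m : Fin d) (v : Eu d → ℝ) (x : Eu d) : ℝ := ∑ k ∈ Finset.univ.erase m, ∑ i, pd2 i k v x ^ 2

lemma hs_eq (m : Fin d) (v : Eu d → ℝ) (x : Eu d) :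
    hs v x = hy m v x + ∑ i, pd2 i m v x ^ 2 := by
  unfold hs hy
  rw [Finset.sum_comm, ← Finset.sum_erase_add _ _ (Finset.mem_univ m)]

lemma hy_nonneg (m : Fin d) (v : Eu d → ℝ) (x : Eu d) : 0 ≤ hy m v x :=
  Finset.sum_nonneg fun _ _ => Finset.sum_nonneg fun _ _ => sq_nonneg _

lemma pd2_le_hy {m : Fin d} {v : Eu d → ℝ} (hv : ContDiff ℝ 2 v) (x : Eu d) (i j : Fin d)
    (h : ¬ (i = m ∧ j = m)) : pd2 i j v x ^ 2 ≤ hy m v x := by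
  have key : ∀ i j, j ≠ m → pd2 i j v x ^ 2 ≤ hy m v x := by
    intro i j hj
    unfold hy
    refine le_trans ?_ (Finset.single_le_sum (f := fun k => ∑ i, pd2 i k v x ^ 2)
      (fun _ _ => Finset.sum_nonneg fun _ _ => sq_nonneg _) (Finset.mem_erase.2 ⟨hj, Finset.mem_univ j⟩))
    exact Finset.single_le_sum (f := fun i => pd2 i j v x ^ 2) (fun _ _ => sq_nonneg _) (Finset.mem_univ i)
  by_cases hj : j = m
  · rw [pd2_symm hv]
    exact key _ _ fun hi => h ⟨hi, hj⟩
  · exact key _ _ hj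

lemma hs_le_hy (d : ℕ) (ν : ℝ) (hν : 0 < ν) : ∃ C : ℝ, 0 < C ∧ ∀ (m : Fin d) (a : Fin d → Fin d → Eu d → ℝ),
    Coef ν a → ∀ v : Eu d → ℝ, ContDiff ℝ 2 v → ∀ x,
      hs v x ≤ C * ((LL a v x) ^ 2 + hy m v x) := by
  refine ⟨1 + d + 2 * ν⁻¹ ^ 2 * (1 + (d * d * ν⁻¹) ^ 2), by positivity, fun m a ha v hv x => ?_⟩
  set s := Real.sqrt (hy m v x) with hs_def
  have s0 : 0 ≤ s := Real.sqrt_nonneg _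
  have ss : s ^ 2 = hy m v x := Real.sq_sqrt (hy_nonneg m v x)
  have hle : ∀ i j, ¬ (i = m ∧ j = m) → |pd2 i j v x| ≤ s := fun i j h =>
    Real.abs_le_sqrt (pd2_le_hy hv x i j h)
  have hνi : 0 < ν⁻¹ := inv_pos.2 hν
  -- rest
  have hrest : |LL a v x - a m m x * pd2 m m v x| ≤ d * d * ν⁻¹ * s := by
    have e1 : LL a v x = ∑ p : Fin d × Fin d, a p.1 p.2 x * pd2 p.1 p.2 v x := by
      rw [Fintype.sum_prod_type]; rfl
    rw [e1, ← Finset.sum_erase_add _ _ (Finset.mem_univ ((m, m) : Fin d × Fin d)), add_sub_cancel_right]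
    refine (Finset.abs_sum_le_sum_abs _ _).trans ?_
    have : ∀ p ∈ (Finset.univ.erase ((m, m) : Fin d × Fin d)), |a p.1 p.2 x * pd2 p.1 p.2 v x| ≤ ν⁻¹ * s := by
      intro p hp
      rw [abs_mul]
      refine mul_le_mul (ha.bdd hν _ _ _) (hle _ _ ?_) (abs_nonneg _) hνi.le
      rintro ⟨h1, h2⟩
      exact (Finset.mem_erase.1 hp).1 (Prod.ext h1 h2)
    refine (Finset.sum_le_card_nsmul _ _ _ this).trans ?_
    rw [nsmul_eq_mul]
    have hc : ((Finset.univ.erase ((m, m) : Fin d × Fin d)).card : ℝ) ≤ d * d := by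
      have := Finset.card_le_univ (Finset.univ.erase ((m, m) : Fin d × Fin d))
      simp only [Fintype.card_prod, Fintype.card_fin] at this
      exact_mod_cast this
    calc _ ≤ (d * d : ℝ) * (ν⁻¹ * s) := mul_le_mul_of_nonneg_right hc (by positivity)
      _ = _ := by ring
  have hmm : |pd2 m m v x| ≤ ν⁻¹ * (|LL a v x| + d * d * ν⁻¹ * s) := by
    have h1 : ν * |pd2 m m v x| ≤ |a m m x * pd2 m m v x| := by
      rw [abs_mul]
      exact mul_le_mul_of_nonneg_right ((ha.diag m x).1.trans (le_abs_self _)) (abs_nonneg _)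
    have h2 : |a m m x * pd2 m m v x| ≤ |LL a v x| + d * d * ν⁻¹ * s := by
      have := abs_sub_abs_le_abs_sub (a m m x * pd2 m m v x) (LL a v x)
      rw [abs_sub_comm] at this
      linarith
    rw [inv_mul_eq_div, le_div_iff₀ hν]
    linarith
  have hmm2 : pd2 m m v x ^ 2 ≤ 2 * ν⁻¹ ^ 2 * ((LL a v x) ^ 2 + (d * d * ν⁻¹) ^ 2 * s ^ 2) := by
    rw [← sq_abs]
    refine (pow_le_pow_left₀ (abs_nonneg _) hmm 2).trans ?_
    rw [mul_pow, ← sq_abs (LL a v x)]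
    have : (|LL a v x| + d * d * ν⁻¹ * s) ^ 2 ≤ 2 * (|LL a v x| ^ 2 + (d * d * ν⁻¹) ^ 2 * s ^ 2) := by
      nlinarith [sq_nonneg (|LL a v x| - d * d * ν⁻¹ * s)]
    nlinarith [sq_nonneg ν⁻¹, mul_le_mul_of_nonneg_left this (sq_nonneg ν⁻¹)]
  have hsum : ∑ i, pd2 i m v x ^ 2 ≤ d * hy m v x + pd2 m m v x ^ 2 := by
    have : ∀ i ∈ (Finset.univ : Finset (Fin d)), pd2 i m v x ^ 2 ≤ hy m v x + if i = m then pd2 m m v x ^ 2 else 0 := by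
      intro i _
      by_cases hi : i = m
      · subst hi; simp [hy_nonneg]
      · simpa [hi] using pd2_le_hy hv x i m (fun h => hi h.1)
    refine (Finset.sum_le_sum this).trans ?_
    rw [Finset.sum_add_distrib]
    simp
  rw [hs_eq m, ← ss] at *
  have p1 : 0 ≤ 2 * ν⁻¹ ^ 2 * (d * d * ν⁻¹) ^ 2 * (LL a v x) ^ 2 := by positivity
  have p2 : 0 ≤ (1 + d : ℝ) * (LL a v x) ^ 2 := by positivity
  have p3 : 0 ≤ 2 * ν⁻¹ ^ 2 * s ^ 2 := by positivity
  nlinarith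

lemma pd_hcs {u : Eu d → ℝ} (h : HasCompactSupport u) (i : Fin d) : HasCompactSupport (pd i u) := by
  unfold pd; exact h.fderiv_apply ℝ _

lemma pd2_hcs {u : Eu d → ℝ} (h : HasCompactSupport u) (i j : Fin d) : HasCompactSupport (pd2 i j u) :=
  pd_hcs (pd_hcs h j) i

lemma OnlyC.shift {m : Fin d} {a : Fin d → Fin d → Eu d → ℝ} (h : OnlyC m a) (i j : Fin d) {k : Fin d}
    (hk : k ≠ m) (x : Eu d) (t : ℝ) : a i j (x + t • ev k) = a i j x := by
  apply h
  simp [ev, hk.symm]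

/-- the key energy inequality for one good direction -/
lemma energy_k {ν : ℝ} (hν : 0 < ν) {m k : Fin d} (hk : k ≠ m)
    {a : Fin d → Fin d → Eu d → ℝ} (ha : Coef ν a) (ho : OnlyC m a) {w : Eu d → ℝ}
    (hw : ContDiff ℝ 2 w) (cw : HasCompactSupport w) :
    ∫ x, ∑ i, pd2 i k w x ^ 2 ≤ ν⁻¹ ^ 6 * ∫ x, (LL a w x) ^ 2 := by
  have hνi : 0 < ν⁻¹ := inv_pos.2 hν
  set b : Fin d → Fin d → Eu d → ℝ := fun i j x => a i j x / a m m x with hb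
  have amm : ∀ x, 0 < a m m x := fun x => hν.trans_le (ha.diag m x).1
  have bmeas : ∀ i j, Measurable (b i j) := fun i j => (ha.meas i j).div (ha.meas m m)
  have bbd : ∀ i j x, |b i j x| ≤ ν⁻¹ * ν⁻¹ := by
    intro i j x
    rw [hb]; simp only
    rw [abs_div, div_eq_mul_inv]
    refine mul_le_mul (ha.bdd hν i j x) ?_ (by positivity) hνi.le
    rw [abs_of_pos (amm x)]
    exact inv_anti₀ hν (ha.diag m x).1
  have bshift : ∀ i j k, k ≠ m → ∀ x (t : ℝ), b i j (x + t • ev k) = b i j x := by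
    intro i j k hk x t
    simp only [hb, ho.shift _ _ hk]
  have hD : ∀ i, ContDiff ℝ 1 (pd i w) := fun i => pd_contDiff hw i
  have cD : ∀ i, HasCompactSupport (pd i w) := fun i => pd_hcs cw i
  -- swap
  have hsw : ∀ i j, ∫ x, b i j x * (pd2 i j w x * pd2 k k w x) =
      ∫ x, b i j x * (pd2 i k w x * pd2 j k w x) := by
    have h1 : ∀ i j, j ≠ m → ∫ x, b i j x * (pd2 i j w x * pd2 k k w x) =
      ∫ x, b i j x * (pd2 i k w x * pd2 j k w x) := by
      intro i j hj
      have := swap_ibp (hD i) (hD k) (cD i) (cD k) (bmeas i j) _ (bbd i j) j k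
        (bshift i j j hj) (bshift i j k hk)
      simp only [pd2_symm hw i]
      exact this
    intro i j
    by_cases hj : j = m
    · by_cases hi : i = m
      · subst hj; subst hi
        have b1 : ∀ x, b i i x = 1 := fun x => div_self (amm x).ne'
        have := swap_ibp (hD i) (hD k) (cD i) (cD k) (measurable_const (a := (1:ℝ))) 1 (by simp) i k
          (fun _ _ => rfl) (fun _ _ => rfl)
        simp only [b1]
        have e : ∀ x, pd2 i k w x * pd2 i k w x = pd k (pd i w) x * pd i (pd k w) x := by
          intro x
          nth_rewrite 1 [pd2_symm hw i k]
          rfl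
        simp only [e]
        exact this
      · have hbs : ∀ x, b i j x = b j i x := fun x => by simp only [hb, ha.symm i j]
        have := h1 j i hi
        simp only [hbs, pd2_symm hw i j]
        rw [this]
        congr 1; ext x; ring
    · exact h1 i j hj
  have I1 : ∀ i j i' j' i'' j'', Integrable fun x => b i j x * (pd2 i' j' w x * pd2 i'' j'' w x) := by
    intro i j i' j' i'' j''
    exact bdd_int (bmeas i j) _ (bbd i j) ((pd2_cont hw _ _).mul (pd2_cont hw _ _))
      ((pd2_hcs cw _ _).mul_right)
  have T1 : ∫ x, ∑ i, ∑ j, b i j x * (pd2 i j w x * pd2 k k w x) =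
      ∫ x, ∑ i, ∑ j, b i j x * (pd2 i k w x * pd2 j k w x) := by
    rw [integral_finsetSum _ fun i _ => integrable_finsetSum _ fun j _ => I1 _ _ _ _ _ _,
      integral_finsetSum _ fun i _ => integrable_finsetSum _ fun j _ => I1 _ _ _ _ _ _]
    refine Finset.sum_congr rfl fun i _ => ?_
    rw [integral_finsetSum _ fun j _ => I1 _ _ _ _ _ _,
      integral_finsetSum _ fun j _ => I1 _ _ _ _ _ _]
    exact Finset.sum_congr rfl fun j _ => hsw i j
  have J1 : Integrable fun x => ∑ i, ∑ j, b i j x * (pd2 i j w x * pd2 k k w x) :=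
    integrable_finsetSum _ fun i _ => integrable_finsetSum _ fun j _ => I1 _ _ _ _ _ _
  have J2 : Integrable fun x => ∑ i, ∑ j, b i j x * (pd2 i k w x * pd2 j k w x) :=
    integrable_finsetSum _ fun i _ => integrable_finsetSum _ fun j _ => I1 _ _ _ _ _ _
  have J3 : Integrable fun x => ∑ i, pd2 i k w x ^ 2 :=
    integrable_finsetSum _ fun i _ => ((pd2_cont hw i k).pow 2).integrable_of_hasCompactSupport
      (by simpa [sq] using (pd2_hcs cw i k).mul_right (f' := pd2 i k w))
  have hsI : Integrable (hs w) := by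
    unfold hs
    exact integrable_finsetSum _ fun i _ => integrable_finsetSum _ fun j _ => 
     ((pd2_cont hw i j).pow 2).integrable_of_hasCompactSupport
      (by simpa [sq] using (pd2_hcs cw i j).mul_right (f' := pd2 i j w))
  have J4 : Integrable fun x => (LL a w x) ^ 2 := by
    refine Integrable.mono' (hsI.const_mul (ν⁻¹ ^ 2 * d ^ 2))
      ((LL_meas ha.meas hw).pow_const 2).aestronglyMeasurable ?_
    refine Eventually.of_forall fun x => ?_
    rw [Real.norm_eq_abs, abs_of_nonneg (sq_nonneg _)]
    exact LL_sq_le a _ w x fun i j => ha.bdd hν i j x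
  have pt : ∀ x, ν ^ 2 / 2 * ∑ i, pd2 i k w x ^ 2 ≤ ν⁻¹ ^ 4 / 2 * (LL a w x) ^ 2 -
      ((∑ i, ∑ j, b i j x * (pd2 i j w x * pd2 k k w x)) -
       ∑ i, ∑ j, b i j x * (pd2 i k w x * pd2 j k w x)) := by
    intro x
    have e1 : ∑ i, ∑ j, b i j x * (pd2 i j w x * pd2 k k w x) = LL a w x / a m m x * pd2 k k w x := by
      unfold LL
      rw [Finset.sum_div, Finset.sum_mul]
      refine Finset.sum_congr rfl fun i _ => ?_
      rw [Finset.sum_div, Finset.sum_mul]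
      refine Finset.sum_congr rfl fun j _ => ?_
      simp only [hb]; ring
    have e2 : ∑ i, ∑ j, b i j x * (pd2 i k w x * pd2 j k w x) =
        (∑ i, ∑ j, a i j x * pd2 i k w x * pd2 j k w x) / a m m x := by
      rw [Finset.sum_div]
      refine Finset.sum_congr rfl fun i _ => ?_
      rw [Finset.sum_div]
      refine Finset.sum_congr rfl fun j _ => ?_
      simp only [hb]; ring
    have hS0 : 0 ≤ ∑ i, pd2 i k w x ^ 2 := Finset.sum_nonneg fun _ _ => sq_nonneg _
    have hkS : pd2 k k w x ^ 2 ≤ ∑ i, pd2 i k w x ^ 2 :=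
      Finset.single_le_sum (f := fun i => pd2 i k w x ^ 2) (fun _ _ => sq_nonneg _) (Finset.mem_univ k)
    have e3 : ν ^ 2 * ∑ i, pd2 i k w x ^ 2 ≤
        (∑ i, ∑ j, a i j x * pd2 i k w x * pd2 j k w x) / a m m x := by
      have := (ha.ell x (fun i => pd2 i k w x)).1
      rw [le_div_iff₀ (amm x)]
      have h2 : a m m x * ν ≤ 1 := by
        have := mul_le_mul_of_nonneg_right (ha.diag m x).2 hν.le
        rwa [inv_mul_cancel₀ hν.ne'] at this
      have : ν ^ 2 * (∑ i, pd2 i k w x ^ 2) * a m m x = (ν * ∑ i, pd2 i k w x ^ 2) * (a m m x * ν) := by ring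
      rw [this]
      calc _ ≤ (ν * ∑ i, pd2 i k w x ^ 2) * 1 := mul_le_mul_of_nonneg_left h2 (by positivity)
        _ ≤ _ := by linarith
    rw [e1, e2]
    have e4 : LL a w x / a m m x * pd2 k k w x ≤ ν⁻¹ ^ 4 / 2 * (LL a w x) ^ 2 + ν ^ 2 / 2 * pd2 k k w x ^ 2 := by
      have q : (LL a w x / a m m x) ^ 2 ≤ ν⁻¹ ^ 2 * (LL a w x) ^ 2 := by
        rw [div_pow, div_eq_mul_inv, mul_comm, ← inv_pow]
        refine mul_le_mul_of_nonneg_right ?_ (sq_nonneg _)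
        exact pow_le_pow_left₀ (inv_nonneg.2 (amm x).le) (inv_anti₀ hν (ha.diag m x).1) 2
      have r : LL a w x / a m m x * pd2 k k w x ≤
          ν⁻¹ ^ 2 / 2 * (LL a w x / a m m x) ^ 2 + ν ^ 2 / 2 * pd2 k k w x ^ 2 := by
        have h1 : ν⁻¹ * ν = 1 := inv_mul_cancel₀ hν.ne'
        have h2 := sq_nonneg (ν⁻¹ * (LL a w x / a m m x) - ν * pd2 k k w x)
        have h3 : (ν⁻¹ * (LL a w x / a m m x)) * (ν * pd2 k k w x) = LL a w x / a m m x * pd2 k k w x := by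
          calc _ = (ν⁻¹ * ν) * (LL a w x / a m m x * pd2 k k w x) := by ring
            _ = _ := by rw [h1, one_mul]
        nlinarith
      have q' := mul_le_mul_of_nonneg_left q (show 0 ≤ ν⁻¹ ^ 2 / 2 by positivity)
      nlinarith
    have e5 := mul_le_mul_of_nonneg_left hkS (show 0 ≤ ν ^ 2 / 2 by positivity)
    linarith
  have := integral_mono (J3.const_mul (ν ^ 2 / 2)) ((J4.const_mul (ν⁻¹ ^ 4 / 2)).sub (J1.sub J2)) pt
  simp only [Pi.sub_apply] at this
  rw [integral_const_mul, integral_sub (J4.const_mul _) (by exact J1.sub J2), integral_sub J1 J2, T1, sub_self,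
    sub_zero, integral_const_mul] at this
  have h6 : ν⁻¹ ^ 6 * (∫ x, (LL a w x) ^ 2) = (2 * ν⁻¹ ^ 2) * (ν⁻¹ ^ 4 / 2 * ∫ x, (LL a w x) ^ 2) := by ring
  rw [h6]
  have h7 : ∫ x, ∑ i, pd2 i k w x ^ 2 = (2 * ν⁻¹ ^ 2) * (ν ^ 2 / 2 * ∫ x, ∑ i, pd2 i k w x ^ 2) := by
    have : ν⁻¹ ^ 2 * ν ^ 2 = 1 := by rw [← mul_pow, inv_mul_cancel₀ hν.ne', one_pow]
    calc _ = (ν⁻¹ ^ 2 * ν ^ 2) * ∫ x, ∑ i, pd2 i k w x ^ 2 := by rw [this, one_mul]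
      _ = _ := by ring
  rw [h7]
  exact mul_le_mul_of_nonneg_left this (by positivity)

end energy

section cacc
variable {d : ℕ}

lemma energy0 (d : ℕ) (ν : ℝ) (hν : 0 < ν) : ∃ C : ℝ, 0 < C ∧ ∀ (m : Fin d) (a : Fin d → Fin d → Eu d → ℝ),
    Coef ν a → OnlyC m a → ∀ w : Eu d → ℝ, ContDiff ℝ 2 w → HasCompactSupport w →
      ∫ x, hs w x ≤ C * ∫ x, (LL a w x) ^ 2 := by
  obtain ⟨C, hC, h⟩ := hs_le_hy d ν hν
  refine ⟨C * (1 + d * ν⁻¹ ^ 6), by positivity, fun m a ha ho w hw cw => ?_⟩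
  have sqI : ∀ i j, Integrable fun x => pd2 i j w x ^ 2 := fun i j =>
     ((pd2_cont hw i j).pow 2).integrable_of_hasCompactSupport
      (by simpa [sq] using (pd2_hcs cw i j).mul_right (f' := pd2 i j w))
  have hsI : Integrable (hs w) := by
    unfold hs
    exact integrable_finsetSum _ fun i _ => integrable_finsetSum _ fun j _ => sqI i j
  have hyI : Integrable (hy m w) := by
    unfold hy
    exact integrable_finsetSum _ fun i _ => integrable_finsetSum _ fun j _ => sqI _ _
  have J4 : Integrable fun x => (LL a w x) ^ 2 := by
    refine Integrable.mono' (hsI.const_mul (ν⁻¹ ^ 2 * d ^ 2))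
      ((LL_meas ha.meas hw).pow_const 2).aestronglyMeasurable ?_
    refine Eventually.of_forall fun x => ?_
    rw [Real.norm_eq_abs, abs_of_nonneg (sq_nonneg _)]
    exact LL_sq_le a _ w x fun i j => ha.bdd hν i j x
  have L0 : 0 ≤ ∫ x, (LL a w x) ^ 2 := integral_nonneg fun _ => sq_nonneg _
  have h1 : ∫ x, hy m w x ≤ d * ν⁻¹ ^ 6 * ∫ x, (LL a w x) ^ 2 := by
    unfold hy
    rw [integral_finsetSum _ fun i _ => integrable_finsetSum _ fun j _ => sqI _ _]
    refine (Finset.sum_le_card_nsmul _ _ (ν⁻¹ ^ 6 * ∫ x, (LL a w x) ^ 2) fun k hk => 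
      energy_k hν (Finset.mem_erase.1 hk).1 ha ho hw cw).trans ?_
    rw [nsmul_eq_mul, mul_assoc]
    refine mul_le_mul_of_nonneg_right ?_ (by positivity)
    have := Finset.card_le_univ (Finset.univ.erase m)
    rw [Fintype.card_fin] at this
    exact_mod_cast this
  calc ∫ x, hs w x ≤ ∫ x, C * ((LL a w x) ^ 2 + hy m w x) :=
        integral_mono hsI ((J4.add hyI).const_mul C) fun x => h m a ha w hw x
    _ = C * ((∫ x, (LL a w x) ^ 2) + ∫ x, hy m w x) := by
        rw [integral_const_mul, integral_add J4 hyI]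
    _ ≤ C * ((∫ x, (LL a w x) ^ 2) + d * ν⁻¹ ^ 6 * ∫ x, (LL a w x) ^ 2) := by gcongr
    _ = _ := by ring

/-- frozen coefficients -/
def frz (m : Fin d) (a : Fin d → Fin d → Eu d → ℝ) (i j : Fin d) (x : Eu d) : ℝ := a i j (x m • ev m)

lemma frz_coef {ν : ℝ} {a : Fin d → Fin d → Eu d → ℝ} (ha : Coef ν a) (m : Fin d) : Coef ν (frz m a) where
  meas i j := (ha.meas i j).comp (by
    have : Continuous fun x : Eu d => x m • (ev m : Eu d) := by fun_prop
    exact this.measurable)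
  symm i j x := ha.symm i j _
  ell x ξ := ha.ell _ ξ

lemma frz_only (a : Fin d → Fin d → Eu d → ℝ) (m : Fin d) : OnlyC m (frz m a) := by
  intro i j x y h; unfold frz; rw [h]

def Near (m : Fin d) (η : ℝ) (a : Fin d → Fin d → Eu d → ℝ) : Prop :=
  ∀ x ∈ ball (0 : Eu d) 1, ∀ i j, |a i j x - frz m a i j x| ≤ η

lemma LL_add_sq (a a0 : Fin d → Fin d → Eu d → ℝ) (η : ℝ) (v : Eu d → ℝ) (x : Eu d)
    (h : ∀ i j, |a i j x - a0 i j x| ≤ η) :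
    (LL a0 v x) ^ 2 ≤ 2 * (LL a v x) ^ 2 + 2 * (η ^ 2 * d ^ 2) * hs v x := by
  have h1 := LL_sq_le (fun i j x => a i j x - a0 i j x) η v x h
  have h2 : LL (fun i j x => a i j x - a0 i j x) v x = LL a v x - LL a0 v x := by
    unfold LL; simp only [sub_mul, Finset.sum_sub_distrib]
  rw [h2] at h1
  nlinarith [sq_nonneg (LL a v x + (LL a v x - LL a0 v x))]

lemma pd_zero_of_notMem {u : Eu d → ℝ} {x : Eu d} (hx : x ∉ tsupport u) (i : Fin d) : pd i u x = 0 := by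
  unfold pd
  rw [fderiv_of_notMem_tsupport ℝ hx]; rfl

lemma pd_tsupport (u : Eu d → ℝ) (i : Fin d) : tsupport (pd i u) ⊆ tsupport u := by
  refine closure_minimal ?_ (isClosed_tsupport u)
  intro x hx
  by_contra h
  exact hx (pd_zero_of_notMem h i)

lemma pd2_zero_of_notMem {u : Eu d → ℝ} {x : Eu d} (hx : x ∉ tsupport u) (i j : Fin d) : pd2 i j u x = 0 :=
  pd_zero_of_notMem (fun h => hx (pd_tsupport u j h)) i

lemma energy1 (d : ℕ) (ν : ℝ) (hν : 0 < ν) : ∃ η : ℝ, 0 < η ∧ ∃ C : ℝ, 0 < C ∧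
    ∀ (m : Fin d) (a : Fin d → Fin d → Eu d → ℝ),
    Coef ν a → Near m η a → ∀ w : Eu d → ℝ, ContDiff ℝ 2 w → HasCompactSupport w →
      tsupport w ⊆ ball 0 1 → 
      ∫ x, hs w x ≤ C * ∫ x, (LL a w x) ^ 2 := by
  obtain ⟨C, hC, h⟩ := energy0 d ν hν
  set η : ℝ := Real.sqrt (1 / (4 * C * (d ^ 2 + 1))) with hη
  have hη2 : η ^ 2 = 1 / (4 * C * (d ^ 2 + 1)) := Real.sq_sqrt (by positivity)
  refine ⟨η, Real.sqrt_pos.2 (by positivity), 4 * C, by positivity, fun m a ha hn w hw cw hsup => ?_⟩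
  have sqI : ∀ i j, Integrable fun x => pd2 i j w x ^ 2 := fun i j =>
     ((pd2_cont hw i j).pow 2).integrable_of_hasCompactSupport
      (by simpa [sq] using (pd2_hcs cw i j).mul_right (f' := pd2 i j w))
  have hsI : Integrable (hs w) := by
    unfold hs
    exact integrable_finsetSum _ fun i _ => integrable_finsetSum _ fun j _ => sqI i j
  have J4 : ∀ a : Fin d → Fin d → Eu d → ℝ, Coef ν a → Integrable fun x => (LL a w x) ^ 2 := by
    intro a ha
    refine Integrable.mono' (hsI.const_mul (ν⁻¹ ^ 2 * d ^ 2))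
      ((LL_meas ha.meas hw).pow_const 2).aestronglyMeasurable ?_
    refine Eventually.of_forall fun x => ?_
    rw [Real.norm_eq_abs, abs_of_nonneg (sq_nonneg _)]
    exact LL_sq_le a _ w x fun i j => ha.bdd hν i j x
  have h0 := h m (frz m a) (frz_coef ha m) (frz_only a m) w hw cw
  have h1 : ∫ x, (LL (frz m a) w x) ^ 2 ≤ ∫ x, (2 * (LL a w x) ^ 2 + 2 * (η ^ 2 * d ^ 2) * hs w x) := by
    refine integral_mono (J4 _ (frz_coef ha m)) (((J4 _ ha).const_mul _).add (hsI.const_mul _)) fun x => ?_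
    by_cases hx : x ∈ tsupport w
    · exact LL_add_sq a _ η w x fun i j => hn x (hsup hx) i j
    · have : LL (frz m a) w x = 0 := by
        unfold LL; simp [pd2_zero_of_notMem hx]
      have h5 := hs_nonneg w x
      have h6 : 0 ≤ 2 * (LL a w x) ^ 2 + 2 * (η ^ 2 * d ^ 2) * hs w x := by positivity
      simpa [this] using h6
  rw [integral_add ((J4 _ ha).const_mul _) (hsI.const_mul _), integral_const_mul, integral_const_mul] at h1
  have hs0 : 0 ≤ ∫ x, hs w x := integral_nonneg fun x => hs_nonneg w x
  have h2 : C * (2 * (η ^ 2 * d ^ 2)) ≤ 1 / 2 := by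
    rw [hη2]
    have : C * (2 * (1 / (4 * C * (d ^ 2 + 1)) * d ^ 2)) = 1 / 2 * ((d : ℝ) ^ 2 / (d ^ 2 + 1)) := by
      field_simp; ring
    rw [this]
    have : ((d : ℝ) ^ 2 / (d ^ 2 + 1)) ≤ 1 := by
      rw [div_le_one (by positivity)]; linarith
    linarith
  have h3 := mul_le_mul_of_nonneg_left h1 hC.le
  have h4 := mul_le_mul_of_nonneg_right h2 hs0
  nlinarith

/-- Cauchy–Schwarz on an interval -/
lemma cs_interval {h : ℝ → ℝ} (hh : Continuous h) {t : ℝ} (ht : 0 < t) :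
    ((1 / t) * ∫ s in (0:ℝ)..t, h s) ^ 2 ≤ (1 / t) * ∫ s in (0:ℝ)..t, h s ^ 2 := by
  set M := (1 / t) * ∫ s in (0:ℝ)..t, h s with hM
  have hI : ∫ s in (0:ℝ)..t, h s = t * M := by rw [hM]; field_simp
  have h0 : 0 ≤ ∫ s in (0:ℝ)..t, (h s - M) ^ 2 :=
    intervalIntegral.integral_nonneg ht.le fun _ _ => sq_nonneg _
  have e : ∫ s in (0:ℝ)..t, (h s - M) ^ 2 = (∫ s in (0:ℝ)..t, h s ^ 2) - t * M ^ 2 := by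
    have : (fun s => (h s - M) ^ 2) = fun s => h s ^ 2 - (2 * M * h s - M ^ 2) := by ext s; ring
    have i1 : IntervalIntegrable (fun s => h s ^ 2) volume 0 t := by
      apply Continuous.intervalIntegrable; fun_prop
    have i2 : IntervalIntegrable (fun s => 2 * M * h s) volume 0 t := by
      apply Continuous.intervalIntegrable; fun_prop
    have i3 : IntervalIntegrable (fun _ : ℝ => M ^ 2) volume 0 t := by
      apply Continuous.intervalIntegrable; fun_prop
    rw [this, intervalIntegral.integral_sub i1 (i2.sub i3),
      intervalIntegral.integral_sub i2 i3, intervalIntegral.integral_const_mul, hI]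
    simp; ring
  rw [e] at h0
  rw [one_div, inv_mul_eq_div, le_div_iff₀ ht]
  linarith

lemma jensen_gen {X : Type*} [MeasurableSpace X] (μ : Measure X) [SFinite μ] {ψ : ℝ → X → ℝ} {t : ℝ}
    (ht : 0 < t) (hc : ∀ x, Continuous fun s => ψ s x)
    (hi : Integrable (Function.uncurry fun x s => ψ s x ^ 2) (μ.prod (volume.restrict (Ioc 0 t))))
    (hm : AEStronglyMeasurable (fun x => (1 / t) * ∫ s in (0:ℝ)..t, ψ s x) μ)
    {M : ℝ} (hM : ∀ s ∈ Ioc 0 t, ∫ x, ψ s x ^ 2 ∂μ ≤ M) :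
    ∫ x, ((1 / t) * ∫ s in (0:ℝ)..t, ψ s x) ^ 2 ∂μ ≤ M := by
  have hI : Integrable (fun x => (1 / t) * ∫ s in (0:ℝ)..t, ψ s x ^ 2) μ := by
    have := hi.integral_prod_left
    simp only [intervalIntegral.integral_of_le ht.le]
    exact this.const_mul _
  have hI2 : Integrable (fun x => ((1 / t) * ∫ s in (0:ℝ)..t, ψ s x) ^ 2) μ := by
    refine Integrable.mono' hI (hm.pow 2) (Eventually.of_forall fun x => ?_)
    rw [Real.norm_eq_abs, abs_of_nonneg (sq_nonneg _)]
    exact cs_interval (hc x) ht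
  refine (integral_mono hI2 hI fun x => cs_interval (hc x) ht).trans ?_
  rw [integral_const_mul]
  simp only [intervalIntegral.integral_of_le ht.le]
  rw [integral_integral_swap hi]
  have hM' : ∫ s in Ioc 0 t, ∫ x, ψ s x ^ 2 ∂μ ≤ ∫ s in Ioc 0 t, M := by
    refine setIntegral_mono_on hi.integral_prod_right (by simp) measurableSet_Ioc hM
  rw [setIntegral_const] at hM'
  simp [ht.le] at hM'
  rw [one_div, inv_mul_le_iff₀ ht]
  exact hM'

end cacc

section tools
variable {d : ℕ}

lemma jensenC {X : Type*} [PseudoMetricSpace X] [ProperSpace X] [SecondCountableTopology X]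
    [MeasureSpace X] [BorelSpace X] [IsLocallyFiniteMeasure (volume : Measure X)]
    [SFinite (volume : Measure X)] {A : Set X} (hA : Bornology.IsBounded A)
    {ψ : ℝ → X → ℝ} (hψ : Continuous (fun p : X × ℝ => ψ p.2 p.1)) {t : ℝ} (ht : 0 < t) {M : ℝ}
    (hM : ∀ s ∈ Ioc 0 t, ∫ x in A, ψ s x ^ 2 ≤ M) :
    ∫ x in A, ((1 / t) * ∫ s in (0:ℝ)..t, ψ s x) ^ 2 ≤ M := by
  refine jensen_gen _ ht (fun x => ?_) ?_ ?_ hM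
  · exact hψ.comp (by fun_prop : Continuous fun s : ℝ => ((x, s) : X × ℝ))
  · rw [Measure.prod_restrict]
    have hc : Continuous (Function.uncurry fun (x : X) (s : ℝ) => ψ s x ^ 2) := hψ.pow 2
    have hb : Bornology.IsBounded (A ×ˢ Ioc 0 t) := hA.prod (isBounded_Ioc 0 t)
    rcases isEmpty_or_nonempty X with hX | hX
    · have : A = ∅ := Set.eq_empty_of_isEmpty A
      simp [this]
    obtain ⟨x0⟩ := hX
    obtain ⟨R, hR⟩ := hb.subset_closedBall (x0, 0)
    exact (hc.locallyIntegrable.integrableOn_isCompact (isCompact_closedBall _ R)).mono_set hR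
  · have : Continuous fun x => ∫ s in (0:ℝ)..t, ψ s x :=
      intervalIntegral.continuous_parametric_intervalIntegral_of_continuous' hψ 0 t
    exact (this.const_mul _ |>.aestronglyMeasurable)

lemma set_le {h : Eu d → ℝ} (h0 : ∀ x, 0 ≤ h x) {A A' : Set (Eu d)} (hAA : A ⊆ A')
    (hi : IntegrableOn h A') : ∫ x in A, h x ≤ ∫ x in A', h x :=
  setIntegral_mono_set hi (Eventually.of_forall h0) hAA.eventuallyLE

lemma shift_intOn {h : Eu d → ℝ} {A A' : Set (Eu d)} {v : Eu d} (hAA : ∀ x ∈ A, x + v ∈ A')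
    (hi : IntegrableOn h A') : IntegrableOn (fun x => h (x + v)) A := by
  have := ((measurePreserving_add_right (volume : Measure (Eu d)) v).integrableOn_comp_preimage
    (measurableEmbedding_addRight v) (f := h) (s := A')).2 hi
  exact this.mono_set hAA

lemma shift_le {h : Eu d → ℝ} (h0 : ∀ x, 0 ≤ h x) {A A' : Set (Eu d)} {v : Eu d}
    (hAA : ∀ x ∈ A, x + v ∈ A')
    (hi : IntegrableOn h A') : ∫ x in A, h (x + v) ≤ ∫ x in A', h x := by
  have e := (measurePreserving_add_right (volume : Measure (Eu d)) v).setIntegral_preimage_emb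
    (measurableEmbedding_addRight v) h A'
  have := ((measurePreserving_add_right (volume : Measure (Eu d)) v).integrableOn_comp_preimage
    (measurableEmbedding_addRight v) (f := h) (s := A')).2 hi
  rw [← e]
  exact set_le (h := fun x => h (x + v)) (fun x => h0 _) hAA this

/-- Lemma J -/
lemma lemJ {g : Eu d → ℝ} (hg : ContDiff ℝ 1 g) (j : Fin d) {t : ℝ} (ht : 0 < t) {A A' : Set (Eu d)}
    (hA : Bornology.IsBounded A) (hA' : Bornology.IsBounded A')
    (hAA : ∀ x ∈ A, ∀ s ∈ Icc 0 t, x + s • ev j ∈ A') :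
    ∫ x in A, (slp g j t x) ^ 2 ≤ ∫ x in A', (pd j g x) ^ 2 := by
  have e : ∀ x, slp g j t x = (1 / t) * ∫ s in (0:ℝ)..t, pd j g (x + s • ev j) := by
    intro x; rw [ftc_line hg]; unfold slp; ring
  simp only [e]
  have hc := pd_cont hg j
  refine jensenC hA (ψ := fun s x => pd j g (x + s • ev j)) (hc.comp (by fun_prop)) ht fun s hs => ?_
  exact shift_le (h := fun x => pd j g x ^ 2) (fun x => sq_nonneg _)
    (fun x hx => hAA x hx s ⟨hs.1.le, hs.2⟩) (cont_intOn (hc.pow 2) hA')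

/-- Lemma J2 -/
lemma lemJ2 {g : Eu d → ℝ} (hg : ContDiff ℝ 1 g) (j : Fin d) {t : ℝ} (ht : 0 < t) {A : Set (Eu d)}
    (hA : Bornology.IsBounded A) {M : ℝ}
    (hM : ∀ s ∈ Ioc 0 t, ∫ x in A, (pd j g (x + s • ev j) - pd j g x) ^ 2 ≤ M) :
    ∫ x in A, (slp g j t x - pd j g x) ^ 2 ≤ M := by
  have hc := pd_cont hg j
  have e : ∀ x, slp g j t x - pd j g x
      = (1 / t) * ∫ s in (0:ℝ)..t, (pd j g (x + s • ev j) - pd j g x) := by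
    intro x
    have i1 : IntervalIntegrable (fun s => pd j g (x + s • ev j)) volume 0 t := by
      apply Continuous.intervalIntegrable; exact hc.comp (by fun_prop)
    have i2 : IntervalIntegrable (fun _ : ℝ => pd j g x) volume 0 t := by
      apply Continuous.intervalIntegrable; fun_prop
    rw [intervalIntegral.integral_sub i1 i2, ftc_line hg]
    unfold slp
    simp
    field_simp
  simp only [e]
  exact jensenC hA (ψ := fun s x => pd j g (x + s • ev j) - pd j g x)
    ((hc.comp (by fun_prop)).sub (hc.comp (by fun_prop))) ht hM

lemma dil_le {Φ : Eu d → ℝ} (hΦ : Continuous Φ) (h0 : ∀ x, 0 ≤ Φ x) {R s : ℝ}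
    (hs : s ∈ Icc (1/2 : ℝ) 1) {z : Eu d} (hz : z ∈ ball (0 : Eu d) R) :
    ∫ x in ball (0 : Eu d) R, Φ (s • x + (1 - s) • z) ≤ 2 ^ d * ∫ x in ball (0 : Eu d) R, Φ x := by
  set B := ball (0 : Eu d) R
  have mB : MeasurableSet B := measurableSet_ball
  have s0 : 0 < s := lt_of_lt_of_le (by norm_num) hs.1
  set Ψ : Eu d → ℝ := B.indicator Φ
  have Ψ0 : ∀ x, 0 ≤ Ψ x := fun x => indicator_nonneg (fun x _ => h0 x) x
  have ΨI : Integrable Ψ := (integrable_indicator_iff mB).2 (cont_intOn hΦ isBounded_ball)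
  have ΨI2 : Integrable fun x => Ψ (s • x + (1 - s) • z) := by
    have h1 : Integrable fun x => Ψ (x + (1 - s) • z) := ΨI.comp_add_right _
    exact h1.comp_smul (R := s) s0.ne'
  have hle : ∫ x in B, Φ (s • x + (1 - s) • z) ≤ ∫ x, Ψ (s • x + (1 - s) • z) := by
    rw [← integral_indicator mB]
    refine integral_mono ((integrable_indicator_iff mB).2
      (cont_intOn (hΦ.comp (by fun_prop)) isBounded_ball)) ΨI2 fun x => ?_
    by_cases hx : x ∈ B
    · have hm : s • x + (1 - s) • z ∈ B :=
        (convex_ball (0 : Eu d) R) hx hz s0.le (by linarith [hs.2]) (by ring)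
      simp only [indicator_of_mem hx, Ψ, indicator_of_mem hm]; exact le_rfl
    · simp only [indicator_of_notMem hx]; exact Ψ0 _
  refine hle.trans ?_
  rw [Measure.integral_comp_smul (volume : Measure (Eu d)) (fun x => Ψ (x + (1 - s) • z)) s,
    integral_add_right_eq_self Ψ, integral_indicator mB]
  simp only [finrank_euclideanSpace, Fintype.card_fin, smul_eq_mul]
  refine mul_le_mul_of_nonneg_right ?_ (integral_nonneg fun x => h0 x)
  rw [abs_of_nonneg (by positivity), ← inv_pow]
  refine pow_le_pow_left₀ (by positivity) ?_ _
  rw [inv_le_comm₀ s0 (by norm_num)]; linarith [hs.1]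

end tools

section poincare
variable {d : ℕ}

lemma fderiv_eq_sum (g : Eu d → ℝ) (z v : Eu d) : fderiv ℝ g z v = ∑ k, v k * pd k g z := by
  have : v = ∑ k, v k • (ev k : Eu d) := by
    ext l
    simp [ev, Pi.single_apply]
  conv_lhs => rw [this]
  rw [map_sum]
  simp [pd]

lemma fderiv_sq_le (g : Eu d → ℝ) (z v : Eu d) : (fderiv ℝ g z v) ^ 2 ≤ ‖v‖ ^ 2 * gs g z := by
  rw [fderiv_eq_sum, EuclideanSpace.norm_sq_eq]
  simp only [Real.norm_eq_abs, sq_abs]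
  exact Finset.sum_mul_sq_le_sq_mul_sq _ _ _

lemma ftc_seg {g : Eu d → ℝ} (hg : ContDiff ℝ 1 g) (x v : Eu d) :
    ∫ s in (0:ℝ)..1, fderiv ℝ g (x + s • v) v = g (x + v) - g x := by
  have key : ∀ s : ℝ, HasDerivAt (fun s : ℝ => g (x + s • v)) (fderiv ℝ g (x + s • v) v) s := by
    intro s
    have h1 : HasDerivAt (fun s : ℝ => x + s • v) v s := by
      simpa using ((hasDerivAt_id s).smul_const v).const_add x
    exact ((diff1 hg (x + s • v)).hasFDerivAt).comp_hasDerivAt s h1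
  rw [intervalIntegral.integral_eq_sub_of_hasDerivAt (fun s _ => key s)]
  · simp
  · apply Continuous.intervalIntegrable
    exact ((hg.continuous_fderiv (by norm_num)).comp (by fun_prop)).clm_apply continuous_const

lemma poincare (g : Eu d → ℝ) (hg : ContDiff ℝ 1 g) (R : ℝ) (hR : 0 < R) :
    ∃ c, ∫ x in ball (0 : Eu d) R, (g x - c) ^ 2 ≤ 4 * 2 ^ d * R ^ 2 * ∫ x in ball (0 : Eu d) R, gs g x := by
  set B := ball (0 : Eu d) R with hB
  have mB : MeasurableSet B := measurableSet_ball
  have vB : volume B ≠ ⊤ := measure_ball_lt_top.ne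
  have vB0 : volume B ≠ 0 := (measure_ball_pos volume _ hR).ne'
  have gc := gs_cont hg
  have fc := hg.continuous_fderiv (by norm_num)
  set G := ∫ x in B, gs g x with hG
  have key : ∫ p in B ×ˢ B, ((1 / (1:ℝ)) * ∫ s in (0:ℝ)..1,
      fderiv ℝ g (p.1 + s • (p.2 - p.1)) (p.2 - p.1)) ^ 2 ≤ 4 * R ^ 2 * (volume.real B * (2 ^ d * G)) := by
    refine jensenC (X := Eu d × Eu d) (A := B ×ˢ B) (isBounded_ball.prod isBounded_ball)
      (ψ := fun s p => fderiv ℝ g (p.1 + s • (p.2 - p.1)) (p.2 - p.1)) ?_ one_pos fun t ht => ?_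
    · exact (fc.comp (by fun_prop)).clm_apply (by fun_prop)
    have cΦ : Continuous fun p : Eu d × Eu d => gs g (p.1 + t • (p.2 - p.1)) := gc.comp (by fun_prop)
    have hcpt : Bornology.IsBounded (B ×ˢ B) := isBounded_ball.prod isBounded_ball
    have int2 : ∀ φ : Eu d × Eu d → ℝ, Continuous φ → IntegrableOn φ (B ×ˢ B) := by
      intro φ hφ
      obtain ⟨R', hR'⟩ := hcpt.subset_closedBall 0
      exact (hφ.locallyIntegrable.integrableOn_isCompact (isCompact_closedBall 0 R')).mono_set hR'
    have s1 : ∫ p in B ×ˢ B, (fderiv ℝ g (p.1 + t • (p.2 - p.1)) (p.2 - p.1)) ^ 2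
        ≤ ∫ p in B ×ˢ B, 4 * R ^ 2 * gs g (p.1 + t • (p.2 - p.1)) := by
      refine setIntegral_mono_on (int2 _ ?_) (int2 _ (cΦ.const_mul _)) (mB.prod mB) fun p hp => ?_
      · exact ((fc.comp (by fun_prop)).clm_apply (by fun_prop)).pow 2
      refine (fderiv_sq_le _ _ _).trans (mul_le_mul_of_nonneg_right ?_ (gs_nonneg _ _))
      have h1 : ‖p.1‖ < R := by simpa [hB] using hp.1
      have h2 : ‖p.2‖ < R := by simpa [hB] using hp.2
      have h3 : ‖p.2 - p.1‖ ≤ 2 * R := (norm_sub_le _ _).trans (by linarith)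
      calc ‖p.2 - p.1‖ ^ 2 ≤ (2 * R) ^ 2 := by gcongr
        _ = _ := by ring
    refine s1.trans ?_
    rw [integral_const_mul]
    refine mul_le_mul_of_nonneg_left ?_ (by positivity)
    have hconst : ∫ _x in B, 2 ^ d * G = volume.real B * (2 ^ d * G) := by
      rw [setIntegral_const]; rfl
    have iΦ : Integrable (fun p : Eu d × Eu d => gs g (p.1 + t • (p.2 - p.1)))
        ((volume.restrict B).prod (volume.restrict B)) := by
      rw [Measure.prod_restrict]; exact int2 _ cΦ
    rw [← hconst, Measure.volume_eq_prod, ← Measure.prod_restrict]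
    have ic : IntegrableOn (fun _ : Eu d => 2 ^ d * G) B := cont_intOn continuous_const isBounded_ball
    rcases le_total t (1/2) with h | h
    · rw [integral_prod_symm _ iΦ]
      refine setIntegral_mono_on iΦ.integral_prod_right ic mB fun y hy => ?_
      have := dil_le gc (gs_nonneg g) (s := 1 - t) ⟨by linarith, by linarith [ht.1]⟩ hy
      refine le_trans (le_of_eq ?_) this
      refine integral_congr_ae (Eventually.of_forall fun x => ?_)
      show gs g (x + t • (y - x)) = gs g ((1 - t) • x + (1 - (1 - t)) • y)
      congr 1; module
    · rw [integral_prod _ iΦ]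
      refine setIntegral_mono_on iΦ.integral_prod_left ic mB fun y hy => ?_
      have := dil_le gc (gs_nonneg g) (s := t) ⟨by linarith, ht.2⟩ hy
      refine le_trans (le_of_eq ?_) this
      refine integral_congr_ae (Eventually.of_forall fun x => ?_)
      show gs g (y + t • (x - y)) = gs g (t • x + (1 - t) • y)
      congr 1; module
  have e : ∀ p : Eu d × Eu d, (1 / (1:ℝ)) * ∫ s in (0:ℝ)..1,
      fderiv ℝ g (p.1 + s • (p.2 - p.1)) (p.2 - p.1) = g p.2 - g p.1 := by
    intro p; rw [ftc_seg hg]; simp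
  simp only [e] at key
  have gcont := hg.continuous
  have iΨ : Integrable (fun p : Eu d × Eu d => (g p.2 - g p.1) ^ 2)
        ((volume.restrict B).prod (volume.restrict B)) := by
    rw [Measure.prod_restrict]
    have hcpt : Bornology.IsBounded (B ×ˢ B) := isBounded_ball.prod isBounded_ball
    obtain ⟨R', hR'⟩ := hcpt.subset_closedBall 0
    have hφ : Continuous fun p : Eu d × Eu d => (g p.2 - g p.1) ^ 2 := by fun_prop
    exact (hφ.locallyIntegrable.integrableOn_isCompact (isCompact_closedBall 0 R')).mono_set hR'
  rw [Measure.volume_eq_prod, ← Measure.prod_restrict, integral_prod_symm _ iΨ] at key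
  obtain ⟨y, hy, hle⟩ := exists_le_setAverage (μ := volume) vB0 vB iΨ.integral_prod_right
  refine ⟨g y, ?_⟩
  have hv : 0 < volume.real B := ENNReal.toReal_pos vB0 vB
  rw [setAverage_eq, smul_eq_mul, inv_mul_eq_div, le_div_iff₀ hv] at hle
  have e2 : ∫ x in B, (g x - g y) ^ 2 = ∫ x in B, (g y - g x) ^ 2 := by
    congr 1; ext x; ring
  rw [e2]
  have h3 := hle.trans key
  have h4 : (∫ x in B, (g y - g x) ^ 2) * volume.real B ≤ (4 * 2 ^ d * R ^ 2 * G) * volume.real B := by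
    refine h3.trans (le_of_eq ?_); ring
  exact le_of_mul_le_mul_right h4 hv

end poincare

section caccioppoli
variable {d : ℕ}

lemma set_le2 {X : Type*} [MeasurableSpace X] {μ : Measure X} {A : Set X} (mA : MeasurableSet A)
    {f g1 g2 : X → ℝ} (hf : IntegrableOn f A μ) (h1 : IntegrableOn g1 A μ) (h2 : IntegrableOn g2 A μ)
    (c1 c2 : ℝ) (h : ∀ x ∈ A, f x ≤ c1 * g1 x + c2 * g2 x) :
    ∫ x in A, f x ∂μ ≤ c1 * (∫ x in A, g1 x ∂μ) + c2 * ∫ x in A, g2 x ∂μ := by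
  have i1 : IntegrableOn (fun x => c1 * g1 x) A μ := h1.const_mul c1
  have i2 : IntegrableOn (fun x => c2 * g2 x) A μ := h2.const_mul c2
  rw [← integral_const_mul, ← integral_const_mul, ← integral_add i1 i2]
  exact setIntegral_mono_on hf (i1.add i2) mA h

lemma set_le3 {X : Type*} [MeasurableSpace X] {μ : Measure X} {A : Set X} (mA : MeasurableSet A)
    {f g1 g2 g3 : X → ℝ} (hf : IntegrableOn f A μ) (h1 : IntegrableOn g1 A μ) (h2 : IntegrableOn g2 A μ)
    (h3 : IntegrableOn g3 A μ)
    (c1 c2 c3 : ℝ) (h : ∀ x ∈ A, f x ≤ c1 * g1 x + c2 * g2 x + c3 * g3 x) :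
    ∫ x in A, f x ∂μ ≤ c1 * (∫ x in A, g1 x ∂μ) + c2 * (∫ x in A, g2 x ∂μ) + c3 * ∫ x in A, g3 x ∂μ := by
  have i1 : IntegrableOn (fun x => c1 * g1 x) A μ := h1.const_mul c1
  have i2 : IntegrableOn (fun x => c2 * g2 x) A μ := h2.const_mul c2
  have i3 : IntegrableOn (fun x => c3 * g3 x) A μ := h3.const_mul c3
  have i12 : IntegrableOn (fun x => c1 * g1 x + c2 * g2 x) A μ := i1.add i2
  rw [← integral_const_mul, ← integral_const_mul, ← integral_const_mul, ← integral_add i1 i2,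
    ← integral_add i12 i3]
  exact setIntegral_mono_on hf (i12.add i3) mA h

lemma pd_congr_open {u v : Eu d → ℝ} {O : Set (Eu d)} (hO : IsOpen O) (h : ∀ x ∈ O, u x = v x)
    (i : Fin d) : ∀ x ∈ O, pd i u x = pd i v x := by
  intro x hx
  unfold pd
  have : u =ᶠ[nhds x] v := by filter_upwards [hO.mem_nhds hx] with y hy using h y hy
  rw [this.fderiv_eq]

lemma pd2_congr_open {u v : Eu d → ℝ} {O : Set (Eu d)} (hO : IsOpen O) (h : ∀ x ∈ O, u x = v x)
    (i j : Fin d) : ∀ x ∈ O, pd2 i j u x = pd2 i j v x :=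
  pd_congr_open hO (pd_congr_open hO h j) i

lemma pd_subc {V : Eu d → ℝ} (hV : Differentiable ℝ V) (c : ℝ) (i : Fin d) (x : Eu d) :
    pd i (fun y => V y - c) x = pd i V x := by
  rw [pd_sub hV (by fun_prop), pd_const]; ring

lemma pd2_subc {V : Eu d → ℝ} (hV : ContDiff ℝ 2 V) (c : ℝ) (i j : Fin d) (x : Eu d) :
    pd2 i j (fun y => V y - c) x = pd2 i j V x := by
  unfold pd2; simp only [pd_subc (diff2 hV)]

lemma frz_eq {m : Fin d} {a : Fin d → Fin d → Eu d → ℝ} (h : OnlyC m a) : frz m a = a := by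
  ext i j x; unfold frz; apply h; simp [ev]

lemma OnlyC.near {m : Fin d} {a : Fin d → Fin d → Eu d → ℝ} (h : OnlyC m a) {η : ℝ} (hη : 0 ≤ η) :
    Near m η a := by
  intro x _ i j; rw [frz_eq h]; simpa using hη

lemma Near.mono {m : Fin d} {a : Fin d → Fin d → Eu d → ℝ} {η η' : ℝ} (h : Near m η a) (hη : η ≤ η') :
    Near m η' a := fun x hx i j => (h x hx i j).trans hη

lemma bump_bound {ζ : Eu d → ℝ} (h : ContDiff ℝ 2 ζ) (hc : HasCompactSupport ζ) :
    ∃ K : ℝ, 0 < K ∧ ∀ x, |ζ x| ≤ K ∧ (∀ i, |pd i ζ x| ≤ K) ∧ hs ζ x ≤ K := by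
  obtain ⟨K0, h0⟩ := hc.exists_bound_of_continuous h.continuous
  have h1 : ∀ i, ∃ K, ∀ x, ‖pd i ζ x‖ ≤ K := fun i =>
    (pd_hcs hc i).exists_bound_of_continuous (pd_contDiff h i).continuous
  choose K1 h1 using h1
  have h2 : ∀ i j, ∃ K, ∀ x, ‖pd2 i j ζ x‖ ≤ K := fun i j =>
    (pd2_hcs hc i j).exists_bound_of_continuous (pd2_cont h i j)
  choose K2 h2 using h2
  refine ⟨1 + |K0| + ∑ i, |K1 i| + ∑ i, ∑ j, (K2 i j) ^ 2, by positivity, fun x => ⟨?_, fun i => ?_, ?_⟩⟩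
  · have := h0 x
    rw [Real.norm_eq_abs] at this
    have a1 : 0 ≤ ∑ i, |K1 i| := by positivity
    have a2 : 0 ≤ ∑ i, ∑ j, (K2 i j) ^ 2 := by positivity
    linarith [le_abs_self K0]
  · have := h1 i x
    rw [Real.norm_eq_abs] at this
    have a1 : |K1 i| ≤ ∑ i, |K1 i| := Finset.single_le_sum (f := fun i => |K1 i|) (fun _ _ => abs_nonneg _) (Finset.mem_univ i)
    have a2 : 0 ≤ ∑ i, ∑ j, (K2 i j) ^ 2 := by positivity
    linarith [le_abs_self (K1 i), abs_nonneg K0]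
  · have : hs ζ x ≤ ∑ i, ∑ j, (K2 i j) ^ 2 := by
      unfold hs
      refine Finset.sum_le_sum fun i _ => Finset.sum_le_sum fun j _ => ?_
      have := h2 i j x
      rw [Real.norm_eq_abs] at this
      exact sq_le_sq' (by linarith [neg_abs_le (pd2 i j ζ x)]) (le_trans (le_abs_self _) this)
    have a1 : 0 ≤ ∑ i, |K1 i| := by positivity
    linarith [abs_nonneg K0]

lemma LL_prod_sq {ν : ℝ} (hν : 0 < ν) {a : Fin d → Fin d → Eu d → ℝ} (ha : Coef ν a)
    {ζ V : Eu d → ℝ} (hζ : ContDiff ℝ 2 ζ) (hV : ContDiff ℝ 2 V) (c K : ℝ) (x : Eu d)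
    (h0 : |ζ x| ≤ K) (h1 : ∀ i, |pd i ζ x| ≤ K) (h2 : hs ζ x ≤ K) :
    (LL a (fun y => ζ y * (V y - c)) x) ^ 2 ≤
      3 * K ^ 2 * (LL a V x) ^ 2 + 3 * ((2 * d * ν⁻¹ * K) ^ 2 * d) * gs V x
        + 3 * (ν⁻¹ ^ 2 * d ^ 2 * K) * (V x - c) ^ 2 := by
  have hνi : 0 < ν⁻¹ := inv_pos.2 hν
  have K0 : 0 ≤ K := (abs_nonneg _).trans h0
  set X := ∑ i, ∑ j, a i j x * (pd i ζ x * pd j V x + pd j ζ x * pd i V x) with hX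
  have e : LL a (fun y => ζ y * (V y - c)) x = ζ x * LL a V x + X + (V x - c) * LL a ζ x := by
    unfold LL
    rw [hX, Finset.mul_sum, Finset.mul_sum, ← Finset.sum_add_distrib, ← Finset.sum_add_distrib]
    refine Finset.sum_congr rfl fun i _ => ?_
    rw [Finset.mul_sum, Finset.mul_sum, ← Finset.sum_add_distrib, ← Finset.sum_add_distrib]
    refine Finset.sum_congr rfl fun j _ => ?_
    rw [pd2_mul (v := fun y => V y - c) hζ (hV.sub contDiff_const), pd2_subc hV, pd_subc (diff2 hV), pd_subc (diff2 hV)]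
    ring
  have hX2 : X ^ 2 ≤ (2 * d * ν⁻¹ * K) ^ 2 * d * gs V x := by
    have b1 : |X| ≤ (2 * d * ν⁻¹ * K) * ∑ j, |pd j V x| := by
      calc |X| ≤ ∑ i, ∑ j, (ν⁻¹ * K * |pd j V x| + ν⁻¹ * K * |pd i V x|) := by
            refine (Finset.abs_sum_le_sum_abs _ _).trans (Finset.sum_le_sum fun i _ => ?_)
            refine (Finset.abs_sum_le_sum_abs _ _).trans (Finset.sum_le_sum fun j _ => ?_)
            rw [abs_mul]
            calc |a i j x| * |pd i ζ x * pd j V x + pd j ζ x * pd i V x|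
                ≤ ν⁻¹ * (|pd i ζ x| * |pd j V x| + |pd j ζ x| * |pd i V x|) := by
                  refine mul_le_mul (ha.bdd hν i j x) ?_ (abs_nonneg _) hνi.le
                  rw [← abs_mul, ← abs_mul]; exact abs_add_le _ _
              _ ≤ ν⁻¹ * (K * |pd j V x| + K * |pd i V x|) := by
                  have := h1 i
                  have := h1 j
                  gcongr
              _ = _ := by ring
        _ = _ := by
            simp only [Finset.sum_add_distrib, Finset.sum_const, Finset.card_univ, Fintype.card_fin, nsmul_eq_mul, ← Finset.mul_sum]
            ring
    have b2 : (∑ j, |pd j V x|) ^ 2 ≤ d * gs V x := by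
      have := sq_sum_le_card_mul_sum_sq (s := (Finset.univ : Finset (Fin d))) (f := fun j => |pd j V x|)
      simpa [gs] using this
    calc X ^ 2 = |X| ^ 2 := (sq_abs _).symm
      _ ≤ ((2 * d * ν⁻¹ * K) * ∑ j, |pd j V x|) ^ 2 := by gcongr
      _ = (2 * d * ν⁻¹ * K) ^ 2 * (∑ j, |pd j V x|) ^ 2 := by ring
      _ ≤ (2 * d * ν⁻¹ * K) ^ 2 * (d * gs V x) := by gcongr
      _ = _ := by ring
  have hζ2 : (LL a ζ x) ^ 2 ≤ ν⁻¹ ^ 2 * d ^ 2 * K := by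
    refine (LL_sq_le a _ ζ x fun i j => ha.bdd hν i j x).trans ?_
    gcongr
  have hA : (ζ x * LL a V x) ^ 2 ≤ K ^ 2 * (LL a V x) ^ 2 := by
    rw [mul_pow]
    have : ζ x ^ 2 ≤ K ^ 2 := by rw [← sq_abs]; gcongr
    gcongr
  have hC : ((V x - c) * LL a ζ x) ^ 2 ≤ ν⁻¹ ^ 2 * d ^ 2 * K * (V x - c) ^ 2 := by
    rw [mul_pow, mul_comm]
    gcongr
  rw [e]
  have : (ζ x * LL a V x + X + (V x - c) * LL a ζ x) ^ 2 ≤ 3 * (ζ x * LL a V x) ^ 2 + 3 * X ^ 2 + 3 * ((V x - c) * LL a ζ x) ^ 2 := by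
    nlinarith [sq_nonneg (ζ x * LL a V x - X), sq_nonneg (ζ x * LL a V x - (V x - c) * LL a ζ x), sq_nonneg (X - (V x - c) * LL a ζ x)]
  linarith

lemma cacc (d : ℕ) (ν : ℝ) (hν : 0 < ν) : ∃ η : ℝ, 0 < η ∧ ∀ r R : ℝ, 0 < r → r < R → R ≤ 1 → ∃ C : ℝ, 0 < C ∧
    ∀ (m : Fin d) (a : Fin d → Fin d → Eu d → ℝ), Coef ν a → Near m η a →
    ∀ V : Eu d → ℝ, ContDiff ℝ 2 V →
      ∫ x in ball (0 : Eu d) r, hs V x ≤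
        C * ((∫ x in ball (0 : Eu d) R, (LL a V x) ^ 2) + ∫ x in ball (0 : Eu d) R, gs V x) := by
  obtain ⟨η, hη, C, hC, h⟩ := energy1 d ν hν
  refine ⟨η, hη, fun r R hr hrR hR => ?_⟩
  let b : ContDiffBump (0 : Eu d) := ⟨r, (r + R) / 2, hr, by linarith⟩
  set ζ : Eu d → ℝ := fun x => b x with hζd
  have hζ : ContDiff ℝ 2 ζ := b.contDiff
  have cζ : HasCompactSupport ζ := b.hasCompactSupport
  have tζ : tsupport ζ ⊆ ball 0 R := by
    show tsupport b ⊆ _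
    rw [b.tsupport_eq]
    exact closedBall_subset_ball (by show (r + R) / 2 < R; linarith)
  obtain ⟨K, hK, hb⟩ := bump_bound hζ cζ
  have hνi : 0 < ν⁻¹ := inv_pos.2 hν
  set C1 := 3 * K ^ 2 with hC1
  set C2 := 3 * ((2 * d * ν⁻¹ * K) ^ 2 * d) with hC2
  set C3 := 3 * (ν⁻¹ ^ 2 * d ^ 2 * K) with hC3
  have p1 : 0 < C1 := by positivity
  have p2 : 0 ≤ C2 := by positivity
  have p3 : 0 ≤ C3 := by positivity
  refine ⟨C * (C1 + C2 + C3 * (4 * 2 ^ d * R ^ 2)), by positivity, fun m a ha hn V hV => ?_⟩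
  obtain ⟨c, hc⟩ := poincare V (hV.of_le (by norm_num)) R (hr.trans hrR)
  set w : Eu d → ℝ := fun y => ζ y * (V y - c) with hw
  have hwC : ContDiff ℝ 2 w := hζ.mul (hV.sub contDiff_const)
  have cw : HasCompactSupport w := cζ.mul_right
  have tw : tsupport w ⊆ ball 0 R := (tsupport_mul_subset_left (f := ζ) (g := fun y => V y - c)).trans tζ
  have h0 := h m a ha hn w hwC cw (tw.trans (ball_subset_ball hR))
  set B := ball (0 : Eu d) R
  have mB : MeasurableSet B := measurableSet_ball
  have hBb : Bornology.IsBounded B := isBounded_ball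
  have hVc := hV.continuous
  have e1 : ∫ x, (LL a w x) ^ 2 = ∫ x in B, (LL a w x) ^ 2 := by
    rw [setIntegral_eq_integral_of_forall_compl_eq_zero]
    intro x hx
    have : LL a w x = 0 := by
      unfold LL; simp [pd2_zero_of_notMem (fun h => hx (tw h))]
    simp [this]
  have e2 := set_le3 mB (LL_intOn hν ha hwC hBb) (LL_intOn hν ha hV hBb)
    (cont_intOn (gs_cont (hV.of_le (by norm_num))) hBb)
    (cont_intOn (by fun_prop : Continuous fun x => (V x - c) ^ 2) hBb) C1 C2 C3 fun x hx =>
      LL_prod_sq hν ha hζ hV c K x (hb x).1 (hb x).2.1 (hb x).2.2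
  have e3 : ∫ x in ball (0 : Eu d) r, hs V x = ∫ x in ball (0 : Eu d) r, hs w x := by
    refine setIntegral_congr_fun measurableSet_ball fun x hx => ?_
    have : ∀ y ∈ ball (0 : Eu d) r, w y = V y - c := by
      intro y hy
      have : ζ y = 1 := b.one_of_mem_closedBall (ball_subset_closedBall hy)
      simp [hw, this]
    unfold hs
    refine Finset.sum_congr rfl fun i _ => Finset.sum_congr rfl fun j _ => ?_
    rw [pd2_congr_open isOpen_ball this i j x hx, pd2_subc hV]
  have e4 : ∫ x in ball (0 : Eu d) r, hs w x ≤ ∫ x, hs w x := by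
    refine setIntegral_le_integral ?_ (Eventually.of_forall fun x => hs_nonneg w x)
    unfold hs
    exact integrable_finsetSum _ fun i _ => integrable_finsetSum _ fun j _ => 
     ((pd2_cont hwC i j).pow 2).integrable_of_hasCompactSupport
      (by simpa [sq] using (pd2_hcs cw i j).mul_right (f' := pd2 i j w))
  have g0 : 0 ≤ ∫ x in B, gs V x := integral_nonneg fun x => gs_nonneg V x
  have l0 : 0 ≤ ∫ x in B, (LL a V x) ^ 2 := integral_nonneg fun x => sq_nonneg _
  set GG := ∫ x in B, gs V x
  set LV := ∫ x in B, (LL a V x) ^ 2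
  rw [e3]
  refine e4.trans (h0.trans ?_)
  rw [e1, mul_assoc]
  refine mul_le_mul_of_nonneg_left (e2.trans ?_) hC.le
  have h5 := mul_le_mul_of_nonneg_left hc p3
  have q1 : 0 ≤ C3 * (4 * 2 ^ d * R ^ 2) := by positivity
  nlinarith [mul_nonneg p1.le g0, mul_nonneg p2 l0, mul_nonneg q1 l0]

end caccioppoli

section dsob
variable {d : ℕ}

/-- ball intersected with slabs -/
def AS (S : Finset (Fin d)) (ρ r : ℝ) : Set (Eu d) := {x | x ∈ ball (0 : Eu d) r ∧ ∀ j ∈ S, |x j| < ρ}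

lemma AS_meas (S : Finset (Fin d)) (ρ r : ℝ) : MeasurableSet (AS S ρ r) := by
  refine (IsOpen.inter isOpen_ball ?_).measurableSet
  have : {x : Eu d | ∀ j ∈ S, |x j| < ρ} = ⋂ j ∈ S, {x : Eu d | |x j| < ρ} := by ext; simp
  show IsOpen {x : Eu d | ∀ j ∈ S, |x j| < ρ}
  rw [this]
  refine isOpen_biInter_finset fun j _ => isOpen_lt (by fun_prop) continuous_const

lemma AS_sub (S : Finset (Fin d)) (ρ r : ℝ) : AS S ρ r ⊆ ball (0 : Eu d) r := fun _ h => h.1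

lemma AS_bdd (S : Finset (Fin d)) (ρ r : ℝ) : Bornology.IsBounded (AS S ρ r) :=
  isBounded_ball.subset (AS_sub S ρ r)

lemma AS_empty (ρ r : ℝ) : AS (∅ : Finset (Fin d)) ρ r = ball (0 : Eu d) r := by
  ext; simp [AS]

lemma AS_mono (S : Finset (Fin d)) {ρ ρ' r r' : ℝ} (h1 : ρ ≤ ρ') (h2 : r ≤ r') : AS S ρ r ⊆ AS S ρ' r' :=
  fun _ h => ⟨ball_subset_ball h2 h.1, fun j hj => (h.2 j hj).trans_le h1⟩

lemma norm_shift {x : Eu d} {j : Fin d} {s r L : ℝ} (hx : x ∈ ball (0 : Eu d) r) (hs : |s| ≤ L) :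
    x + s • ev j ∈ ball (0 : Eu d) (r + L) := by
  rw [mem_ball_zero_iff] at hx ⊢
  refine (norm_add_le _ _).trans_lt ?_
  rw [norm_smul, norm_ev, mul_one, Real.norm_eq_abs]; linarith

lemma AS_shift {S : Finset (Fin d)} {j : Fin d} (hj : j ∉ S) {ρ r L s : ℝ} {x : Eu d}
    (hx : x ∈ AS S ρ r) (hs : |s| ≤ L) : x + s • ev j ∈ AS S ρ (r + L) := by
  refine ⟨norm_shift hx.1 hs, fun k hk => ?_⟩
  have : k ≠ j := fun h => hj (h ▸ hk)
  simpa [ev, this] using hx.2 k hk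

lemma lemS {S : Finset (Fin d)} {j : Fin d} (hj : j ∉ S) {ρ r L : ℝ} (hL : 0 < L) (hρ : 0 < ρ)
    (hρL : 2 * ρ ≤ L) {g : Eu d → ℝ} (hg : Continuous g) :
    ∫ x in AS (insert j S) ρ r, g x ^ 2 ≤ (8 / L + 4 * L) * ρ *
      ((∫ x in AS S ρ (r + L), g x ^ 2) + ∫ x in AS S ρ (r + L), (slp g j (2 * ρ) x) ^ 2) := by
  set E := AS (insert j S) ρ r with hE
  set A := AS S ρ (r + L) with hA
  set h := 2 * ρ with hh
  have h0 : 0 < h := by positivity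
  have E_sub : E ⊆ AS S ρ r := fun x hx => ⟨hx.1, fun k hk => hx.2 k (Finset.mem_insert_of_mem hk)⟩
  set N := ⌊L / h⌋₊ with hN
  have hN1 : (N : ℝ) ≤ L / h := Nat.floor_le (by positivity)
  have hN2 : L / h < N + 1 := Nat.lt_floor_add_one _
  have hN3 : 1 ≤ L / h := by rw [le_div_iff₀ h0]; linarith
  have hN4 : (1:ℝ) ≤ N := by
    have : 1 ≤ N := Nat.le_floor (by simpa using hN3)
    exact_mod_cast this
  have hN5 : L / h ≤ 2 * N := by linarith
  have hNL : (N : ℝ) * h ≤ L := by rwa [le_div_iff₀ h0] at hN1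
  have mE : MeasurableSet E := AS_meas _ _ _
  have mA : MeasurableSet A := AS_meas _ _ _
  have bE : Bornology.IsBounded E := AS_bdd _ _ _
  have bA : Bornology.IsBounded A := AS_bdd _ _ _
  -- disjoint shifts
  have disj : ∀ φ : Eu d → ℝ, Continuous φ → (∀ x, 0 ≤ φ x) →
      ∑ n ∈ Finset.range N, ∫ x in E, φ (x + ((n : ℝ) * h) • ev j) ≤ ∫ x in A, φ x := by
    intro φ hφ φ0
    let En : ℕ → Set (Eu d) := fun n => (fun y => y - ((n : ℝ) * h) • ev j) ⁻¹' E
    have mEn : ∀ n, MeasurableSet (En n) := fun n => mE.preimage (by fun_prop)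
    have subEn : ∀ n ∈ Finset.range N, En n ⊆ A := by
      intro n hn y hy
      have h1 : ((n : ℝ)) ≤ N := by exact_mod_cast (Finset.mem_range.1 hn).le
      have := AS_shift hj (E_sub hy) (s := (n : ℝ) * h) (L := L) (by
        rw [abs_of_nonneg (by positivity)]
        exact (mul_le_mul_of_nonneg_right h1 h0.le).trans hNL)
      simpa using this
    have iEn : ∀ n ∈ Finset.range N, IntegrableOn φ (En n) := fun n hn =>
      (cont_intOn hφ bA).mono_set (subEn n hn)
    calc ∑ n ∈ Finset.range N, ∫ x in E, φ (x + ((n : ℝ) * h) • ev j) 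
        ≤ ∑ n ∈ Finset.range N, ∫ x in En n, φ x := by
          refine Finset.sum_le_sum fun n hn => shift_le φ0 (fun x hx => ?_) (iEn n hn)
          show x + ((n : ℝ) * h) • ev j - ((n : ℝ) * h) • ev j ∈ E
          simpa using hx
      _ = ∫ x in ⋃ n ∈ Finset.range N, En n, φ x := by
          rw [integral_biUnion_finset _ (fun n _ => mEn n) ?_ iEn]
          intro n hn l hl hnl
          rw [Function.onFun, Set.disjoint_left]
          intro y hy1 hy2
          have a1 := hy1.2 j (Finset.mem_insert_self _ _)
          have a2 := hy2.2 j (Finset.mem_insert_self _ _)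
          simp [ev] at a1 a2
          rw [abs_lt] at a1 a2
          rcases lt_or_gt_of_ne hnl with h' | h'
          · have : (n : ℝ) + 1 ≤ l := by exact_mod_cast h'
            nlinarith
          · have : (l : ℝ) + 1 ≤ n := by exact_mod_cast h'
            nlinarith
      _ ≤ ∫ x in A, φ x := by
          refine set_le φ0 ?_ (cont_intOn hφ bA)
          exact Set.iUnion₂_subset subEn
  have sc : Continuous (slp g j h) := slp_cont hg j h
  have pt : ∀ x, ∀ n ∈ Finset.range N, g x ^ 2 ≤ 2 * g (x + ((n : ℝ) * h) • ev j) ^ 2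
      + 2 * h ^ 2 * N * ∑ l ∈ Finset.range N, (slp g j h (x + ((l : ℝ) * h) • ev j)) ^ 2 := by
    intro x n hn
    have tel : g (x + ((n : ℝ) * h) • ev j) - g x
        = ∑ l ∈ Finset.range n, h * slp g j h (x + ((l : ℝ) * h) • ev j) := by
      have := Finset.sum_range_sub (fun l : ℕ => g (x + ((l : ℝ) * h) • ev j)) n
      simp only [Nat.cast_zero, zero_mul, zero_smul, add_zero] at this
      rw [← this]
      refine Finset.sum_congr rfl fun l _ => ?_
      unfold slp
      rw [mul_div_cancel₀ _ h0.ne', add_assoc, ← add_smul]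
      push_cast
      congr 4; ring
    have b1 : (g (x + ((n : ℝ) * h) • ev j) - g x) ^ 2 ≤ h ^ 2 * N * ∑ l ∈ Finset.range N, (slp g j h (x + ((l : ℝ) * h) • ev j)) ^ 2 := by
      rw [tel, ← Finset.mul_sum, mul_pow, mul_assoc]
      refine mul_le_mul_of_nonneg_left ?_ (sq_nonneg _)
      refine (sq_sum_le_card_mul_sum_sq).trans ?_
      rw [Finset.card_range]
      have hn' := (Finset.mem_range.1 hn).le
      have : (n : ℝ) ≤ N := by exact_mod_cast hn'
      refine mul_le_mul this ?_ (Finset.sum_nonneg fun _ _ => sq_nonneg _) (by positivity)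
      exact Finset.sum_le_sum_of_subset_of_nonneg (Finset.range_mono hn') fun _ _ _ => sq_nonneg _
    nlinarith [sq_nonneg (g (x + ((n : ℝ) * h) • ev j) + (g (x + ((n : ℝ) * h) • ev j) - g x))]
  set I := ∫ x in E, g x ^ 2 with hI
  set P := ∫ x in A, g x ^ 2 with hP
  set Q := ∫ x in A, (slp g j h x) ^ 2 with hQ
  have cg2 : ∀ n : ℕ, Continuous fun x => g (x + ((n : ℝ) * h) • ev j) ^ 2 := fun n =>
    (hg.comp (by fun_prop)).pow 2
  have cs2 : ∀ n : ℕ, Continuous fun x => slp g j h (x + ((n : ℝ) * h) • ev j) ^ 2 := fun n =>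
    (sc.comp (by fun_prop)).pow 2
  have css : Continuous fun x => ∑ l ∈ Finset.range N, (slp g j h (x + ((l : ℝ) * h) • ev j)) ^ 2 :=
    continuous_finsetSum _ fun l _ => cs2 l
  have hsum := Finset.sum_le_sum fun n (hn : n ∈ Finset.range N) =>
    set_le2 mE (cont_intOn (hg.pow 2) bE) (cont_intOn (cg2 n) bE) (cont_intOn css bE) 2 (2 * h ^ 2 * N)
      fun x _ => pt x n hn
  rw [Finset.sum_const, Finset.card_range, nsmul_eq_mul, Finset.sum_add_distrib, Finset.sum_const,
    Finset.card_range, nsmul_eq_mul, ← Finset.mul_sum,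
    integral_finsetSum _ (fun l _ => cont_intOn (cs2 l) bE)] at hsum
  have d1 := disj (fun x => g x ^ 2) (hg.pow 2) fun _ => sq_nonneg _
  have d2 := disj (fun x => slp g j h x ^ 2) (sc.pow 2) fun _ => sq_nonneg _
  have P0 : 0 ≤ P := integral_nonneg fun _ => sq_nonneg _
  have Q0 : 0 ≤ Q := integral_nonneg fun _ => sq_nonneg _
  have f1 : (N : ℝ) * I ≤ 2 * P + N * (2 * h ^ 2 * N * Q) := by
    refine hsum.trans ?_
    have := mul_le_mul_of_nonneg_left d2 (by positivity : 0 ≤ (N : ℝ) * (2 * h ^ 2 * N))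
    nlinarith
  have Npos : (0:ℝ) < N := by linarith
  have f2 : I ≤ 2 / N * P + 2 * h ^ 2 * N * Q := by
    rw [← mul_le_mul_iff_right₀ Npos]
    refine f1.trans (le_of_eq ?_)
    field_simp
  have c1 : 2 / (N : ℝ) ≤ 8 / L * ρ := by
    rw [div_le_iff₀ Npos]
    rw [div_le_iff₀ h0] at hN5
    have : 2 = 2 / L * L := by field_simp
    have h8 : 2 / L * L ≤ 2 / L * (2 * N * h) := mul_le_mul_of_nonneg_left hN5 (by positivity)
    have : 2 / L * (2 * N * h) = 8 / L * ρ * N := by rw [hh]; ring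
    linarith
  have c2 : 2 * h ^ 2 * N ≤ 4 * L * ρ := by
    have := mul_le_mul_of_nonneg_left hNL h0.le
    nlinarith
  have k1 : 0 ≤ 8 / L * ρ := by positivity
  have k2 : 0 ≤ 4 * L * ρ := by positivity
  calc I ≤ 8 / L * ρ * P + 4 * L * ρ * Q := f2.trans (by gcongr)
    _ ≤ _ := by nlinarith

end dsob

section pslemma
variable {d : ℕ}

lemma slp_eq (U : Eu d → ℝ) (j : Fin d) (h : ℝ) :
    slp U j h = fun x => h⁻¹ * (U (x + h • ev j) - U x) := by
  ext x; unfold slp; ring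

lemma shift_contDiff {n : WithTop ℕ∞} {U : Eu d → ℝ} (hU : ContDiff ℝ n U) (v : Eu d) :
    ContDiff ℝ n fun x => U (x + v) := hU.comp (contDiff_id.add contDiff_const)

lemma slp_contDiff {n : WithTop ℕ∞} {U : Eu d → ℝ} (hU : ContDiff ℝ n U) (j : Fin d) (h : ℝ) :
    ContDiff ℝ n (slp U j h) := by
  rw [slp_eq]
  exact contDiff_const.mul ((shift_contDiff hU _).sub hU)

lemma pd_slp {U : Eu d → ℝ} (hU : ContDiff ℝ 1 U) (j : Fin d) (h : ℝ) (k : Fin d) (x : Eu d) :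
    pd k (slp U j h) x = slp (pd k U) j h x := by
  rw [slp_eq, slp_eq, pd_const_mul (u := fun x => U (x + h • ev j) - U x)
    (diff1 ((shift_contDiff hU _).sub hU)), pd_sub (diff1 (shift_contDiff hU _)) (diff1 hU), pd_shift]

lemma pd2_slp {U : Eu d → ℝ} (hU : ContDiff ℝ 2 U) (j : Fin d) (h : ℝ) (k l : Fin d) (x : Eu d) :
    pd2 k l (slp U j h) x = slp (pd2 k l U) j h x := by
  have : pd l (slp U j h) = slp (pd l U) j h := by
    ext y; exact pd_slp (hU.of_le (by norm_num)) j h l y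
  rw [pd2_eq, this, pd_slp (pd_contDiff hU l)]; rfl

lemma LL_slp {a : Fin d → Fin d → Eu d → ℝ} {U : Eu d → ℝ} (hU : ContDiff ℝ 2 U) (j : Fin d) (h : ℝ)
    (ha : ∀ k l x, a k l (x + h • ev j) = a k l x) (x : Eu d) :
    LL a (slp U j h) x = slp (LL a U) j h x := by
  rw [slp_eq, slp_eq, LL_const_mul (u := fun x => U (x + h • ev j) - U x)
    ((shift_contDiff hU _).sub hU), LL_sub (shift_contDiff hU _) hU, LL_shift _ ha]

lemma int_hs {U : Eu d → ℝ} (hU : ContDiff ℝ 2 U) {A : Set (Eu d)} (hA : Bornology.IsBounded A) :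
    ∫ x in A, hs U x = ∑ k, ∑ l, ∫ x in A, pd2 k l U x ^ 2 := by
  unfold hs
  have i1 : ∀ k l, IntegrableOn (fun x => pd2 k l U x ^ 2) A := fun k l =>
    cont_intOn ((pd2_cont hU k l).pow 2) hA
  rw [integral_finsetSum _ fun k _ => integrable_finsetSum _ fun l _ => i1 k l]
  exact Finset.sum_congr rfl fun k _ => integral_finsetSum _ fun l _ => i1 k l

lemma int_gs {U : Eu d → ℝ} (hU : ContDiff ℝ 1 U) {A : Set (Eu d)} (hA : Bornology.IsBounded A) :
    ∫ x in A, gs U x = ∑ k, ∫ x in A, pd k U x ^ 2 := by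
  unfold gs
  exact integral_finsetSum _ fun k _ => cont_intOn ((pd_cont hU k).pow 2) hA

lemma gs_slp_le {U : Eu d → ℝ} (hU : ContDiff ℝ 2 U) (j : Fin d) {h : ℝ} (h0 : 0 < h)
    {A A' : Set (Eu d)} (hA : Bornology.IsBounded A) (hA' : Bornology.IsBounded A')
    (hAA : ∀ x ∈ A, ∀ s ∈ Icc 0 h, x + s • ev j ∈ A') :
    ∫ x in A, gs (slp U j h) x ≤ ∫ x in A', hs U x := by
  rw [int_gs (slp_contDiff (hU.of_le (by norm_num)) j h) hA, int_hs hU hA']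
  refine le_trans (Finset.sum_le_sum fun k _ => ?_)
    (Finset.single_le_sum (f := fun k => ∑ l, ∫ x in A', pd2 k l U x ^ 2)
    (fun k _ => Finset.sum_nonneg fun l _ => integral_nonneg fun _ => sq_nonneg _) (Finset.mem_univ j))
  simp only [pd_slp (hU.of_le (by norm_num))]
  exact lemJ (pd_contDiff hU k) j h0 hA hA' hAA

lemma LL_slp_le {ν : ℝ} (hν : 0 < ν) {a : Fin d → Fin d → Eu d → ℝ} (hc : Coef ν a)
    {U : Eu d → ℝ} (hU : ContDiff ℝ 2 U) (j : Fin d) {h : ℝ} (h0 : 0 < h)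
    (ha : ∀ k l x, a k l (x + h • ev j) = a k l x)
    {A A' : Set (Eu d)} (mA : MeasurableSet A) (hA : Bornology.IsBounded A) (hA' : Bornology.IsBounded A')
    (hAA : A ⊆ A') (hs : ∀ x ∈ A, x + h • ev j ∈ A') :
    ∫ x in A, (LL a (slp U j h) x) ^ 2 ≤ 4 / h ^ 2 * ∫ x in A', (LL a U x) ^ 2 := by
  have iA' := LL_intOn hν hc hU hA'
  have := set_le2 mA (LL_intOn hν hc (slp_contDiff hU j h) hA) (shift_intOn hs iA') (iA'.mono_set hAA)
    (2 / h ^ 2) (2 / h ^ 2) fun x _ => by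
      rw [LL_slp hU j h ha, slp, div_pow]
      have e : 2 / h ^ 2 * LL a U (x + h • ev j) ^ 2 + 2 / h ^ 2 * LL a U x ^ 2
        = (2 * LL a U (x + h • ev j) ^ 2 + 2 * LL a U x ^ 2) / h ^ 2 := by ring
      rw [e, div_le_div_iff_of_pos_right (by positivity)]
      nlinarith [sq_nonneg (LL a U (x + h • ev j) + LL a U x)]
  refine this.trans ?_
  have h1 := shift_le (fun x => sq_nonneg (LL a U x)) hs iA'
  have h2 := set_le (fun x => sq_nonneg (LL a U x)) hAA iA'
  have h3 : 0 ≤ 2 / h ^ 2 := by positivity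
  have e : 4 / h ^ 2 = 2 / h ^ 2 + 2 / h ^ 2 := by ring
  rw [e, add_mul]
  gcongr

lemma hs_lemS {S : Finset (Fin d)} {j : Fin d} (hj : j ∉ S) {ρ r L : ℝ} (hL : 0 < L) (hρ : 0 < ρ)
    (hρL : 2 * ρ ≤ L) {U : Eu d → ℝ} (hU : ContDiff ℝ 2 U) :
    ∫ x in AS (insert j S) ρ r, hs U x ≤ (8 / L + 4 * L) * ρ *
      ((∫ x in AS S ρ (r + L), hs U x) + ∫ x in AS S ρ (r + L), hs (slp U j (2 * ρ)) x) := by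
  rw [int_hs hU (AS_bdd _ _ _), int_hs hU (AS_bdd _ _ _), int_hs (slp_contDiff hU _ _) (AS_bdd _ _ _),
    ← Finset.sum_add_distrib, Finset.mul_sum]
  refine Finset.sum_le_sum fun k _ => ?_
  rw [← Finset.sum_add_distrib, Finset.mul_sum]
  refine Finset.sum_le_sum fun l _ => ?_
  simp only [pd2_slp hU]
  exact lemS hj hL hρ hρL (pd2_cont hU k l)

lemma lemPS (d : ℕ) (ν : ℝ) (hν : 0 < ν) (m : Fin d) (S : Finset (Fin d)) : m ∉ S → ∀ r R : ℝ, 0 < r → r < R → R ≤ 1 →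
    ∃ C : ℝ, 0 < C ∧ ∃ ρ0 : ℝ, 0 < ρ0 ∧ ∀ ρ : ℝ, 0 < ρ → ρ ≤ ρ0 → ∃ C' : ℝ, 0 < C' ∧
    ∀ a : Fin d → Fin d → Eu d → ℝ, Coef ν a → OnlyC m a → ∀ U : Eu d → ℝ, ContDiff ℝ 2 U →
      ∫ x in AS S ρ r, hs U x ≤ C * ρ ^ S.card * (∫ x in ball (0 : Eu d) R, hs U x)
        + C' * ∫ x in ball (0 : Eu d) R, (LL a U x) ^ 2 := by
  obtain ⟨η, hη, hcacc⟩ := cacc d ν hν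
  induction S using Finset.induction_on with
  | empty =>
    intro _ r R hr hrR hR
    refine ⟨1, one_pos, 1, one_pos, fun ρ _ _ => ⟨1, one_pos, fun a ha ho U hU => ?_⟩⟩
    rw [AS_empty]
    have := set_le (hs_nonneg U) (ball_subset_ball hrR.le) (cont_intOn (hs_cont hU) (isBounded_ball (x := (0 : Eu d)) (r := R)))
    have h2 : 0 ≤ ∫ x in ball (0 : Eu d) R, (LL a U x) ^ 2 := integral_nonneg fun _ => sq_nonneg _
    simp; linarith
  | insert j S hjS ih =>
    intro hm r R hr hrR hR
    have hmS : m ∉ S := fun h => hm (Finset.mem_insert_of_mem h)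
    have hjm : j ≠ m := fun h => hm (h ▸ Finset.mem_insert_self _ _)
    set L := (R - r) / 4 with hL
    have L0 : 0 < L := by rw [hL]; linarith
    have eR : R = r + L + L + L + L := by rw [hL]; ring
    obtain ⟨C1, hC1, ρ0, hρ0, h1⟩ := ih hmS (r + L) (r + L + L) (by linarith) (by linarith) (by linarith)
    obtain ⟨Cc, hCc, hca⟩ := hcacc (r + L + L) (r + L + L + L) (by linarith) (by linarith) (by linarith)
    set K := 8 / L + 4 * L with hK
    have K0 : 0 < K := by positivity
    refine ⟨K * C1 * (1 + Cc), by positivity, min ρ0 (L / 2), by positivity, fun ρ hρ hρ' => ?_⟩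
    obtain ⟨C', hC', h2⟩ := h1 ρ hρ (hρ'.trans (min_le_left _ _))
    have hρL : 2 * ρ ≤ L := by linarith [hρ'.trans (min_le_right _ _)]
    set T := 4 / (2 * ρ) ^ 2 with hT
    have T0 : 0 < T := by positivity
    refine ⟨K * ρ * (C' + C1 * ρ ^ S.card * Cc * T + C' * T), by positivity, fun a ha ho U hU => ?_⟩
    set V := slp U j (2 * ρ) with hV
    have hVc : ContDiff ℝ 2 V := slp_contDiff hU _ _
    have hsl := hs_lemS hjS (r := r) L0 hρ hρL hU
    set Y := ∫ x in ball (0 : Eu d) R, hs U x with hY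
    set G := ∫ x in ball (0 : Eu d) R, (LL a U x) ^ 2 with hG
    have b : ∀ s : ℝ, Bornology.IsBounded (ball (0 : Eu d) s) := fun s => isBounded_ball
    have hinv : ∀ k l x, a k l (x + (2 * ρ) • ev j) = a k l x := fun k l x => ho.shift k l hjm x _
    have u1 : ∫ x in ball (0 : Eu d) (r + L + L), hs U x ≤ Y :=
      set_le (hs_nonneg U) (ball_subset_ball (by linarith)) (cont_intOn (hs_cont hU) (b R))
    have u2 : ∫ x in ball (0 : Eu d) (r + L + L), (LL a U x) ^ 2 ≤ G :=
      set_le (fun x => sq_nonneg _) (ball_subset_ball (by linarith)) (LL_intOn hν ha hU (b R))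
    have sh : ∀ x ∈ ball (0 : Eu d) (r + L + L + L), ∀ s ∈ Icc 0 (2 * ρ), x + s • ev j ∈ ball (0 : Eu d) R := by
      intro x hx s hs
      rw [eR]
      exact norm_shift hx (by rw [abs_of_nonneg hs.1]; linarith [hs.2])
    have v1 : ∫ x in ball (0 : Eu d) (r + L + L + L), (LL a V x) ^ 2 ≤ T * G :=
      LL_slp_le hν ha hU j (by positivity) hinv measurableSet_ball (b _) (b _)
        (ball_subset_ball (by linarith)) fun x hx => sh x hx _ ⟨by positivity, le_rfl⟩
    have v2 : ∫ x in ball (0 : Eu d) (r + L + L), (LL a V x) ^ 2 ≤ T * G :=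
      (set_le (fun x => sq_nonneg _) (ball_subset_ball (by linarith)) (LL_intOn hν ha hVc (b _))).trans v1
    have v3 : ∫ x in ball (0 : Eu d) (r + L + L + L), gs V x ≤ Y :=
      gs_slp_le hU j (by positivity) (b _) (b _) sh
    have v4 : ∫ x in ball (0 : Eu d) (r + L + L), hs V x ≤ Cc * (T * G + Y) :=
      (hca m a ha (ho.near hη.le) V hVc).trans (by gcongr)
    have w1 := h2 a ha ho U hU
    have w2 := h2 a ha ho V hVc
    have p : 0 < C1 * ρ ^ S.card := by positivity
    have w1' : ∫ x in AS S ρ (r + L), hs U x ≤ C1 * ρ ^ S.card * Y + C' * G := w1.trans (by gcongr)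
    have w2' : ∫ x in AS S ρ (r + L), hs V x ≤ C1 * ρ ^ S.card * (Cc * (T * G + Y)) + C' * (T * G) :=
      w2.trans (by gcongr)
    rw [Finset.card_insert_of_notMem hjS]
    calc _ ≤ K * ρ * ((C1 * ρ ^ S.card * Y + C' * G) + (C1 * ρ ^ S.card * (Cc * (T * G + Y)) + C' * (T * G))) :=
          hsl.trans (by gcongr)
      _ = _ := by ring

end pslemma

section d1
variable {d : ℕ}

lemma pd2_le_hs (U : Eu d → ℝ) (k l : Fin d) (x : Eu d) : pd2 k l U x ^ 2 ≤ hs U x := by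
  unfold hs
  refine le_trans ?_ (Finset.single_le_sum (f := fun k => ∑ l, pd2 k l U x ^ 2)
      (fun _ _ => Finset.sum_nonneg fun _ _ => sq_nonneg _) (Finset.mem_univ k))
  exact Finset.single_le_sum (f := fun l => pd2 k l U x ^ 2) (fun _ _ => sq_nonneg _) (Finset.mem_univ l)

lemma int_pd2_le_hs {U : Eu d → ℝ} (hU : ContDiff ℝ 2 U) (k l : Fin d) {A : Set (Eu d)}
    (hA : Bornology.IsBounded A) : ∫ x in A, pd2 k l U x ^ 2 ≤ ∫ x in A, hs U x :=
  integral_mono (cont_intOn ((pd2_cont hU k l).pow 2) hA) (cont_intOn (hs_cont hU) hA)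
    fun x => pd2_le_hs U k l x

lemma int_sq_add {f g : Eu d → ℝ} (hf : Continuous f) (hg : Continuous g) {A : Set (Eu d)}
    (mA : MeasurableSet A) (hA : Bornology.IsBounded A) :
    ∫ x in A, f x ^ 2 ≤ 2 * (∫ x in A, g x ^ 2) + 2 * ∫ x in A, (g x - f x) ^ 2 :=
  set_le2 mA (cont_intOn (hf.pow 2) hA) (cont_intOn (hg.pow 2) hA) (cont_intOn ((hg.sub hf).pow 2) hA) 2 2
    fun x _ => by
      simp only [Pi.pow_apply, Pi.sub_apply]
      nlinarith [sq_nonneg (2 * g x - f x)]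

lemma D1_k (d : ℕ) (ν : ℝ) (hν : 0 < ν) (m : Fin d) :
    ∃ C : ℝ, 0 < C ∧ ∃ ρ1 : ℝ, 0 < ρ1 ∧ ∀ ρ : ℝ, 0 < ρ → ρ ≤ ρ1 → ∃ C' : ℝ, 0 < C' ∧
    ∀ a : Fin d → Fin d → Eu d → ℝ, Coef ν a → OnlyC m a → ∀ U : Eu d → ℝ, ContDiff ℝ 2 U → 
      ∀ k j : Fin d, k ≠ m →
      ∫ x in ball (0 : Eu d) ρ, pd2 k j U x ^ 2 ≤ C * ρ ^ d * (∫ x in ball (0 : Eu d) (1/2), hs U x)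
        + C' * ∫ x in ball (0 : Eu d) (1/2), (LL a U x) ^ 2 := by
  obtain ⟨η, hη, hcacc⟩ := cacc d ν hν
  obtain ⟨Cc, hCc, hca⟩ := hcacc (3/8) (7/16) (by norm_num) (by norm_num) (by norm_num)
  set S : Finset (Fin d) := Finset.univ.erase m with hS
  have hmS : m ∉ S := by simp [hS]
  have dpos : 0 < d := m.pos
  have cardS : S.card = d - 1 := by simp [hS]
  obtain ⟨C1, hC1, ρ0, hρ0, hps⟩ := lemPS d ν hν m S hmS (1/4) (3/8) (by norm_num) (by norm_num) (by norm_num)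
  set K : ℝ := 8 / (1/16) + 4 * (1/16) with hK
  have K0 : 0 < K := by positivity
  refine ⟨2 * (K * (C1 * 2 ^ (d - 1) + C1 * Cc)) + 2 * Cc, by positivity, min (ρ0 / 2) (1 / 32), by positivity, fun ρ hρ hρ' => ?_⟩
  have r1 : 2 * ρ ≤ ρ0 := by linarith [hρ'.trans (min_le_left _ _)]
  have r2 : ρ ≤ 1 / 32 := hρ'.trans (min_le_right _ _)
  obtain ⟨Ca, hCa, ha1⟩ := hps (2 * ρ) (by linarith) r1
  obtain ⟨Cb, hCb, hb1⟩ := hps ρ hρ (by linarith)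
  set τ := ρ ^ d with hτ
  have τ0 : 0 < τ := by positivity
  have τρ : τ ≤ ρ := pow_le_of_le_one hρ.le (by linarith) dpos.ne'
  set T := 4 / τ ^ 2 with hT
  have T0 : 0 < T := by positivity
  refine ⟨2 * (K * ρ * (Ca + C1 * ρ ^ (d - 1) * Cc * T + Cb * T)) + 8 * Cc, by positivity, 
    fun a ha ho U hU k j hk => ?_⟩
  set Y := ∫ x in ball (0 : Eu d) (1/2), hs U x with hY
  set G := ∫ x in ball (0 : Eu d) (1/2), (LL a U x) ^ 2 with hG
  have Y0 : 0 ≤ Y := integral_nonneg fun x => hs_nonneg U x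
  have G0 : 0 ≤ G := integral_nonneg fun x => sq_nonneg _
  have b : ∀ s : ℝ, Bornology.IsBounded (ball (0 : Eu d) s) := fun s => isBounded_ball
  have hinv : ∀ (t : ℝ) (i l x), a i l (x + t • ev k) = a i l x := fun t i l x => ho.shift i l hk x _
  have sh : ∀ t : ℝ, t ≤ 1/16 → ∀ x ∈ ball (0 : Eu d) (7/16), ∀ s ∈ Icc 0 t, x + s • ev k ∈ ball (0 : Eu d) (1/2) := by
    intro t ht x hx s hs
    have := norm_shift (j := k) hx (L := 1/16) (s := s) (by rw [abs_of_nonneg hs.1]; linarith [hs.2])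
    norm_num at this ⊢; exact this
  have vLL : ∀ t : ℝ, 0 < t → t ≤ 1/16 → ∫ x in ball (0 : Eu d) (7/16), (LL a (slp U k t) x) ^ 2 ≤ 4 / t ^ 2 * G := by
    intro t ht ht'
    exact LL_slp_le hν ha hU k ht (hinv t) measurableSet_ball (b _) (b _)
        (ball_subset_ball (by norm_num)) fun x hx => sh t ht' x hx _ ⟨ht.le, le_rfl⟩
  have vhs : ∀ t : ℝ, 0 < t → t ≤ 1/16 → ∫ x in ball (0 : Eu d) (3/8), hs (slp U k t) x ≤ Cc * (4 / t ^ 2 * G + Y) := by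
    intro t ht ht'
    refine (hca m a ha (ho.near hη.le) _ (slp_contDiff hU k t)).trans ?_
    have := gs_slp_le hU k ht (b _) (b _) (sh t ht')
    have := vLL t ht ht'
    gcongr
  -- difference part
  have J2 : ∫ x in ball (0 : Eu d) ρ, (slp (pd j U) k τ x - pd2 k j U x) ^ 2 ≤ Cc * (4 * G + ρ ^ d * Y) := by
    refine lemJ2 (pd_contDiff hU j) k τ0 (b _) fun s hs => ?_
    have s16 : s ≤ 1/16 := by linarith [hs.2]
    have e : ∀ x, (pd k (pd j U) (x + s • ev k) - pd k (pd j U) x) ^ 2 = s ^ 2 * pd2 k j (slp U k s) x ^ 2 := by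
      intro x
      rw [pd2_slp hU, slp, div_pow, mul_div_cancel₀ _ (pow_pos hs.1 2).ne']; rfl
    simp only [e]
    rw [integral_const_mul]
    have s2 : s ^ 2 ≤ ρ ^ d := by
      have : s ^ 2 ≤ τ ^ 2 := by have := hs.1; have := hs.2; gcongr
      refine this.trans ?_
      rw [sq, ← hτ]
      exact mul_le_of_le_one_left τ0.le (by linarith)
    calc s ^ 2 * ∫ x in ball (0 : Eu d) ρ, pd2 k j (slp U k s) x ^ 2 
        ≤ s ^ 2 * (Cc * (4 / s ^ 2 * G + Y)) := by
          refine mul_le_mul_of_nonneg_left ?_ (sq_nonneg _)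
          refine (int_pd2_le_hs (slp_contDiff hU k s) k j (b _)).trans ?_
          exact (set_le (hs_nonneg _) (ball_subset_ball (by linarith)) (cont_intOn (hs_cont (slp_contDiff hU k s)) (b _))).trans (vhs s hs.1 s16)
      _ = Cc * (4 * G + s ^ 2 * Y) := by
          have := hs.1.ne'
          field_simp
      _ ≤ _ := by gcongr
  -- main part
  set V := slp U k τ with hV
  have hVc : ContDiff ℝ 2 V := slp_contDiff hU _ _
  set g := slp (pd j U) k τ with hg
  have gV : g = pd j V := by ext x; exact (pd_slp (hU.of_le (by norm_num)) k τ j x).symm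
  have gC : ContDiff ℝ 1 g := slp_contDiff (pd_contDiff hU j) _ _
  have sub : ball (0 : Eu d) ρ ⊆ AS (insert m S) ρ (1/8) := by
    intro x hx
    refine ⟨ball_subset_ball (by linarith) hx, fun l _ => ?_⟩
    rw [mem_ball_zero_iff] at hx
    exact lt_of_le_of_lt (by simpa using PiLp.norm_apply_le x l) hx
  have m1 := (set_le (h := fun x => g x ^ 2) (fun x => sq_nonneg _) sub (cont_intOn (gC.continuous.pow 2) (AS_bdd _ _ _))).trans
    (lemS hmS (r := 1/8) (L := 1/16) (by norm_num) hρ (by linarith) gC.continuous)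
  have e316 : (1/8 : ℝ) + 1/16 = 3/16 := by norm_num
  rw [e316] at m1
  have kS : k ∈ S := by simp [hS, hk]
  have m2 : ∫ x in AS S ρ (3/16), g x ^ 2 ≤ C1 * (2 * ρ) ^ (d - 1) * Y + Ca * G := by
    refine (lemJ (pd_contDiff hU j) k τ0 (AS_bdd _ _ _) (AS_bdd S (2 * ρ) (1/4)) ?_).trans ?_
    · intro x hx s hs
      refine ⟨?_, fun l hl => ?_⟩
      · have := norm_shift (j := k) hx.1 (L := 1/16) (s := s) (by rw [abs_of_nonneg hs.1]; linarith [hs.2])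
        norm_num at this ⊢; exact this
      · have h1 := hx.2 l hl
        by_cases h : l = k
        · subst h
          simp only [ev, PiLp.add_apply, PiLp.smul_apply, PiLp.single_apply, if_true, smul_eq_mul, mul_one]
          refine (abs_add_le _ _).trans_lt ?_
          rw [abs_of_nonneg hs.1]; linarith [hs.2]
        · simp [ev, h]; linarith
    · refine (int_pd2_le_hs hU k j (AS_bdd _ _ _)).trans ?_
      have := ha1 a ha ho U hU
      rw [cardS] at this
      refine this.trans ?_
      have q1 := set_le (hs_nonneg U) (ball_subset_ball (by norm_num : (3/8 : ℝ) ≤ 1/2)) (cont_intOn (hs_cont hU) (b _))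
      have q2 := set_le (fun x => sq_nonneg (LL a U x)) (ball_subset_ball (by norm_num : (3/8 : ℝ) ≤ 1/2)) (LL_intOn hν ha hU (b _))
      gcongr
  have m3 : ∫ x in AS S ρ (3/16), (slp g m (2 * ρ) x) ^ 2 ≤ C1 * ρ ^ (d - 1) * (Cc * (T * G + Y)) + Cb * (T * G) := by
    refine (lemJ gC m (by positivity) (AS_bdd _ _ _) (AS_bdd S ρ (1/4)) ?_).trans ?_
    · intro x hx s hs
      have := AS_shift hmS hx (L := 1/16) (s := s) (by rw [abs_of_nonneg hs.1]; linarith [hs.2])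
      norm_num at this ⊢; exact this
    · rw [gV]
      refine (int_pd2_le_hs hVc m j (AS_bdd _ _ _)).trans ?_
      have := hb1 a ha ho V hVc
      rw [cardS] at this
      refine this.trans ?_
      have q1 := vhs τ τ0 (by linarith)
      have q2 := (set_le (fun x => sq_nonneg (LL a V x)) (ball_subset_ball (by norm_num : (3/8 : ℝ) ≤ 7/16)) (LL_intOn hν ha hVc (b _))).trans (vLL τ τ0 (by linarith))
      gcongr
  have fin := int_sq_add (pd2_cont hU k j) gC.continuous (measurableSet_ball (x := (0 : Eu d)) (ε := ρ)) (b _)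
  have m4 : ∫ x in ball (0 : Eu d) ρ, g x ^ 2 ≤ K * ρ * ((C1 * (2 * ρ) ^ (d - 1) * Y + Ca * G) + 
      (C1 * ρ ^ (d - 1) * (Cc * (T * G + Y)) + Cb * (T * G))) := m1.trans (by gcongr)
  calc _ ≤ 2 * (K * ρ * ((C1 * (2 * ρ) ^ (d - 1) * Y + Ca * G) + 
      (C1 * ρ ^ (d - 1) * (Cc * (T * G + Y)) + Cb * (T * G)))) + 2 * (Cc * (4 * G + ρ ^ d * Y)) := fin.trans (by gcongr)
    _ = _ := by
      have : ρ ^ d = ρ * ρ ^ (d - 1) := by rw [← pow_succ']; congr 1; omega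
      rw [show τ = ρ * ρ ^ (d - 1) from hτ.trans this, this, mul_pow]; ring

lemma D1 (d : ℕ) (ν : ℝ) (hν : 0 < ν) (m : Fin d) :
    ∃ C : ℝ, 0 < C ∧ ∃ ρ1 : ℝ, 0 < ρ1 ∧ ρ1 < 1/2 ∧ ∀ ρ : ℝ, 0 < ρ → ρ ≤ ρ1 → ∃ C' : ℝ, 0 < C' ∧
    ∀ a : Fin d → Fin d → Eu d → ℝ, Coef ν a → OnlyC m a → ∀ U : Eu d → ℝ, ContDiff ℝ 2 U → 
      ∫ x in ball (0 : Eu d) ρ, hs U x ≤ C * ρ ^ d * (∫ x in ball (0 : Eu d) (1/2), hs U x)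
        + C' * ∫ x in ball (0 : Eu d) (1/2), (LL a U x) ^ 2 := by
  obtain ⟨C0, hC0, h0⟩ := hs_le_hy d ν hν
  obtain ⟨C, hC, ρ1, hρ1, h1⟩ := D1_k d ν hν m
  have dpos : 0 < d := m.pos
  refine ⟨C0 * (d * d * C), by positivity, min ρ1 (1/4), by positivity, (min_le_right _ _).trans_lt (by norm_num), fun ρ hρ hρ' => ?_⟩
  obtain ⟨C', hC', h2⟩ := h1 ρ hρ (hρ'.trans (min_le_left _ _))
  have hρ4 := hρ'.trans (min_le_right _ _)
  refine ⟨C0 * (1 + d * d * C'), by positivity, fun a ha ho U hU => ?_⟩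
  have b : ∀ s : ℝ, Bornology.IsBounded (ball (0 : Eu d) s) := fun s => isBounded_ball
  set Y := ∫ x in ball (0 : Eu d) (1/2), hs U x with hY
  set G := ∫ x in ball (0 : Eu d) (1/2), (LL a U x) ^ 2 with hG
  have Y0 : 0 ≤ Y := integral_nonneg fun x => hs_nonneg U x
  have G0 : 0 ≤ G := integral_nonneg fun x => sq_nonneg _
  have i1 : ∀ k l, IntegrableOn (fun x => pd2 k l U x ^ 2) (ball (0 : Eu d) ρ) := fun k l =>
    cont_intOn ((pd2_cont hU k l).pow 2) (b _)
  have hyI : IntegrableOn (hy m U) (ball (0 : Eu d) ρ) := by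
    unfold hy; exact integrable_finsetSum _ fun k _ => integrable_finsetSum _ fun l _ => i1 l k
  have hyle : ∫ x in ball (0 : Eu d) ρ, hy m U x ≤ d * (d * (C * ρ ^ d * Y + C' * G)) := by
    unfold hy
    rw [integral_finsetSum _ fun k _ => integrable_finsetSum _ fun l _ => i1 l k]
    refine (Finset.sum_le_card_nsmul _ _ (d * (C * ρ ^ d * Y + C' * G)) fun k hk => ?_).trans ?_
    · rw [integral_finsetSum _ fun l _ => i1 l k]
      refine (Finset.sum_le_card_nsmul _ _ (C * ρ ^ d * Y + C' * G) fun l _ => ?_).trans ?_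
      · simp only [pd2_symm hU l k]
        exact h2 a ha ho U hU k l (Finset.mem_erase.1 hk).1
      · rw [Finset.card_univ, Fintype.card_fin, nsmul_eq_mul]
    · rw [nsmul_eq_mul]
      refine mul_le_mul_of_nonneg_right ?_ (by positivity)
      have := Finset.card_le_univ (Finset.univ.erase m)
      rw [Fintype.card_fin] at this
      exact_mod_cast this
  have := set_le2 (measurableSet_ball (x := (0 : Eu d)) (ε := ρ)) (cont_intOn (hs_cont hU) (b _))
    (LL_intOn hν ha hU (b _)) hyI C0 C0 fun x _ => by
      have := h0 m a ha U hU x; linarith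
  have q2 := set_le (fun x => sq_nonneg (LL a U x)) (ball_subset_ball (by linarith : ρ ≤ 1/2)) (LL_intOn hν ha hU (b _))
  calc _ ≤ C0 * G + C0 * (d * (d * (C * ρ ^ d * Y + C' * G))) := this.trans (by gcongr)
    _ = _ := by ring

/-- perturbed version -/
lemma D1p (d : ℕ) (ν : ℝ) (hν : 0 < ν) (m : Fin d) :
    ∃ C : ℝ, 0 < C ∧ ∃ ρ1 : ℝ, 0 < ρ1 ∧ ρ1 < 1/2 ∧ ∀ ρ : ℝ, 0 < ρ → ρ ≤ ρ1 → ∃ C' : ℝ, 0 < C' ∧ ∃ η : ℝ, 0 < η ∧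
    ∀ a : Fin d → Fin d → Eu d → ℝ, Coef ν a → Near m η a → ∀ U : Eu d → ℝ, ContDiff ℝ 2 U → 
      ∫ x in ball (0 : Eu d) ρ, hs U x ≤ C * ρ ^ d * (∫ x in ball (0 : Eu d) (1/2), hs U x)
        + C' * ∫ x in ball (0 : Eu d) (1/2), (LL a U x) ^ 2 := by
  obtain ⟨C, hC, ρ1, hρ1, hρ12, h1⟩ := D1 d ν hν m
  have dpos : 0 < d := m.pos
  refine ⟨C + 1, by positivity, ρ1, hρ1, hρ12, fun ρ hρ hρ' => ?_⟩
  obtain ⟨C', hC', h2⟩ := h1 ρ hρ hρ'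
  set η : ℝ := Real.sqrt (ρ ^ d / (C' * (2 * d ^ 2))) with hη
  have hη2 : η ^ 2 = ρ ^ d / (C' * (2 * d ^ 2)) := Real.sq_sqrt (by positivity)
  refine ⟨2 * C', by positivity, η, Real.sqrt_pos.2 (by positivity), fun a ha hn U hU => ?_⟩
  have b : ∀ s : ℝ, Bornology.IsBounded (ball (0 : Eu d) s) := fun s => isBounded_ball
  have h3 := h2 (frz m a) (frz_coef ha m) (frz_only a m) U hU
  have h4 := set_le2 (measurableSet_ball (x := (0 : Eu d)) (ε := 1/2))
    (LL_intOn hν (frz_coef ha m) hU (b _)) (LL_intOn hν ha hU (b _)) (cont_intOn (hs_cont hU) (b _))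
    2 (2 * (η ^ 2 * d ^ 2)) fun x hx => 
      LL_add_sq a (frz m a) η U x fun i j => hn x (ball_subset_ball (by norm_num) hx) i j
  have e : C' * (2 * (η ^ 2 * d ^ 2)) = ρ ^ d := by
    rw [hη2]; field_simp
  set Y := ∫ x in ball (0 : Eu d) (1/2), hs U x with hY
  set G := ∫ x in ball (0 : Eu d) (1/2), (LL a U x) ^ 2 with hG
  calc _ ≤ C * ρ ^ d * Y + C' * (2 * G + 2 * (η ^ 2 * d ^ 2) * Y) := h3.trans (by gcongr)
    _ = C * ρ ^ d * Y + C' * (2 * (η ^ 2 * d ^ 2)) * Y + 2 * C' * G := by ring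
    _ = _ := by rw [e]; ring

end d1

section mainM
variable {d : ℕ}

lemma int_gs1 {U : Eu d → ℝ} (hU : ContDiff ℝ 2 U) (k : Fin d) {A : Set (Eu d)} (hA : Bornology.IsBounded A) :
    ∫ x in A, gs (pd k U) x ≤ ∫ x in A, hs U x := by
  refine integral_mono (cont_intOn (gs_cont (pd_contDiff hU k)) hA) (cont_intOn (hs_cont hU) hA) fun x => ?_
  show ∑ l, pd l (pd k U) x ^ 2 ≤ ∑ l, ∑ k, pd2 l k U x ^ 2
  exact Finset.sum_le_sum fun l _ => Finset.single_le_sum (f := fun k => pd2 l k U x ^ 2) 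
    (fun _ _ => sq_nonneg _) (Finset.mem_univ k)

lemma lemM (d : ℕ) (ν : ℝ) (hν : 0 < ν) (m : Fin d) :
    ∃ C : ℝ, 0 < C ∧ ∃ ρ1 : ℝ, 0 < ρ1 ∧ ρ1 < 1/2 ∧ ∀ ρ : ℝ, 0 < ρ → ρ ≤ ρ1 → ∃ C' : ℝ, 0 < C' ∧ ∃ η : ℝ, 0 < η ∧
    ∀ a : Fin d → Fin d → Eu d → ℝ, Coef ν a → Near m η a → ∀ i : Fin d, 
      (∀ k l (x : Eu d) (s : ℝ), a k l (x + s • ev i) = a k l x) → ∀ u : Eu d → ℝ, ContDiff ℝ 2 u → ∀ K2 : ℝ, 0 ≤ K2 →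
      (∀ s ∈ Ioc (0:ℝ) (1/8), ∫ x in ball (0 : Eu d) (3/4), (LL a u (x + s • ev i) - LL a u x) ^ 2 ≤ K2) →
      ∀ c : Fin d → ℝ, ∃ c' : Fin d → ℝ, 
      ∑ k, ∫ x in ball (0 : Eu d) ρ, (pd2 i k u x - c' k) ^ 2 ≤ 
        C * ρ ^ (d + 2) * (∑ k, ∫ x in ball (0 : Eu d) 1, (pd2 i k u x - c k) ^ 2) + C' * K2 := by
  obtain ⟨η1, hη1, hcacc⟩ := cacc d ν hν
  obtain ⟨Cc, hCc, hca⟩ := hcacc (1/2) (3/4) (by norm_num) (by norm_num) (by norm_num)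
  obtain ⟨C1, hC1, ρ1, hρ1, hρ12, hD⟩ := D1p d ν hν m
  have dpos : 0 < d := m.pos
  refine ⟨d * (8 * 2 ^ d * C1 * Cc + 2 * Cc), by positivity, min ρ1 (1/8), by positivity, (min_le_left _ _).trans_lt hρ12, fun ρ hρ hρ' => ?_⟩
  have r1 : ρ ≤ ρ1 := (hρ'.trans (min_le_left _ _))
  have r2 : ρ ≤ 1 / 8 := hρ'.trans (min_le_right _ _)
  obtain ⟨C2, hC2, η2, hη2, hD2⟩ := hD ρ hρ r1
  set τ := ρ ^ (d + 2) with hτ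
  have τ0 : 0 < τ := by positivity
  have τρ : τ ≤ ρ := pow_le_of_le_one hρ.le (by linarith) (by omega)
  refine ⟨d * (8 * 2 ^ d * ρ ^ 2 * (C1 * ρ ^ d * Cc + C2) * (τ ^ 2)⁻¹ + 2 * Cc), by positivity, min η1 η2, by positivity, ?_⟩
  intro a ha hn i hinv u hu K2 K20 hK2 c
  have n1 : Near m η1 a := hn.mono (min_le_left _ _)
  have n2 : Near m η2 a := hn.mono (min_le_right _ _)
  have b : ∀ s : ℝ, Bornology.IsBounded (ball (0 : Eu d) s) := fun s => isBounded_ball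
  set E := ∑ k, ∫ x in ball (0 : Eu d) 1, (pd2 i k u x - c k) ^ 2 with hE
  have E0 : 0 ≤ E := Finset.sum_nonneg fun k _ => integral_nonneg fun x => sq_nonneg _
  let V : ℝ → Eu d → ℝ := fun s x => slp u i s x - lin c x
  have hV : ∀ s, ContDiff ℝ 2 (V s) := fun s => (slp_contDiff hu i s).sub (lin_contDiff c)
  have pdV : ∀ s k x, pd k (V s) x = slp (pd k u) i s x - c k := fun s k x => by
    rw [pd_sub (diff2 (slp_contDiff hu i s)) (diff2 (lin_contDiff c)), pd_lin, pd_slp (hu.of_le (by norm_num))]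
  have pd2V : ∀ s k l x, pd2 k l (V s) x = slp (pd2 k l u) i s x := fun s k l x => by
    rw [pd2_sub (slp_contDiff hu i s) (lin_contDiff c), pd2_lin, pd2_slp hu, sub_zero]
  have LLV : ∀ s x, LL a (V s) x = slp (LL a u) i s x := fun s x => by
    rw [LL_sub (slp_contDiff hu i s) (lin_contDiff c), LL_lin, sub_zero, LL_slp hu i s fun k l x => hinv k l x s]
  have sh : ∀ t : ℝ, t ≤ 1/8 → ∀ x ∈ ball (0 : Eu d) (3/4), ∀ s ∈ Icc 0 t, x + s • ev i ∈ ball (0 : Eu d) 1 := by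
    intro t ht x hx s hs
    have := norm_shift (j := i) hx (L := 1/4) (s := s) (by rw [abs_of_nonneg hs.1]; linarith [hs.2])
    norm_num at this ⊢; exact this
  have vLL : ∀ s : ℝ, 0 < s → s ≤ 1/8 → ∫ x in ball (0 : Eu d) (3/4), (LL a (V s) x) ^ 2 ≤ (s ^ 2)⁻¹ * K2 := by
    intro s hs hs'
    have e : ∀ x, LL a (V s) x ^ 2 = (s ^ 2)⁻¹ * (LL a u (x + s • ev i) - LL a u x) ^ 2 := fun x => by
      rw [LLV, slp, div_pow, div_eq_inv_mul]
    simp only [e]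
    rw [integral_const_mul]
    exact mul_le_mul_of_nonneg_left (hK2 s ⟨hs, hs'⟩) (by positivity)
  have vgs : ∀ s : ℝ, 0 < s → s ≤ 1/8 → ∫ x in ball (0 : Eu d) (3/4), gs (V s) x ≤ E := by
    intro s hs hs'
    rw [int_gs ((hV s).of_le (by norm_num)) (b _)]
    refine Finset.sum_le_sum fun k _ => ?_
    let ck : Fin d → ℝ := fun l => if l = i then c k else 0
    have hg : ContDiff ℝ 1 (fun x => pd k u x - lin ck x) := (pd_contDiff hu k).sub (lin_contDiff ck)
    have := lemJ hg i hs (b (3/4)) (b 1) (sh s hs')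
    have e1 : ∀ x, slp (fun x => pd k u x - lin ck x) i s x = pd k (V s) x := by
      intro x
      rw [pdV]
      have : lin ck (x + s • ev i) - lin ck x = c k * s := by
        unfold lin
        rw [← Finset.sum_sub_distrib]
        simp [ck, ev, mul_add]
      unfold slp
      field_simp
      linear_combination -this
    have e2 : ∀ x, pd i (fun x => pd k u x - lin ck x) x = pd2 i k u x - c k := by
      intro x
      rw [pd_sub (diff1 (pd_contDiff hu k)) (diff1 (lin_contDiff ck)), pd_lin]
      simp [ck]; rfl
    simp only [e1, e2] at this
    exact this
  have vhs : ∀ s : ℝ, 0 < s → s ≤ 1/8 → ∫ x in ball (0 : Eu d) (1/2), hs (V s) x ≤ Cc * ((s ^ 2)⁻¹ * K2 + E) := by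
    intro s hs hs'
    refine (hca m a ha n1 _ (hV s)).trans ?_
    have := vLL s hs hs'
    have := vgs s hs hs'
    gcongr
  have τ8 : τ ≤ 1/8 := by linarith
  have J2 : ∀ k, ∫ x in ball (0 : Eu d) ρ, (slp (pd k u) i τ x - pd2 i k u x) ^ 2 ≤ Cc * (K2 + τ ^ 2 * E) := by
    intro k
    refine lemJ2 (pd_contDiff hu k) i τ0 (b _) fun s hs => ?_
    have s16 : s ≤ 1/8 := by linarith [hs.2]
    have e : ∀ x, (pd i (pd k u) (x + s • ev i) - pd i (pd k u) x) ^ 2 = s ^ 2 * pd2 i k (V s) x ^ 2 := by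
      intro x
      rw [pd2V, slp, div_pow, mul_div_cancel₀ _ (pow_pos hs.1 2).ne']; rfl
    simp only [e]
    rw [integral_const_mul]
    have s2 : s ^ 2 ≤ τ ^ 2 := by have := hs.1; have := hs.2; gcongr
    calc s ^ 2 * ∫ x in ball (0 : Eu d) ρ, pd2 i k (V s) x ^ 2 
        ≤ s ^ 2 * (Cc * ((s ^ 2)⁻¹ * K2 + E)) := by
          refine mul_le_mul_of_nonneg_left ?_ (sq_nonneg _)
          refine (int_pd2_le_hs (hV s) i k (b _)).trans ?_
          exact (set_le (hs_nonneg _) (ball_subset_ball (by linarith)) (cont_intOn (hs_cont (hV s)) (b _))).trans (vhs s hs.1 s16)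
      _ = Cc * (K2 + s ^ 2 * E) := by
          have := hs.1.ne'
          field_simp
      _ ≤ _ := by gcongr
  have h3 : ∫ x in ball (0 : Eu d) ρ, hs (V τ) x ≤ C1 * ρ ^ d * (Cc * ((τ ^ 2)⁻¹ * K2 + E)) + C2 * ((τ ^ 2)⁻¹ * K2) := by
    refine (hD2 a ha n2 _ (hV τ)).trans ?_
    have := vhs τ τ0 τ8
    have := (set_le (fun x => sq_nonneg (LL a (V τ) x)) (ball_subset_ball (by norm_num : (1/2 : ℝ) ≤ 3/4)) (LL_intOn hν ha (hV τ) (b _))).trans (vLL τ τ0 τ8)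
    gcongr
  choose bb hbb using fun k => poincare (pd k (V τ)) (pd_contDiff (hV τ) k) ρ hρ
  refine ⟨fun k => c k + bb k, ?_⟩
  have per : ∀ k ∈ (Finset.univ : Finset (Fin d)), ∫ x in ball (0 : Eu d) ρ, (pd2 i k u x - (c k + bb k)) ^ 2 ≤
     2 * (4 * 2 ^ d * ρ ^ 2 * (C1 * ρ ^ d * (Cc * ((τ ^ 2)⁻¹ * K2 + E)) + C2 * ((τ ^ 2)⁻¹ * K2))) + 2 * (Cc * (K2 + τ ^ 2 * E)) := by
    intro k _
    refine (set_le2 (measurableSet_ball (x := (0 : Eu d)) (ε := ρ))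
      (cont_intOn (((pd2_cont hu i k).sub continuous_const).pow 2) (b _))
      (g1 := fun x => (pd k (V τ) x - bb k) ^ 2) (g2 := fun x => (slp (pd k u) i τ x - pd2 i k u x) ^ 2) 
      (cont_intOn (((pd_contDiff (hV τ) k).continuous.sub continuous_const).pow 2) (b _))
      (cont_intOn (((slp_cont (pd_contDiff hu k).continuous i τ).sub (pd2_cont hu i k)).pow 2) (b _)) 2 2 fun x _ => ?_).trans ?_
    · simp only [Pi.pow_apply, Pi.sub_apply, pdV]
      nlinarith [sq_nonneg (2 * slp (pd k u) i τ x - c k - bb k - pd2 i k u x)]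
    · have := (int_gs1 (hV τ) k (b ρ)).trans h3
      have q1 := hbb k
      have q2 := J2 k
      have q3 := q1.trans (mul_le_mul_of_nonneg_left this (by positivity))
      linarith
  refine (Finset.sum_le_card_nsmul _ _ _ per).trans ?_
  rw [Finset.card_univ, Fintype.card_fin, nsmul_eq_mul]
  have e1 : ρ ^ 2 * ρ ^ d = τ := by rw [← pow_add, hτ, add_comm]
  have e2 : τ ^ 2 ≤ τ := by rw [sq]; exact mul_le_of_le_one_left τ0.le (by linarith)
  have e3 : 2 * (Cc * (K2 + τ ^ 2 * E)) ≤ 2 * (Cc * (K2 + τ * E)) := by gcongr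
  calc _ ≤ d * (2 * (4 * 2 ^ d * ρ ^ 2 * (C1 * ρ ^ d * (Cc * ((τ ^ 2)⁻¹ * K2 + E)) + C2 * ((τ ^ 2)⁻¹ * K2))) + 2 * (Cc * (K2 + τ * E))) := by gcongr
    _ = d * (8 * 2 ^ d * C1 * Cc * E * (ρ ^ 2 * ρ ^ d) + 2 * Cc * τ * E) + d * (8 * 2 ^ d * ρ ^ 2 * (C1 * ρ ^ d * Cc + C2) * (τ ^ 2)⁻¹ + 2 * Cc) * K2 := by ring
    _ = _ := by rw [e1]; ring

end mainM

section scal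
variable {d : ℕ}

lemma subst_ball (φ : Eu d → ℝ) (v : Eu d) {t : ℝ} (ht : 0 < t) :
    ∫ w in ball (0 : Eu d) 1, φ (v + t • w) = (t ^ d)⁻¹ * ∫ x in ball v t, φ x := by
  rw [Measure.setIntegral_comp_smul_of_pos volume (fun x => φ (v + x)) (ball (0 : Eu d) 1) ht, smul_unitBall_of_pos ht]
  simp only [finrank_euclideanSpace, Fintype.card_fin, smul_eq_mul]
  congr 1
  have := (measurePreserving_add_left (volume : Measure (Eu d)) v).setIntegral_preimage_emb 
    (measurableEmbedding_addLeft v) φ (ball v t)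
  rw [← this]
  congr 2
  ext x; simp [mem_ball, dist_eq_norm]

/-- zero out the coordinate `i` -/
def zc (i : Fin d) (x : Eu d) : Eu d := x - x i • ev i

lemma zc_apply (i : Fin d) (x : Eu d) (j : Fin d) : zc i x j = if j = i then 0 else x j := by
  unfold zc ev
  by_cases h : j = i
  · subst h; simp
  · simp [h]

lemma norm_le_of_coord {x y : Eu d} (h : ∀ j, x j ^ 2 ≤ y j ^ 2) : ‖x‖ ≤ ‖y‖ := by
  rw [EuclideanSpace.norm_eq, EuclideanSpace.norm_eq]
  apply Real.sqrt_le_sqrt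
  refine Finset.sum_le_sum fun j _ => ?_
  simpa using h j

lemma zc_shift (i : Fin d) (x : Eu d) (s : ℝ) : zc i (x + s • ev i) = zc i x := by
  ext j; rw [zc_apply, zc_apply]
  split_ifs with h
  · rfl
  · simp [ev, h]

lemma zc_cont (i : Fin d) : Continuous (zc i : Eu d → Eu d) := by unfold zc; fun_prop

def fz (x0 : Eu d) (r : ℝ) (i : Fin d) (a : Fin d → Fin d → Eu d → ℝ) (k l : Fin d) (x : Eu d) : ℝ :=
  a k l (x0 + r • zc i x)

lemma fz_coef {ν : ℝ} {a : Fin d → Fin d → Eu d → ℝ} (ha : Coef ν a) (x0 : Eu d) (r : ℝ) (i : Fin d) :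
    Coef ν (fz x0 r i a) where
  meas k l := (ha.meas k l).comp (by
    have := zc_cont (d := d) i
    have : Continuous fun x : Eu d => x0 + r • zc i x := by fun_prop
    exact this.measurable)
  symm k l x := ha.symm k l _
  ell x ξ := ha.ell _ ξ

lemma fz_near {a : Fin d → Fin d → Eu d → ℝ} {m i : Fin d} (him : i ≠ m) {η r : ℝ} (hr : 0 < r) {ω : ℝ → ℝ}
    (hm : MonotoneOn ω (Ici 0)) (hω : ω r ≤ η)
    (h : ∀ k l (x y : Eu d), x m = y m → |a k l x - a k l y| ≤ ω (dist x y)) (x0 : Eu d) :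
    Near m η (fz x0 r i a) := by
  intro x hx k l
  unfold frz fz
  refine (h k l _ _ ?_).trans (le_trans (hm (mem_Ici.2 dist_nonneg) (mem_Ici.2 hr.le) ?_) hω)
  · simp [zc_apply, him.symm, ev]
  · rw [dist_eq_norm, add_sub_add_left_eq_sub, ← smul_sub, norm_smul, Real.norm_of_nonneg hr.le]
    refine mul_le_of_le_one_right hr.le ?_
    rw [mem_ball_zero_iff] at hx
    refine le_trans (norm_le_of_coord fun j => ?_) hx.le
    rw [PiLp.sub_apply, zc_apply, zc_apply]
    by_cases h1 : j = i
    · simp [h1, sq_nonneg]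
    · by_cases h2 : j = m
      · simp [h1, h2, ev, sq_nonneg]
      · simp [h1, h2, ev]

lemma fz_inv (a : Fin d → Fin d → Eu d → ℝ) (x0 : Eu d) (r : ℝ) (i : Fin d) (k l : Fin d) (x : Eu d) (s : ℝ) :
    fz x0 r i a k l (x + s • ev i) = fz x0 r i a k l x := by
  unfold fz; rw [zc_shift]

/-- scaled function -/
def scl (x0 : Eu d) (r : ℝ) (U : Eu d → ℝ) (x : Eu d) : ℝ := (r ^ 2)⁻¹ * U (x0 + r • x)

lemma scl_contDiff {U : Eu d → ℝ} (hU : ContDiff ℝ 2 U) (x0 : Eu d) (r : ℝ) : ContDiff ℝ 2 (scl x0 r U) := by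
  unfold scl
  have : ContDiff ℝ 2 fun x : Eu d => U (x0 + r • x) := hU.comp (by fun_prop)
  exact contDiff_const.mul this

lemma pd2_scl {U : Eu d → ℝ} (hU : ContDiff ℝ 2 U) (x0 : Eu d) {r : ℝ} (hr : 0 < r) (k l : Fin d) (x : Eu d) :
    pd2 k l (scl x0 r U) x = pd2 k l U (x0 + r • x) := by
  have : ContDiff ℝ 2 fun x : Eu d => U (x0 + r • x) := hU.comp (by fun_prop)
  unfold scl
  rw [pd2_const_mul this, pd2_scale hU, inv_mul_cancel_left₀ (by positivity)]

lemma step (d : ℕ) (ν : ℝ) (hν : 0 < ν) (m : Fin d) (γ : ℝ) (hγ : γ < 1) :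
    ∃ ρ : ℝ, 0 < ρ ∧ ρ < 1/2 ∧ ∃ C : ℝ, 0 < C ∧ ∃ η : ℝ, 0 < η ∧
    ∀ a : Fin d → Fin d → Eu d → ℝ, Coef ν a → ∀ (ω : ℝ → ℝ) (r : ℝ), 0 < r → MonotoneOn ω (Ici 0) → ω r ≤ η → 
      (∀ k l (x y : Eu d), x m = y m → |a k l x - a k l y| ≤ ω (dist x y)) → ∀ i : Fin d, i ≠ m → 
      ∀ U : Eu d → ℝ, ContDiff ℝ 2 U → ∀ x0 : Eu d, ∀ K2 : ℝ, 0 ≤ K2 →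
      (∀ s ∈ Ioc (0:ℝ) (1/8), ∫ x in ball (0 : Eu d) (3/4), 
        (LL (fz x0 r i a) (scl x0 r U) (x + s • ev i) - LL (fz x0 r i a) (scl x0 r U) x) ^ 2 ≤ K2) →
      ∀ c : Fin d → ℝ, ∃ c' : Fin d → ℝ, 
      ∑ k, ∫ x in ball (0 : Eu d) 1, (pd2 i k U (x0 + (r * ρ) • x) - c' k) ^ 2 ≤ 
        ρ ^ (2 * γ) / 2 * (∑ k, ∫ x in ball (0 : Eu d) 1, (pd2 i k U (x0 + r • x) - c k) ^ 2) + C * K2 := by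
  obtain ⟨C, hC, ρ1, hρ1, hρ12, h1⟩ := lemM d ν hν m
  -- choose ρ
  have lim : Tendsto (fun ρ : ℝ => ρ ^ (2 - 2 * γ)) (nhdsWithin 0 (Ioi 0)) (nhds 0) := by
    have := (Real.continuousAt_rpow_const 0 (2 - 2 * γ) (Or.inr (by linarith))).tendsto
    rw [Real.zero_rpow (by linarith)] at this
    exact this.mono_left nhdsWithin_le_nhds
  have ev1 : ∀ᶠ ρ : ℝ in nhdsWithin 0 (Ioi 0), ρ ^ (2 - 2 * γ) < 1 / (2 * C) := lim.eventually (gt_mem_nhds (by positivity))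
  have ev2 : ∀ᶠ ρ : ℝ in nhdsWithin 0 (Ioi 0), ρ ∈ Ioo 0 ρ1 := Ioo_mem_nhdsGT hρ1
  obtain ⟨ρ, hρa, hρ, hρb⟩ := (ev1.and ev2).exists
  obtain ⟨C', hC', η, hη, h2⟩ := h1 ρ hρ hρb.le
  have key : C * ρ ^ 2 ≤ ρ ^ (2 * γ) / 2 := by
    have : ρ ^ 2 = ρ ^ (2 * γ) * ρ ^ (2 - 2 * γ) := by
      rw [← Real.rpow_add hρ, ← Real.rpow_natCast]; congr 1; push_cast; ring
    rw [this]
    have p := Real.rpow_pos_of_pos hρ (2 * γ)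
    calc _ = C * ρ ^ (2 - 2 * γ) * ρ ^ (2 * γ) := by ring
      _ ≤ C * (1 / (2 * C)) * ρ ^ (2 * γ) := by gcongr
      _ = _ := by field_simp
  refine ⟨ρ, hρ, by linarith, (ρ ^ d)⁻¹ * C', by positivity, η, hη, ?_⟩
  intro a ha ω r hr hm hω hmod i him U hU x0 K2 K20 hK2 c
  obtain ⟨c', hc'⟩ := h2 (fz x0 r i a) (fz_coef ha x0 r i) (fz_near him hr hm hω hmod x0) i (fz_inv a x0 r i) 
    (scl x0 r U) (scl_contDiff hU x0 r) K2 K20 hK2 c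
  simp only [pd2_scl hU x0 hr] at hc'
  refine ⟨c', ?_⟩
  have e : ∀ k, ∫ x in ball (0 : Eu d) 1, (pd2 i k U (x0 + (r * ρ) • x) - c' k) ^ 2 = 
      (ρ ^ d)⁻¹ * ∫ x in ball (0 : Eu d) ρ, (pd2 i k U (x0 + r • x) - c' k) ^ 2 := by
    intro k
    rw [← subst_ball (fun x => (pd2 i k U (x0 + r • x) - c' k) ^ 2) 0 hρ]
    simp only [zero_add, smul_smul]
  simp only [e]
  rw [← Finset.mul_sum]
  set E := ∑ k, ∫ x in ball (0 : Eu d) 1, (pd2 i k U (x0 + r • x) - c k) ^ 2 with hE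
  have E0 : 0 ≤ E := Finset.sum_nonneg fun k _ => integral_nonneg fun x => sq_nonneg _
  calc _ ≤ (ρ ^ d)⁻¹ * (C * ρ ^ (d + 2) * E + C' * K2) := by gcongr
    _ = C * ρ ^ 2 * E + (ρ ^ d)⁻¹ * C' * K2 := by rw [pow_add]; field_simp
    _ ≤ _ := by gcongr

end scal

section k2
variable {d : ℕ}

def vB (d : ℕ) : ℝ := volume.real (ball (0 : Eu d) 1)

lemma vB_pos (d : ℕ) : 0 < vB d := by
  unfold vB
  rw [measureReal_def]
  exact ENNReal.toReal_pos (measure_ball_pos _ _ one_pos).ne' measure_ball_lt_top.ne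

lemma ae_aff {P : Eu d → Prop} (h : ∀ᵐ y ∂(volume : Measure (Eu d)), P y) (x0 : Eu d) {r : ℝ} (hr : 0 < r) :
    ∀ᵐ x ∂(volume : Measure (Eu d)), P (x0 + r • x) := by
  rw [ae_iff] at h ⊢
  have : {x : Eu d | ¬ P (x0 + r • x)} = (r • ·) ⁻¹' ((x0 + ·) ⁻¹' {y | ¬ P y}) := by ext; simp
  rw [this, Measure.addHaar_preimage_smul _ hr.ne', measure_preimage_add, h, mul_zero]

lemma scl_ball {x0 : Eu d} (hx0 : x0 ∈ ball (0 : Eu d) (1/2)) {r : ℝ} (hr : 0 < r) (hr4 : r ≤ 1/4) {w : Eu d}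
    (hw : ‖w‖ ≤ 1) : x0 + r • w ∈ ball (0 : Eu d) (7/8) := by
  rw [mem_ball_zero_iff] at *
  have : ‖r • w‖ ≤ 1/4 := by
    rw [norm_smul, Real.norm_of_nonneg hr.le]
    nlinarith [norm_nonneg w]
  linarith [norm_add_le x0 (r • w)]

lemma holderM {p : ℝ} (hp : 2 < p) {u U : Eu d → ℝ} (hU : ContDiff ℝ 2 U)
    (hUu : ∀ x ∈ ball (0 : Eu d) (7/8), U x = u x)
    (hi : IntegrableOn (fun x => hessNorm u x ^ p) (ball (0 : Eu d) 1))
    {x0 : Eu d} (hx0 : x0 ∈ ball (0 : Eu d) (1/2)) {r : ℝ} (hr : 0 < r) (hr4 : r ≤ 1/4) :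
    ∫ x in ball (0 : Eu d) 1, hs U (x0 + r • x) ≤ vB d * (vB d)⁻¹ ^ (2 / p) * r ^ (-(2 * d / p)) * 
      ((∫ x in ball (0 : Eu d) 1, hessNorm u x ^ p) ^ (1 / p)) ^ 2 := by
  have b : ∀ s : ℝ, Bornology.IsBounded (ball (0 : Eu d) s) := fun s => isBounded_ball
  set I := ∫ x in ball (0 : Eu d) 1, hessNorm u x ^ p with hI
  have I0 : 0 ≤ I := integral_nonneg fun x => Real.rpow_nonneg (Real.sqrt_nonneg _) _
  have hc : Continuous fun x : Eu d => hs U (x0 + r • x) := (hs_cont hU).comp (by fun_prop)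
  have hcp : Continuous fun x : Eu d => hs U (x0 + r • x) ^ (p / 2) := hc.rpow_const fun x => Or.inr (by linarith)
  have vp := vB_pos d
  have hpow : ∀ t : ℝ, 0 ≤ t → t ^ (p / 2) = (Real.sqrt t) ^ p := fun t ht => by
    rw [Real.sqrt_eq_rpow, ← Real.rpow_mul ht]; congr 1; ring
  have J := (convexOn_rpow (p := p / 2) (by linarith)).map_set_average_le 
    (Real.continuous_rpow_const (by linarith)).continuousOn isClosed_Ici (measure_ball_pos volume (0 : Eu d) one_pos).ne' 
    measure_ball_lt_top.ne (f := fun x : Eu d => hs U (x0 + r • x)) (Eventually.of_forall fun x => hs_nonneg _ _) 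
    (cont_intOn hc (b _)) (cont_intOn hcp (b _))
  simp only [setAverage_eq, smul_eq_mul] at J
  change ((vB d)⁻¹ * _) ^ (p / 2) ≤ (vB d)⁻¹ * _ at J
  have h2 : ∫ x in ball (0 : Eu d) 1, hs U (x0 + r • x) ^ (p / 2) ≤ (r ^ d)⁻¹ * I := by
    rw [subst_ball (fun x => hs U x ^ (p / 2)) x0 hr]
    refine mul_le_mul_of_nonneg_left ?_ (by positivity)
    have sub : ball x0 r ⊆ ball (0 : Eu d) (7/8) := by
      refine ball_subset_ball' ?_
      rw [mem_ball] at hx0; linarith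
    have e : ∫ x in ball x0 r, hs U x ^ (p / 2) = ∫ x in ball x0 r, hessNorm u x ^ p := by
      refine setIntegral_congr_fun measurableSet_ball fun x hx => ?_
      have : hs U x = hs u x := by
        unfold hs
        simp only [fun i j => pd2_congr_open isOpen_ball hUu i j x (sub hx)]
      show hs U x ^ (p / 2) = _
      rw [this, hpow _ (hs_nonneg _ _)]; rfl
    rw [e]
    exact set_le (fun x => Real.rpow_nonneg (Real.sqrt_nonneg _) _) (sub.trans (ball_subset_ball (by norm_num))) hi
  set X := ∫ x in ball (0 : Eu d) 1, hs U (x0 + r • x) with hX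
  have X0 : 0 ≤ X := integral_nonneg fun x => hs_nonneg _ _
  have h3 : ((vB d)⁻¹ * X) ^ (p / 2) ≤ (vB d)⁻¹ * ((r ^ d)⁻¹ * I) := J.trans (by gcongr)
  have h4 : (vB d)⁻¹ * X ≤ ((vB d)⁻¹ * ((r ^ d)⁻¹ * I)) ^ (2 / p) := by
    have := Real.rpow_le_rpow (by positivity) h3 (z := 2 / p) (by positivity)
    rwa [← Real.rpow_mul (by positivity), show p / 2 * (2 / p) = 1 by field_simp, Real.rpow_one] at this
  have h5 : ((vB d)⁻¹ * ((r ^ d)⁻¹ * I)) ^ (2 / p) = (vB d)⁻¹ ^ (2 / p) * (r ^ (-(2 * d / p)) * (I ^ (1 / p)) ^ 2) := by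
    rw [Real.mul_rpow (by positivity) (by positivity), Real.mul_rpow (by positivity) (by positivity)]
    congr 2
    · rw [← Real.rpow_natCast, ← Real.rpow_neg hr.le, ← Real.rpow_mul hr.le]; congr 1; ring
    · rw [← Real.rpow_natCast, ← Real.rpow_mul I0]; congr 1; push_cast; ring
  rw [h5, inv_mul_le_iff₀ vp] at h4
  linarith

lemma zc_sub (i : Fin d) (x : Eu d) : ‖zc i x - x‖ ≤ ‖x‖ := by
  refine norm_le_of_coord fun j => ?_
  rw [PiLp.sub_apply, zc_apply]
  split_ifs with h
  · simp
  · simp [sq_nonneg]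

lemma zc_norm (i : Fin d) (x : Eu d) : ‖zc i x‖ ≤ ‖x‖ := by
  refine norm_le_of_coord fun j => ?_
  rw [zc_apply]
  split_ifs with h
  · simp [sq_nonneg]
  · simp

lemma K2bound {ν : ℝ} {a : Fin d → Fin d → Eu d → ℝ} {q : ℕ} {δ γ : ℝ} (hδ : 0 < δ) (hγ : 0 < γ) {Ka Kf : ℝ} (hKa : 0 ≤ Ka) (hKf : 0 ≤ Kf)
    (hA : ∀ i j, PHolderX d q δ (ball (0 : Eu d) 1) (a i j) Ka) {f : Eu d → ℝ} 
    (hF : PHolderX d q γ (ball (0 : Eu d) 1) f Kf) {U : Eu d → ℝ} (hU : ContDiff ℝ 2 U)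
    (heq : ∀ᵐ y ∂(volume : Measure (Eu d)), y ∈ ball (0 : Eu d) (7/8) → LL a U y = f y)
    {i : Fin d} (hiq : (i : ℕ) < q)
    {x0 : Eu d} (hx0 : x0 ∈ ball (0 : Eu d) (1/2)) {r : ℝ} (hr : 0 < r) (hr4 : r ≤ 1/4) {M : ℝ}
    (hM : ∫ x in ball (0 : Eu d) 1, hs U (x0 + r • x) ≤ M) :
    ∀ s ∈ Ioc (0:ℝ) (1/8), ∫ x in ball (0 : Eu d) (3/4), 
        (LL (fz x0 r i a) (scl x0 r U) (x + s • ev i) - LL (fz x0 r i a) (scl x0 r U) x) ^ 2 ≤ 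
      3 * (Kf * r ^ γ) ^ 2 * vB d + 6 * ((Ka * r ^ δ) ^ 2 * d ^ 2) * M := by
  intro s hs
  have b : ∀ s : ℝ, Bornology.IsBounded (ball (0 : Eu d) s) := fun s => isBounded_ball
  have hc : Continuous fun x : Eu d => _root_.hs U (x0 + r • x) := (hs_cont hU).comp (by fun_prop)
  have hc' : Continuous fun x : Eu d => _root_.hs U (x0 + r • (x + s • ev i)) := hc.comp (by fun_prop : Continuous fun x : Eu d => x + s • ev i)
  set η := Ka * r ^ δ with hη
  have sub : ball (0 : Eu d) (7/8) ⊆ ball 0 1 := ball_subset_ball (by norm_num)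
  have hae : ∀ᵐ x ∂(volume : Measure (Eu d)), x ∈ ball (0 : Eu d) (3/4) → 
      (LL (fz x0 r i a) (scl x0 r U) (x + s • ev i) - LL (fz x0 r i a) (scl x0 r U) x) ^ 2 ≤ 
      3 * (Kf * r ^ γ) ^ 2 + (3 * (η ^ 2 * d ^ 2) * _root_.hs U (x0 + r • (x + s • ev i)) + 3 * (η ^ 2 * d ^ 2) * _root_.hs U (x0 + r • x)) := by
    have h1 := ae_aff heq x0 hr
    have h2 := ae_aff heq (x0 + r • (s • ev i)) hr
    filter_upwards [h1, h2] with x e1 e2 hx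
    rw [show x0 + r • (s • ev i) + r • x = x0 + r • (x + s • ev i) by rw [smul_add]; abel] at e2
    set y := x0 + r • x with hy
    set y' := x0 + r • (x + s • ev i) with hy'
    have nx : ‖x‖ < 3/4 := mem_ball_zero_iff.1 hx
    have nx' : ‖x + s • ev i‖ ≤ 1 := by
      refine (norm_add_le _ _).trans ?_
      rw [norm_smul, norm_ev, Real.norm_of_nonneg hs.1.le]; linarith [hs.2]
    have my : y ∈ ball (0 : Eu d) (7/8) := scl_ball hx0 hr hr4 (by linarith)
    have my' : y' ∈ ball (0 : Eu d) (7/8) := scl_ball hx0 hr hr4 nx'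
    have mz : x0 + r • zc i x ∈ ball (0 : Eu d) (7/8) := scl_ball hx0 hr hr4 (by linarith [zc_norm i x])
    have e1 := e1 my
    have e2 := e2 my'
    have co : ∀ (w : Eu d), ‖w‖ ≤ 1 → x0 + r • w ∈ ball (0 : Eu d) (7/8) → ∀ k l, |a k l (x0 + r • zc i w) - a k l (x0 + r • w)| ≤ η := by
      intro w hw hwm k l
      refine (hA k l _ (sub (scl_ball hx0 hr hr4 ((zc_norm i w).trans hw))) _ (sub hwm) ?_).trans ?_
      · intro j hj
        have : j ≠ i := by rintro rfl; omega
        simp [zc_apply, this]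
      · refine mul_le_mul_of_nonneg_left (Real.rpow_le_rpow dist_nonneg ?_ hδ.le) hKa
        rw [dist_eq_norm, add_sub_add_left_eq_sub, ← smul_sub, norm_smul, Real.norm_of_nonneg hr.le]
        exact mul_le_of_le_one_right hr.le ((zc_sub i w).trans hw)
    have c1 := LL_sq_le (fun k l _ => a k l (x0 + r • zc i x) - a k l y) η U y (co x (by linarith) my)
    have c2 := LL_sq_le (fun k l _ => a k l (x0 + r • zc i (x + s • ev i)) - a k l y') η U y' (co _ nx' my')
    have ff : |f y' - f y| ≤ Kf * r ^ γ := by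
      refine (hF _ (sub my') _ (sub my) ?_).trans ?_
      · intro j hj
        have : j ≠ i := by rintro rfl; omega
        simp [hy, hy', ev, this]
      · refine mul_le_mul_of_nonneg_left (Real.rpow_le_rpow dist_nonneg ?_ hγ.le) hKf
        rw [dist_eq_norm, add_sub_add_left_eq_sub, ← smul_sub, norm_smul, Real.norm_of_nonneg hr.le, add_sub_cancel_left,
          norm_smul, norm_ev, Real.norm_of_nonneg hs.1.le]
        exact mul_le_of_le_one_right hr.le (by linarith [hs.2])
    have ff2 : (f y' - f y) ^ 2 ≤ (Kf * r ^ γ) ^ 2 := sq_le_sq' (by linarith [neg_abs_le (f y' - f y)]) ((le_abs_self _).trans ff)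
    have g1 : LL (fz x0 r i a) (scl x0 r U) x = f y + LL (fun k l _ => a k l (x0 + r • zc i x) - a k l y) U y := by
      rw [← e1]; unfold LL fz
      simp only [pd2_scl hU x0 hr, ← Finset.sum_add_distrib, ← hy]
      refine Finset.sum_congr rfl fun k _ => Finset.sum_congr rfl fun l _ => by ring
    have g2 : LL (fz x0 r i a) (scl x0 r U) (x + s • ev i) = f y' + LL (fun k l _ => a k l (x0 + r • zc i (x + s • ev i)) - a k l y') U y' := by
      rw [← e2]; unfold LL fz
      simp only [pd2_scl hU x0 hr, ← Finset.sum_add_distrib, ← hy']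
      refine Finset.sum_congr rfl fun k _ => Finset.sum_congr rfl fun l _ => by ring
    rw [g1, g2]
    set A1 := LL (fun k l _ => a k l (x0 + r • zc i x) - a k l y) U y
    set A2 := LL (fun k l _ => a k l (x0 + r • zc i (x + s • ev i)) - a k l y') U y'
    set F := f y' - f y with hFd
    have : f y' + A2 - (f y + A1) = F + A2 - A1 := by rw [hFd]; ring
    rw [this]
    nlinarith [sq_nonneg (F - A2), sq_nonneg (F + A1), sq_nonneg (A2 + A1)]
  have i1 : IntegrableOn (fun _ : Eu d => 3 * (Kf * r ^ γ) ^ 2) (ball (0 : Eu d) (3/4)) := cont_intOn continuous_const (b _)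
  have i2 := (cont_intOn hc' (b (3/4))).const_mul (3 * (η ^ 2 * d ^ 2))
  have i3 := (cont_intOn hc (b (3/4))).const_mul (3 * (η ^ 2 * d ^ 2))
  have m1 := integral_mono_of_nonneg (μ := volume.restrict (ball (0 : Eu d) (3/4))) 
    (Eventually.of_forall fun x => sq_nonneg _) (i1.add (i2.add i3)) ((ae_restrict_iff' measurableSet_ball).2 hae)
  refine m1.trans ?_
  have s1 : ∫ x in ball (0 : Eu d) (3/4), _root_.hs U (x0 + r • (x + s • ev i)) ≤ M := by
    refine (shift_le (h := fun x => _root_.hs U (x0 + r • x)) (fun x => hs_nonneg _ _) (A' := ball (0 : Eu d) 1) ?_ (cont_intOn hc (b _))).trans hM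
    intro x hx
    have := norm_shift (j := i) hx (L := 1/4) (s := s) (by rw [abs_of_nonneg hs.1.le]; linarith [hs.2])
    norm_num at this ⊢; exact this
  have s2 : ∫ x in ball (0 : Eu d) (3/4), _root_.hs U (x0 + r • x) ≤ M :=
    (set_le (fun x => hs_nonneg _ _) (ball_subset_ball (by norm_num)) (cont_intOn hc (b _))).trans hM
  have s3 : volume.real (ball (0 : Eu d) (3/4)) ≤ vB d := measureReal_mono (ball_subset_ball (by norm_num)) measure_ball_lt_top.ne
  have i23 : IntegrableOn (fun x => 3 * (η ^ 2 * d ^ 2) * _root_.hs U (x0 + r • (x + s • ev i)) + 3 * (η ^ 2 * d ^ 2) * _root_.hs U (x0 + r • x)) (ball (0 : Eu d) (3/4)) := i2.add i3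
  simp only [Pi.add_apply]
  rw [integral_add i1 i23, setIntegral_const, smul_eq_mul, integral_add i2 i3, integral_const_mul, integral_const_mul]
  have t1 := mul_le_mul_of_nonneg_right s3 (by positivity : 0 ≤ 3 * (Kf * r ^ γ) ^ 2)
  have t2 := mul_le_mul_of_nonneg_left s1 (by positivity : 0 ≤ 3 * (η ^ 2 * (d : ℝ) ^ 2))
  have t3 := mul_le_mul_of_nonneg_left s2 (by positivity : 0 ≤ 3 * (η ^ 2 * (d : ℝ) ^ 2))
  linarith

end k2

section decay
variable {d : ℕ}

lemma decay (d q : ℕ) (ν δ p : ℝ) (ω : ℝ → ℝ) (hd : 2 ≤ d) (hν : 0 < ν) (m : Fin d) (hδ : 0 < δ) (hδ1 : δ ≤ 1)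
    (hp : (d : ℝ) < p) (hγ : 0 < δ - (d : ℝ) / p)
    (hωmono : MonotoneOn ω (Ici (0 : ℝ)))
    (hωlim : Tendsto ω (nhdsWithin 0 (Ioi (0 : ℝ))) (nhds 0)) :
    ∃ ρ : ℝ, 0 < ρ ∧ ρ < 1/2 ∧ ∃ r0 : ℝ, 0 < r0 ∧ r0 ≤ 1/4 ∧ ∃ L : ℝ, 0 < L ∧ 
    ∀ (a : Fin d → Fin d → Eu d → ℝ) (u U f : Eu d → ℝ), Coef ν a →
      (∀ k l (x y : Eu d), x m = y m → |a k l x - a k l y| ≤ ω (dist x y)) → ∀ Ka : ℝ, 0 ≤ Ka →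
      (∀ i j, PHolderX d q δ (ball (0 : Eu d) 1) (a i j) Ka) → ContDiff ℝ 2 U → 
      (∀ x ∈ ball (0 : Eu d) (7/8), U x = u x) →
      IntegrableOn (fun x => hessNorm u x ^ p) (ball (0 : Eu d) 1) →
      (∀ᵐ y ∂(volume : Measure (Eu d)), y ∈ ball (0 : Eu d) (7/8) → LL a U y = f y) →
      ∀ Kf : ℝ, 0 ≤ Kf → PHolderX d q (δ - d / p) (ball (0 : Eu d) 1) f Kf →
      ∀ i : Fin d, (i : ℕ) < q → i ≠ m → ∀ x0 ∈ ball (0 : Eu d) (1/2), ∀ n : ℕ, ∃ c : Fin d → ℝ,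
        ∑ k, ∫ x in ball (0 : Eu d) 1, (pd2 i k U (x0 + (r0 * ρ ^ n) • x) - c k) ^ 2 ≤ 
        L * (Kf + (1 + Ka) * (∫ x in ball (0 : Eu d) 1, hessNorm u x ^ p) ^ (1 / p)) ^ 2 * (r0 * ρ ^ n) ^ (2 * (δ - d / p)) := by
  set γ := δ - d / p with hγd
  have dp : (0 : ℝ) < d := by exact_mod_cast (by omega : 0 < d)
  have p0 : 0 < p := dp.trans hp
  have p2 : 2 < p := lt_of_le_of_lt (by exact_mod_cast hd) hp
  have hγ1 : γ < 1 := by have : 0 < (d : ℝ) / p := by positivity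
                         linarith
  obtain ⟨ρ, hρ, hρ2, C, hC, η, hη, hstep⟩ := step d ν hν m γ hγ1
  have ev1 : ∀ᶠ r : ℝ in nhdsWithin 0 (Ioi 0), ω r < η := hωlim.eventually (gt_mem_nhds hη)
  have ev2 : ∀ᶠ r : ℝ in nhdsWithin 0 (Ioi 0), r ∈ Ioo (0 : ℝ) (1/4) := Ioo_mem_nhdsGT (by norm_num)
  obtain ⟨r0, hω0, hr0, hr04⟩ := (ev1.and ev2).exists
  have vp := vB_pos d
  set cM := vB d * (vB d)⁻¹ ^ (2 / p) with hcM
  have cM0 : 0 < cM := by positivity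
  set B := 3 * vB d + 6 * d ^ 2 * cM with hB
  have B0 : 0 < B := by positivity
  have ργ : 0 < ρ ^ (2 * γ) := Real.rpow_pos_of_pos hρ _
  have rγ : 0 < r0 ^ (2 * γ) := Real.rpow_pos_of_pos hr0 _
  have rd : 0 < r0 ^ (-(2 * d / p)) := Real.rpow_pos_of_pos hr0 _
  set L := cM * r0 ^ (-(2 * d / p)) / r0 ^ (2 * γ) + 2 * C * B / ρ ^ (2 * γ) with hL
  refine ⟨ρ, hρ, hρ2, r0, hr0, hr04.le, L, by positivity, ?_⟩
  intro a u U f ha hmod Ka hKa hA hU hUu hInt heq Kf hKf hF i hiq him x0 hx0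
  set P := (∫ x in ball (0 : Eu d) 1, hessNorm u x ^ p) ^ (1 / p) with hP
  have P0 : 0 ≤ P := Real.rpow_nonneg (integral_nonneg fun x => Real.rpow_nonneg (Real.sqrt_nonneg _) _) _
  set Z := Kf + (1 + Ka) * P with hZ
  have KP : 0 ≤ Ka * P := by positivity
  have Z0 : 0 ≤ Z := by positivity
  have Z1 : Kf ≤ Z := by rw [hZ]; nlinarith
  have Z2 : Ka * P ≤ Z := by rw [hZ]; nlinarith
  have Z3 : P ≤ Z := by rw [hZ]; nlinarith
  have hM : ∀ r : ℝ, 0 < r → r ≤ r0 → ∫ x in ball (0 : Eu d) 1, hs U (x0 + r • x) ≤ cM * r ^ (-(2 * d / p)) * P ^ 2 :=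
    fun r hr hr' => holderM p2 hU hUu hInt hx0 hr (by linarith)
  intro n
  induction n with
  | zero =>
    refine ⟨fun _ => 0, ?_⟩
    simp only [pow_zero, mul_one, sub_zero]
    have hc : ∀ k, Continuous fun x : Eu d => pd2 i k U (x0 + r0 • x) ^ 2 := fun k => 
      ((pd2_cont hU i k).comp (by fun_prop : Continuous fun x : Eu d => x0 + r0 • x)).pow 2
    have hc' : Continuous fun x : Eu d => hs U (x0 + r0 • x) := (hs_cont hU).comp (by fun_prop)
    rw [← integral_finsetSum _ fun k _ => cont_intOn (hc k) isBounded_ball]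
    have : ∫ x in ball (0 : Eu d) 1, ∑ k, pd2 i k U (x0 + r0 • x) ^ 2 ≤ ∫ x in ball (0 : Eu d) 1, hs U (x0 + r0 • x) := by
      refine integral_mono (integrable_finsetSum _ fun k _ => cont_intOn (hc k) isBounded_ball) (cont_intOn hc' isBounded_ball) fun x => ?_
      exact Finset.single_le_sum (f := fun i => ∑ k, pd2 i k U (x0 + r0 • x) ^ 2) (fun _ _ => Finset.sum_nonneg fun _ _ => sq_nonneg _) (Finset.mem_univ i)
    refine this.trans ((hM r0 hr0 le_rfl).trans ?_)
    calc cM * r0 ^ (-(2 * d / p)) * P ^ 2 ≤ cM * r0 ^ (-(2 * d / p)) * Z ^ 2 := by gcongr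
      _ = cM * r0 ^ (-(2 * d / p)) / r0 ^ (2 * γ) * Z ^ 2 * r0 ^ (2 * γ) := by field_simp
      _ ≤ _ := by
        gcongr
        rw [hL]; have : 0 < 2 * C * B / ρ ^ (2 * γ) := by positivity
        linarith
  | succ n ih =>
    obtain ⟨c, hc⟩ := ih
    set r := r0 * ρ ^ n with hr
    have r_pos : 0 < r := by positivity
    have r_le : r ≤ r0 := mul_le_of_le_one_right hr0.le (pow_le_one₀ hρ.le (by linarith))
    have hωr : ω r ≤ η := (hωmono (mem_Ici.2 r_pos.le) (mem_Ici.2 hr0.le) r_le).trans hω0.le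
    have rr : 0 < r ^ (2 * γ) := Real.rpow_pos_of_pos r_pos _
    have hK := K2bound (ν := ν) hδ hγ hKa hKf hA hF hU heq hiq hx0 r_pos (by linarith) (hM r r_pos r_le)
    have eγ : (r ^ γ) ^ 2 = r ^ (2 * γ) := by
      rw [← Real.rpow_natCast, ← Real.rpow_mul r_pos.le]; congr 1; push_cast; ring
    have eδ : (r ^ δ) ^ 2 * r ^ (-(2 * d / p)) = r ^ (2 * γ) := by
      rw [← Real.rpow_natCast, ← Real.rpow_mul r_pos.le, ← Real.rpow_add r_pos]; congr 1; rw [hγd]; push_cast; ring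
    have hK2 : 3 * (Kf * r ^ γ) ^ 2 * vB d + 6 * ((Ka * r ^ δ) ^ 2 * d ^ 2) * (cM * r ^ (-(2 * d / p)) * P ^ 2) ≤ B * Z ^ 2 * r ^ (2 * γ) := by
      calc _ = (3 * vB d * Kf ^ 2) * (r ^ γ) ^ 2 + 6 * d ^ 2 * cM * (Ka * P) ^ 2 * ((r ^ δ) ^ 2 * r ^ (-(2 * d / p))) := by ring
        _ = (3 * vB d * Kf ^ 2) * r ^ (2 * γ) + 6 * d ^ 2 * cM * (Ka * P) ^ 2 * r ^ (2 * γ) := by rw [eγ, eδ]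
        _ ≤ (3 * vB d * Z ^ 2) * r ^ (2 * γ) + 6 * d ^ 2 * cM * Z ^ 2 * r ^ (2 * γ) := by gcongr
        _ = _ := by rw [hB]; ring
    obtain ⟨c', hc'⟩ := hstep a ha ω r r_pos hωmono hωr hmod i him U hU x0 (B * Z ^ 2 * r ^ (2 * γ)) (by positivity)
      (fun s hs => (hK s hs).trans hK2) c
    refine ⟨c', ?_⟩
    have er : r0 * ρ ^ (n + 1) = r * ρ := by rw [hr, pow_succ]; ring
    rw [er]
    refine hc'.trans ?_
    rw [Real.mul_rpow r_pos.le hρ.le]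
    have LB : C * B ≤ L * ρ ^ (2 * γ) / 2 := by
      have : 2 * C * B / ρ ^ (2 * γ) ≤ L := by
        rw [hL]; have : 0 < cM * r0 ^ (-(2 * d / p)) / r0 ^ (2 * γ) := by positivity
        linarith
      rw [div_le_iff₀ ργ] at this
      linarith
    calc _ ≤ ρ ^ (2 * γ) / 2 * (L * Z ^ 2 * r ^ (2 * γ)) + (C * B) * (Z ^ 2 * r ^ (2 * γ)) := by
          have := mul_le_mul_of_nonneg_left hc (by positivity : 0 ≤ ρ ^ (2 * γ) / 2)
          linarith
      _ ≤ ρ ^ (2 * γ) / 2 * (L * Z ^ 2 * r ^ (2 * γ)) + (L * ρ ^ (2 * γ) / 2) * (Z ^ 2 * r ^ (2 * γ)) := by gcongr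
      _ = _ := by ring

end decay

section camp
variable {d : ℕ}

lemma const_cmp {φ : Eu d → ℝ} (hφ : Continuous φ) (c c' : ℝ) :
    (c - c') ^ 2 * vB d ≤ 2 * (∫ x in ball (0 : Eu d) 1, (φ x - c) ^ 2) + 2 * ∫ x in ball (0 : Eu d) 1, (φ x - c') ^ 2 := by
  have := set_le2 (measurableSet_ball (x := (0 : Eu d)) (ε := 1)) (f := fun _ => (c - c') ^ 2)
    (g1 := fun x => (φ x - c) ^ 2) (g2 := fun x => (φ x - c') ^ 2)
    (cont_intOn continuous_const isBounded_ball)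
    (cont_intOn ((hφ.sub continuous_const).pow 2) isBounded_ball)
    (cont_intOn ((hφ.sub continuous_const).pow 2) isBounded_ball) 2 2 fun x _ => by
      nlinarith [sq_nonneg (2 * φ x - c - c')]
  rw [setIntegral_const, smul_eq_mul, mul_comm] at this
  exact this

lemma absq {t v k A w : ℝ} (hv : 0 < v) (hA : 0 ≤ A) (hw : 0 ≤ w) (h : t ^ 2 * v ≤ k * A ^ 2 * w ^ 2) :
    |t| ≤ √(k / v) * A * w := by
  have h1 : t ^ 2 ≤ k / v * (A * w) ^ 2 := by
    rw [div_mul_eq_mul_div, le_div_iff₀ hv]; linarith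
  have := Real.abs_le_sqrt h1
  rwa [Real.sqrt_mul' _ (sq_nonneg _), Real.sqrt_sq (by positivity), ← mul_assoc] at this

lemma camp_osc (d : ℕ) (γ ρ r0 : ℝ) (hγ : 0 < γ) (hρ : 0 < ρ) (hρ1 : ρ < 1) (hr0 : 0 < r0) :
    ∃ G : ℝ, 0 < G ∧ ∀ h : Eu d → ℝ, Continuous h → ∀ A : ℝ, 0 ≤ A → ∀ x0 : Eu d,
      (∀ n : ℕ, ∃ c : ℝ, ∫ x in ball (0 : Eu d) 1, (h (x0 + (r0 * ρ ^ n) • x) - c) ^ 2 ≤ A ^ 2 * ((r0 * ρ ^ n) ^ γ) ^ 2) →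
      ∀ n : ℕ, ∫ x in ball (0 : Eu d) 1, (h (x0 + (r0 * ρ ^ n) • x) - h x0) ^ 2 ≤ G * A ^ 2 * ((r0 * ρ ^ n) ^ γ) ^ 2 := by
  have vp := vB_pos d
  have ργ : 0 < ρ ^ γ := Real.rpow_pos_of_pos hρ _
  have ργ1 : ρ ^ γ < 1 := Real.rpow_lt_one hρ.le hρ1 hγ
  have ρd : 1 ≤ (ρ ^ d)⁻¹ := (one_le_inv₀ (by positivity)).2 (pow_le_one₀ hρ.le hρ1.le)
  set K := √(4 * (ρ ^ d)⁻¹ / vB d) with hK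
  have K0 : 0 ≤ K := Real.sqrt_nonneg _
  set Lc := K / (1 - ρ ^ γ) with hLc
  have q0 : 0 < 1 - ρ ^ γ := by linarith
  have Lc0 : 0 ≤ Lc := by positivity
  have LK : K = Lc * (1 - ρ ^ γ) := by rw [hLc]; field_simp
  refine ⟨2 + 2 * Lc ^ 2 * vB d, by positivity, fun h hh A hA x0 hyp n => ?_⟩
  choose c hc using hyp
  set R : ℕ → ℝ := fun n => r0 * ρ ^ n with hR
  have Rp : ∀ n, 0 < R n := fun n => by positivity
  have Rg : ∀ n, 0 < R n ^ γ := fun n => Real.rpow_pos_of_pos (Rp n) _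
  have RS : ∀ n, R (n + 1) = R n * ρ := fun n => by simp only [hR, pow_succ]; ring
  have RSg : ∀ n, R (n + 1) ^ γ = R n ^ γ * ρ ^ γ := fun n => by rw [RS, Real.mul_rpow (Rp n).le hρ.le]
  have hcont : ∀ t : ℝ, Continuous fun x : Eu d => h (x0 + t • x) := fun t => hh.comp (by fun_prop)
  replace hc : ∀ n, ∫ x in ball (0 : Eu d) 1, (h (x0 + R n • x) - c n) ^ 2 ≤ A ^ 2 * (R n ^ γ) ^ 2 := hc
  have step : ∀ n, |c n - c (n + 1)| ≤ K * A * R n ^ γ := by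
    intro n
    refine absq vp hA (Rg n).le ((const_cmp (hcont (R (n + 1))) _ _).trans ?_)
    have e : ∫ x in ball (0 : Eu d) 1, (h (x0 + R (n + 1) • x) - c n) ^ 2 ≤ (ρ ^ d)⁻¹ * (A ^ 2 * (R n ^ γ) ^ 2) := by
      have := subst_ball (fun x => (h (x0 + R n • x) - c n) ^ 2) 0 hρ
      simp only [zero_add, smul_smul, ← RS] at this
      rw [this]
      refine mul_le_mul_of_nonneg_left (le_trans ?_ (hc n)) (by positivity)
      exact set_le (fun x => sq_nonneg _) (ball_subset_ball hρ1.le) (cont_intOn (((hcont (R n)).sub continuous_const).pow 2) isBounded_ball)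
    have e2 : A ^ 2 * (R (n + 1) ^ γ) ^ 2 ≤ (ρ ^ d)⁻¹ * (A ^ 2 * (R n ^ γ) ^ 2) := by
      have : R (n + 1) ^ γ ≤ R n ^ γ := by rw [RSg]; exact mul_le_of_le_one_right (Rg n).le ργ1.le
      calc _ ≤ A ^ 2 * (R n ^ γ) ^ 2 := by have := (Rg (n+1)).le; gcongr
        _ ≤ _ := le_mul_of_one_le_left (by positivity) ρd
    have := hc (n + 1)
    linarith
  have Rlim : Tendsto R atTop (nhds 0) := by
    have := (tendsto_pow_atTop_nhds_zero_of_lt_one hρ.le hρ1).const_mul r0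
    simpa using this
  have Rglim : Tendsto (fun n => R n ^ γ) atTop (nhds 0) := by
    have := ((Real.continuousAt_rpow_const 0 γ (Or.inr hγ.le)).tendsto).comp Rlim
    rwa [Real.zero_rpow hγ.ne'] at this
  have clim : Tendsto (fun n => |c n - h x0|) atTop (nhds 0) := by
    set G : ℝ → ℝ := fun t => ∫ x in closedBall (0 : Eu d) 1, (h (x0 + t • x) - h x0) ^ 2 with hG
    have Gc : Continuous G := by
      refine continuous_parametric_integral_of_continuous (f := fun (t : ℝ) (x : Eu d) => (h (x0 + t • x) - h x0) ^ 2) ?_ (isCompact_closedBall _ _)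
      have : Continuous fun p : ℝ × Eu d => h (x0 + p.1 • p.2) := hh.comp (by fun_prop)
      exact (this.sub continuous_const).pow 2
    have Glim : Tendsto (fun n => G (R n)) atTop (nhds 0) := by
      have := (Gc.tendsto 0).comp Rlim
      simpa [hG, Function.comp_def] using this
    have up : ∀ n, (c n - h x0) ^ 2 ≤ (2 * (A ^ 2 * (R n ^ γ) ^ 2) + 2 * G (R n)) / vB d := by
      intro n
      rw [le_div_iff₀ vp]
      refine (const_cmp (hcont (R n)) _ _).trans ?_
      have := hc n
      have : ∫ x in ball (0 : Eu d) 1, (h (x0 + R n • x) - h x0) ^ 2 ≤ G (R n) :=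
        set_le (fun x => sq_nonneg _) ball_subset_closedBall (cont_intOn (((hcont (R n)).sub continuous_const).pow 2) isBounded_closedBall)
      linarith
    have l2 : Tendsto (fun n => (2 * (A ^ 2 * (R n ^ γ) ^ 2) + 2 * G (R n)) / vB d) atTop (nhds 0) := by
      have := ((((Rglim.pow 2).const_mul (A ^ 2)).const_mul 2).add (Glim.const_mul 2)).div_const (vB d)
      simpa using this
    have l3 := squeeze_zero (fun n => sq_nonneg _) up l2
    have l4 := (Real.continuous_sqrt.tendsto 0).comp l3
    simpa [Function.comp_def, Real.sqrt_sq_eq_abs] using l4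
  have mono : Monotone fun n => |c n - h x0| - Lc * A * R n ^ γ := by
    refine monotone_nat_of_le_succ fun n => ?_
    have t := abs_sub_le (c n) (c (n + 1)) (h x0)
    have s := step n
    rw [LK] at s
    simp only [RSg]
    linarith
  have lim0 : Tendsto (fun n => |c n - h x0| - Lc * A * R n ^ γ) atTop (nhds 0) := by
    have := clim.sub (Rglim.const_mul (Lc * A))
    simpa using this
  have fin : |c n - h x0| ≤ Lc * A * R n ^ γ := by
    have : |c n - h x0| - Lc * A * R n ^ γ ≤ 0 := mono.ge_of_tendsto lim0 n
    linarith
  have fin2 : (c n - h x0) ^ 2 ≤ (Lc * A * R n ^ γ) ^ 2 := by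
    rw [← sq_abs]; gcongr
  have last := set_le2 (measurableSet_ball (x := (0 : Eu d)) (ε := 1)) (f := fun x => (h (x0 + R n • x) - h x0) ^ 2)
    (g1 := fun x => (h (x0 + R n • x) - c n) ^ 2) (g2 := fun x => (c n - h x0) ^ 2)
    (cont_intOn (((hcont (R n)).sub continuous_const).pow 2) isBounded_ball)
    (cont_intOn (((hcont (R n)).sub continuous_const).pow 2) isBounded_ball)
    (cont_intOn continuous_const isBounded_ball) 2 2 fun x _ => by
      nlinarith [sq_nonneg (h (x0 + R n • x) - 2 * c n + h x0)]
  rw [setIntegral_const, smul_eq_mul] at last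
  change _ ≤ _ + 2 * (vB d * _) at last
  have t1 := hc n
  have t2 := mul_le_mul_of_nonneg_left fin2 vp.le
  refine last.trans ?_
  calc _ ≤ 2 * (A ^ 2 * (R n ^ γ) ^ 2) + 2 * (vB d * (Lc * A * R n ^ γ) ^ 2) := by linarith
    _ = _ := by ring

lemma camp (d : ℕ) (γ ρ r0 : ℝ) (hγ : 0 < γ) (hρ : 0 < ρ) (hρ1 : ρ < 1) (hr0 : 0 < r0) :
    ∃ N : ℝ, 0 < N ∧ ∀ h : Eu d → ℝ, Continuous h → ∀ A : ℝ, 0 ≤ A → (∀ x0 ∈ ball (0 : Eu d) (1/2),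
      ∀ n : ℕ, ∃ c : ℝ, ∫ x in ball (0 : Eu d) 1, (h (x0 + (r0 * ρ ^ n) • x) - c) ^ 2 ≤ A ^ 2 * ((r0 * ρ ^ n) ^ γ) ^ 2) →
      ∀ x ∈ ball (0 : Eu d) (1/2), ∀ y ∈ ball (0 : Eu d) (1/2), |h x - h y| ≤ N * A * dist x y ^ γ := by
  obtain ⟨G, hG, hosc⟩ := camp_osc d γ ρ r0 hγ hρ hρ1 hr0
  have vp := vB_pos d
  have ργ : 0 < ρ ^ γ := Real.rpow_pos_of_pos hρ _
  set K := √(4 * ((1/2 : ℝ) ^ d)⁻¹ * G / vB d) with hK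
  have K0 : 0 < K := Real.sqrt_pos.2 (by positivity)
  obtain ⟨M, hM⟩ := exists_nat_gt (1 / r0)
  have M0 : (0 : ℝ) < M := lt_trans (by positivity) hM
  have M1 : (1 : ℝ) ≤ M := by
    have : 0 < M := by exact_mod_cast M0
    exact_mod_cast this
  have Mr : 1 / (M : ℝ) ≤ r0 := by rw [div_le_iff₀ M0]; rw [div_lt_iff₀ hr0] at hM; linarith
  refine ⟨M * (K / ρ ^ γ), by positivity, fun h hh A hA hyp => ?_⟩
  -- local estimate
  have loc : ∀ x ∈ ball (0 : Eu d) (1/2), ∀ y ∈ ball (0 : Eu d) (1/2), ∀ n : ℕ, dist x y ≤ r0 * ρ ^ n → 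
      |h x - h y| ≤ K * A * (r0 * ρ ^ n) ^ γ := by
    intro x hx y hy n hxy
    set R := r0 * ρ ^ n with hR
    have Rp : 0 < R := by positivity
    set z : Eu d := (1/2 : ℝ) • (x + y) with hz
    have half : ∀ x' ∈ ball (0 : Eu d) (1/2), ‖z - x'‖ ≤ R / 2 → 
        ∫ w in ball (0 : Eu d) 1, (h (z + (R / 2) • w) - h x') ^ 2 ≤ ((1/2 : ℝ) ^ d)⁻¹ * (G * A ^ 2 * (R ^ γ) ^ 2) := by
      intro x' hx' hzx
      have hcx : Continuous fun w : Eu d => h (x' + R • w) := hh.comp (by fun_prop)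
      have := subst_ball (fun w => (h (x' + R • w) - h x') ^ 2) (R⁻¹ • (z - x')) (by norm_num : (0:ℝ) < 1/2)
      have e : ∀ w : Eu d, x' + R • (R⁻¹ • (z - x') + (1/2 : ℝ) • w) = z + (R / 2) • w := by
        intro w
        rw [smul_add, smul_inv_smul₀ Rp.ne', smul_smul]
        rw [show R * (1/2) = R / 2 by ring]; abel
      simp only [e] at this
      rw [this]
      refine mul_le_mul_of_nonneg_left (le_trans ?_ (hosc h hh A hA x' (hyp x' hx') n)) (by positivity)
      refine set_le (fun x => sq_nonneg _) (ball_subset_ball' ?_) (cont_intOn ((hcx.sub continuous_const).pow 2) isBounded_ball)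
      rw [dist_zero_right, norm_smul, norm_inv, Real.norm_of_nonneg Rp.le]
      have : R⁻¹ * ‖z - x'‖ ≤ 1/2 := by
        rw [inv_mul_le_iff₀ Rp]; linarith
      linarith
    have nx : ‖z - x‖ ≤ R / 2 := by
      have : z - x = (1/2 : ℝ) • (y - x) := by rw [hz]; module
      rw [this, norm_smul, ← dist_eq_norm, dist_comm]; norm_num; linarith
    have ny : ‖z - y‖ ≤ R / 2 := by
      have : z - y = (1/2 : ℝ) • (x - y) := by rw [hz]; module
      rw [this, norm_smul, ← dist_eq_norm]; norm_num; linarith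
    have hcz : Continuous fun w : Eu d => h (z + (R / 2) • w) := hh.comp (by fun_prop)
    refine absq vp hA (Real.rpow_nonneg Rp.le _) ((const_cmp hcz _ _).trans ?_)
    have := half x hx nx
    have := half y hy ny
    linarith
  have loc2 : ∀ x ∈ ball (0 : Eu d) (1/2), ∀ y ∈ ball (0 : Eu d) (1/2), dist x y ≤ r0 → 
      |h x - h y| ≤ K / ρ ^ γ * A * dist x y ^ γ := by
    intro x hx y hy hxy
    by_cases hne : x = y
    · subst hne; simp [Real.zero_rpow hγ.ne']
    have dp : 0 < dist x y := dist_pos.2 hne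
    obtain ⟨n, hn1, hn2⟩ := exists_nat_pow_near_of_lt_one (x := dist x y / r0) (y := ρ) (by positivity) ((div_le_one hr0).2 hxy) hρ hρ1
    rw [lt_div_iff₀ hr0] at hn1
    rw [div_le_iff₀ hr0] at hn2
    refine (loc x hx y hy n (by linarith)).trans ?_
    have : (r0 * ρ ^ n) ^ γ ≤ dist x y ^ γ / ρ ^ γ := by
      rw [le_div_iff₀ ργ, ← Real.mul_rpow (by positivity) hρ.le]
      refine Real.rpow_le_rpow (by positivity) ?_ hγ.le
      rw [pow_succ] at hn1; linarith
    calc _ ≤ K * A * (dist x y ^ γ / ρ ^ γ) := by gcongr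
      _ = _ := by ring
  intro x hx y hy
  let P : ℕ → Eu d := fun j => x + ((j : ℝ) / M) • (y - x)
  have Pm : ∀ j ≤ M, P j ∈ ball (0 : Eu d) (1/2) := fun j hj => 
    (convex_ball (0 : Eu d) (1/2)).add_smul_sub_mem hx hy ⟨by positivity, (div_le_one M0).2 (by exact_mod_cast hj)⟩
  have dxy : dist x y ≤ 1 := by
    rw [mem_ball_zero_iff] at hx hy
    rw [dist_eq_norm]; linarith [norm_sub_le x y]
  have Pd : ∀ j, dist (P j) (P (j + 1)) = dist x y / M := by
    intro j
    have : P j - P (j + 1) = (M : ℝ)⁻¹ • (x - y) := by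
      simp only [P]; push_cast; rw [add_div, one_div]; module
    rw [dist_eq_norm, this, norm_smul, norm_inv, Real.norm_of_nonneg M0.le, ← dist_eq_norm, div_eq_inv_mul]
  have ch := dist_le_range_sum_of_dist_le (f := fun j => h (P j)) (d := fun _ => K / ρ ^ γ * A * dist x y ^ γ) M (by
    intro j hj
    rw [Real.dist_eq]
    refine (loc2 _ (Pm j hj.le) _ (Pm (j + 1) hj) ?_).trans ?_
    · rw [Pd]; refine le_trans ?_ Mr; gcongr
    · rw [Pd]
      have : dist x y / M ≤ dist x y := div_le_self dist_nonneg M1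
      gcongr)
  have e0 : P 0 = x := by simp [P]
  have eM : P M = y := by simp [P, M0.ne']
  rw [e0, eM, Finset.sum_const, Finset.card_range, nsmul_eq_mul, Real.dist_eq] at ch
  linarith

end camp

section cutoff
variable {d : ℕ}

lemma cutoff_ext {u : Eu d → ℝ} (hu : ContDiffOn ℝ 2 u (ball (0 : Eu d) 1)) :
    ∃ U : Eu d → ℝ, ContDiff ℝ 2 U ∧ ∀ x ∈ ball (0 : Eu d) (7/8), U x = u x := by
  let χ : ContDiffBump (0 : Eu d) := ⟨7/8, 15/16, by norm_num, by norm_num⟩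
  refine ⟨fun x => χ x * u x, ?_, ?_⟩
  · rw [contDiff_iff_contDiffAt]
    intro x
    by_cases hx : x ∈ ball (0 : Eu d) 1
    · exact χ.contDiff.contDiffAt.mul (hu.contDiffAt (isOpen_ball.mem_nhds hx))
    · have hx' : x ∈ (closedBall (0 : Eu d) (15/16))ᶜ := by
        simp only [mem_ball, not_lt, mem_compl_iff, mem_closedBall, not_le] at hx ⊢
        linarith
      have : (fun x => χ x * u x) =ᶠ[nhds x] fun _ => (0 : ℝ) := by
        filter_upwards [isClosed_closedBall.isOpen_compl.mem_nhds hx'] with y hy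
        have : χ y = 0 := χ.zero_of_le_dist (by
          simp only [mem_compl_iff, mem_closedBall, not_le] at hy
          exact hy.le)
        simp [this]
      exact contDiffAt_const.congr_of_eventuallyEq this
  · intro x hx
    have : χ x = 1 := χ.one_of_mem_closedBall (ball_subset_closedBall hx)
    simp [this]

end cutoff

/-- **Theorem 2.7 (i)**: for non-divergence form elliptic equations with coefficients
uniformly continuous in `(x¹,…,x^{d-1})` (modulus `ω`), merely measurable in `x^d`, and
`δ`-Hölder in `x'`, all derivatives `D D_{x'} u` of a solution are `γ`-Hölder continuous
with `γ = δ - d/p`. -/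
theorem partial_schauder_elliptic_one_bad_direction
    (d q : ℕ) (ν δ p : ℝ) (ω : ℝ → ℝ)
    (hd : 2 ≤ d) (hq1 : 1 ≤ q) (hqd : q < d)
    (hν : ν ∈ Ioc (0 : ℝ) 1) (hδ : δ ∈ Ioc (0 : ℝ) 1)
    (hp : (d : ℝ) < p) (hγ : 0 < δ - (d : ℝ) / p)
    (hω0 : ∀ r, 0 ≤ ω r) (hωmono : MonotoneOn ω (Ici (0 : ℝ)))
    (hωlim : Tendsto ω (nhdsWithin 0 (Ioi (0 : ℝ))) (nhds 0)) :
    ∃ N : ℝ, 0 < N ∧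
      ∀ (a : Fin d → Fin d → EuclideanSpace ℝ (Fin d) → ℝ)
        (u f : EuclideanSpace ℝ (Fin d) → ℝ),
        (∀ i j, Measurable (a i j)) →
        (∀ i j x, a i j x = a j i x) →
        UnifElliptic d ν a →
        -- uniform continuity in `(x¹,…,x^{d-1})` with modulus `ω`
        (∀ (i j : Fin d) (x y : EuclideanSpace ℝ (Fin d)),
          x (⟨d - 1, by omega⟩ : Fin d) = y (⟨d - 1, by omega⟩ : Fin d) →
          |a i j x - a i j y| ≤ ω (dist x y)) →
        ∀ Ka : ℝ, 0 ≤ Ka →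
        (∀ i j, PHolderX d q δ (ball (0 : EuclideanSpace ℝ (Fin d)) 1) (a i j) Ka) →
        ContDiffOn ℝ 2 u (ball (0 : EuclideanSpace ℝ (Fin d)) 1) →
        IntegrableOn (fun x => hessNorm u x ^ p)
          (ball (0 : EuclideanSpace ℝ (Fin d)) 1) →
        (∀ᵐ x ∂(volume.restrict (ball (0 : EuclideanSpace ℝ (Fin d)) 1)),
          ∑ i, ∑ j, a i j x * pd2 i j u x = f x) →
        ∀ Kf : ℝ, 0 ≤ Kf →
          PHolderX d q (δ - (d : ℝ) / p) (ball (0 : EuclideanSpace ℝ (Fin d)) 1) f Kf →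
          ∀ i k : Fin d, (i : ℕ) < q →
            HolderB (δ - (d : ℝ) / p) (ball (0 : EuclideanSpace ℝ (Fin d)) (1/2))
              (pd2 k i u)
              (N * (Kf + (1 + Ka) *
                (∫ x in ball (0 : EuclideanSpace ℝ (Fin d)) 1,
                    hessNorm u x ^ p) ^ (1/p))) := by
  obtain ⟨ρ, hρ, hρ2, r0, hr0, hr04, L, hL, H⟩ :=
    decay d q ν δ p ω hd hν.1 ⟨d - 1, by omega⟩ hδ.1 hδ.2 hp hγ hωmono hωlim
  obtain ⟨N, hN, C⟩ := camp d (δ - (d : ℝ) / p) ρ r0 hγ hρ (by linarith) hr0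
  refine ⟨N * Real.sqrt L, by positivity, ?_⟩
  intro a u f hm hs he hω Ka hKa ha hu hInt heq Kf hKf hf i k hi
  obtain ⟨U, hU, hUu⟩ := cutoff_ext hu
  have hUeq : ∀ x ∈ ball (0 : Eu d) (7/8), ∀ k l, pd2 k l U x = pd2 k l u x := fun x hx k l =>
    pd2_congr_open isOpen_ball hUu k l x hx
  have hLU : ∀ᵐ y ∂(volume : Measure (Eu d)), y ∈ ball (0 : Eu d) (7/8) → LL a U y = f y := by
    rw [ae_restrict_iff' measurableSet_ball] at heq
    filter_upwards [heq] with y hy hy2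
    rw [← hy (ball_subset_ball (by norm_num) hy2)]
    simp only [LL, hUeq y hy2]
  have him : i ≠ (⟨d - 1, by omega⟩ : Fin d) := by
    intro h
    have h2 := congrArg Fin.val h
    simp only at h2
    omega
  have D := H a u U f ⟨hm, hs, he⟩ hω Ka hKa ha hU hUu hInt hLU Kf hKf hf i hi him
  set Z := Kf + (1 + Ka) * (∫ x in ball (0 : EuclideanSpace ℝ (Fin d)) 1, hessNorm u x ^ p) ^ (1/p) with hZ
  have hP : 0 ≤ ∫ x in ball (0 : EuclideanSpace ℝ (Fin d)) 1, hessNorm u x ^ p :=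
    integral_nonneg fun x => Real.rpow_nonneg (Real.sqrt_nonneg _) _
  have hZ0 : 0 ≤ Z := by positivity
  have key := C (pd2 i k U) (pd2_cont hU i k) (Real.sqrt L * Z) (by positivity) (by
    intro x0 hx0 n
    obtain ⟨c, hc⟩ := D x0 hx0 n
    refine ⟨c k, ?_⟩
    have h1 := Finset.single_le_sum (s := Finset.univ)
      (f := fun k => ∫ x in ball (0 : Eu d) 1, (pd2 i k U (x0 + (r0 * ρ ^ n) • x) - c k) ^ 2)
      (fun k _ => integral_nonneg fun x => sq_nonneg _) (Finset.mem_univ k)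
    refine (h1.trans hc).trans (le_of_eq ?_)
    rw [mul_pow, Real.sq_sqrt hL.le, ← Real.rpow_mul_natCast (by positivity)]
    push_cast
    rw [mul_comm (2 : ℝ)])
  intro x hx y hy
  have sub : ∀ x ∈ ball (0 : Eu d) (1/2), pd2 k i u x = pd2 i k U x := fun x hx => by
    rw [← hUeq x (ball_subset_ball (by norm_num) hx), pd2_symm hU]
  rw [sub x hx, sub y hy]
  refine (key x hx y hy).trans (le_of_eq ?_)
  ring
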